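/- Let n ≥ 2, 0 ≤ q ≤ n, s, k positive integers, 0 < λ < λ' < 1, δ > n/2, μ > 0, T > 0, and let w ∈ F^{k,s(s,λ,λ',δ)}_{T,Λ^q}. Then the operator I + Ψ_{μ,q} B_q(w,·) : F^{k,s(s,λ,λ',δ)}_{T,Λ^q} → F^{k,s(s,λ,λ',δ)}_{T,Λ^q} is continuously invertible (bijective with bounded inverse). -/

import Mathlib

open scoped BigOperators ENNReal Classical
open Filter MeasureTheory

noncomputable section

namespace NSdeRham

/-- Euclidean space `ℝⁿ`. -/
abbrev Spc (n : ℕ) := EuclideanSpace ℝ (Fin n)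

variable {n : ℕ}

/-- The weight `w(x) = √(1+|x|²)`. -/
def wt (x : Spc n) : ℝ := Real.sqrt (1 + ‖x‖ ^ 2)

/-- `w(x,y) = max (w x) (w y)`. -/
def wt2 (x y : Spc n) : ℝ := max (wt x) (wt y)

/-- Partial derivative in the `i`-th coordinate direction. -/
def pd (i : Fin n) (f : Spc n → ℝ) (x : Spc n) : ℝ :=
  fderiv ℝ f x (EuclideanSpace.single i 1)

/-- The Laplace operator `Δ = ∑ ∂²/∂xᵢ²`. -/
def lap (f : Spc n → ℝ) (x : Spc n) : ℝ := ∑ i : Fin n, pd i (pd i f) x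

section enorms

variable {F : Type*} [NormedAddCommGroup F]

/-- Weighted sup-"norm" `sup_x w(x)^δ ‖g x‖` (with values in `ℝ≥0∞`). -/
def eWSup (δ : ℝ) (g : Spc n → F) : ℝ≥0∞ :=
  ⨆ x : Spc n, ENNReal.ofReal (wt x ^ δ * ‖g x‖)

/-- Weighted Hölder seminorm `⟨g⟩_{λ,δ}`. -/
def eWHold (lam δ : ℝ) (g : Spc n → F) : ℝ≥0∞ :=
  ⨆ (x : Spc n) (y : Spc n) (_ : x ≠ y ∧ ‖x - y‖ ≤ ‖x‖ / 2),
    ENNReal.ofReal (wt2 x y ^ (δ + lam) * ‖g x - g y‖ / ‖x - y‖ ^ lam)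

/-- The ordinary Hölder norm on the (closed) unit ball around the origin. -/
def eOHold (lam : ℝ) (g : Spc n → F) : ℝ≥0∞ :=
  (⨆ (x : Spc n) (_ : ‖x‖ ≤ 1), ENNReal.ofReal ‖g x‖) +
    ⨆ (x : Spc n) (y : Spc n) (_ : ‖x‖ ≤ 1 ∧ ‖y‖ ≤ 1 ∧ x ≠ y),
      ENNReal.ofReal (‖g x - g y‖ / ‖x - y‖ ^ lam)

/-- The norm of `C^{0,λ,δ}`; for `λ = 0` this is just the weighted sup-norm. -/
def eHol0 (lam δ : ℝ) (g : Spc n → F) : ℝ≥0∞ :=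
  if lam = 0 then eWSup δ g else eOHold lam g + eWSup δ g + eWHold lam δ g

/-- The norm of the base anisotropic space `C^{𝐬(0,λ,δ)}_T`. -/
def eAniso0 (T lam δ : ℝ) (v : ℝ → Spc n → F) : ℝ≥0∞ :=
  (⨆ t : Set.Icc (0 : ℝ) T, eHol0 lam δ (v t)) +
    if lam = 0 then 0 else
      ⨆ (t₁ : Set.Icc (0 : ℝ) T) (t₂ : Set.Icc (0 : ℝ) T) (_ : (t₁ : ℝ) ≠ (t₂ : ℝ))
        (x : Spc n),
        ENNReal.ofReal (wt x ^ δ * ‖v t₁ x - v t₂ x‖ / |(t₁ : ℝ) - (t₂ : ℝ)| ^ (lam / 2))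

end enorms

/-- The norm of the static weighted Hölder space `C^{s,λ,δ}`. -/
def eHolS (s : ℕ) (lam δ : ℝ) (g : Spc n → ℝ) : ℝ≥0∞ :=
  ∑ m ∈ Finset.range (s + 1), eHol0 lam (δ + m) (iteratedFDeriv ℝ m g)

/-- Membership in the static weighted Hölder space `C^{s,λ,δ}`. -/
def HolSMem (s : ℕ) (lam δ : ℝ) (g : Spc n → ℝ) : Prop :=
  ContDiff ℝ s g ∧ eHolS s lam δ g ≠ ⊤

/-- Time derivative of order `j` (within `[0,T]`). -/
def tDeriv (T : ℝ) (j : ℕ) (u : ℝ → Spc n → ℝ) (t : ℝ) (x : Spc n) : ℝ :=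
  iteratedDerivWithin j (fun τ => u τ x) (Set.Icc 0 T) t

/-- Mixed derivative `∂_x^m ∂_t^j`. -/
def mixDeriv (T : ℝ) (m j : ℕ) (u : ℝ → Spc n → ℝ) (t : ℝ) :
    Spc n → ContinuousMultilinearMap ℝ (fun _ : Fin m => Spc n) ℝ :=
  iteratedFDeriv ℝ m (fun x => tDeriv T j u t x)

/-- The norm of the anisotropic weighted parabolic Hölder space `C^{k,𝐬(s,λ,δ)}_T`. -/
def eAnisoKS (T : ℝ) (k s : ℕ) (lam δ : ℝ) (u : ℝ → Spc n → ℝ) : ℝ≥0∞ :=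
  ∑ b ∈ Finset.range (k + 1), ∑ m ∈ Finset.range (2 * s + 1), ∑ j ∈ Finset.range (s + 1),
    if m + 2 * j ≤ 2 * s then eAniso0 T lam (δ + b + m) (mixDeriv T (b + m) j u) else 0

/-- Regularity required of members of `C^{k,𝐬(s,λ,δ)}_T`. -/
def AnisoReg (T : ℝ) (k s : ℕ) (u : ℝ → Spc n → ℝ) : Prop :=
  (∀ x : Spc n, ContDiffOn ℝ s (fun t => u t x) (Set.Icc 0 T)) ∧
  (∀ j : ℕ, j ≤ s → ∀ t ∈ Set.Icc (0 : ℝ) T,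
    ContDiff ℝ (2 * (s - j) + k) (fun x => tDeriv T j u t x)) ∧
  (∀ j m : ℕ, j ≤ s → m + 2 * j ≤ 2 * s + k →
    Continuous fun p : Set.Icc (0 : ℝ) T × Spc n => mixDeriv T m j u p.1 p.2)

/-- Membership in `C^{k,𝐬(s,λ,δ)}_T`. -/
def AnisoMem (T : ℝ) (k s : ℕ) (lam δ : ℝ) (u : ℝ → Spc n → ℝ) : Prop :=
  AnisoReg T k s u ∧ eAnisoKS T k s lam δ u ≠ ⊤

/-- The norm of `𝓕^{k,𝐬(s,λ,λ',δ)}_T = C^{k+1,𝐬(s,λ,δ)}_T ∩ C^{k,𝐬(s,λ',δ)}_T`. -/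
def eFn (T : ℝ) (k s : ℕ) (lam lam' δ : ℝ) (u : ℝ → Spc n → ℝ) : ℝ≥0∞ :=
  eAnisoKS T (k + 1) s lam δ u + eAnisoKS T k s lam' δ u

/-- Membership in `𝓕^{k,𝐬(s,λ,λ',δ)}_T`. -/
def FMem (T : ℝ) (k s : ℕ) (lam lam' δ : ℝ) (u : ℝ → Spc n → ℝ) : Prop :=
  AnisoReg T (k + 1) s u ∧ eFn T k s lam lam' δ u ≠ ⊤

/-- Index set of a basis of `Λ^q`. -/
abbrev Idx (n q : ℕ) := {I : Finset (Fin n) // I.card = q}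

/-- Static differential `q`-forms: coefficient functions. -/
abbrev FormS (n q : ℕ) := Idx n q → Spc n → ℝ

/-- Time-dependent differential `q`-forms. -/
abbrev FormT (n q : ℕ) := Idx n q → ℝ → Spc n → ℝ

/-- Fibre of the bundle `Λ^q`. -/
abbrev Fib (n q : ℕ) := Idx n q → ℝ

/-- The exterior derivative `d_q` on static `q`-forms. -/
def dS {q : ℕ} (u : FormS n q) : FormS n (q + 1) := fun J x =>
  ∑ i : Fin n,
    if h : i ∈ J.1 then
      (-1 : ℝ) ^ (J.1.filter fun j => j < i).card *
        pd i (u ⟨J.1.erase i, by simp [Finset.card_erase_of_mem h, J.2]⟩) x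
    else 0

/-- The exterior derivative `d_{q-1}` mapping `(q-1)`-forms to `q`-forms. -/
def dLowS {q : ℕ} (p : FormS n (q - 1)) : FormS n q := fun J x =>
  ∑ i : Fin n,
    if h : i ∈ J.1 ∧ (J.1.erase i).card = q - 1 then
      (-1 : ℝ) ^ (J.1.filter fun j => j < i).card * pd i (p ⟨J.1.erase i, h.2⟩) x
    else 0

/-- The formal adjoint `d_{q-1}^*` mapping `q`-forms to `(q-1)`-forms. -/
def coDS {q : ℕ} (u : FormS n q) : FormS n (q - 1) := fun K x =>
  -∑ i : Fin n,
    if h : i ∉ K.1 ∧ (insert i K.1).card = q then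
      (-1 : ℝ) ^ (K.1.filter fun j => j < i).card * pd i (u ⟨insert i K.1, h.2⟩) x
    else 0

/-- `d_q` on time-dependent forms. -/
def dT {q : ℕ} (u : FormT n q) : FormT n (q + 1) := fun J t => dS (fun I => u I t) J

/-- `d_{q-1}` on time-dependent forms. -/
def dLowT {q : ℕ} (p : FormT n (q - 1)) : FormT n q := fun J t => dLowS (fun I => p I t) J

/-- `d_{q-1}^*` on time-dependent forms. -/
def coDT {q : ℕ} (u : FormT n q) : FormT n (q - 1) := fun K t => coDS (fun I => u I t) K

/-- Norm of `C^{k,𝐬(s,λ,δ)}_{T,Λ^q}`. -/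
def eAnisoKSF {q : ℕ} (T : ℝ) (k s : ℕ) (lam δ : ℝ) (u : FormT n q) : ℝ≥0∞ :=
  ∑ I : Idx n q, eAnisoKS T k s lam δ (u I)

/-- Membership in `C^{k,𝐬(s,λ,δ)}_{T,Λ^q}`. -/
def CMemF {q : ℕ} (T : ℝ) (k s : ℕ) (lam δ : ℝ) (u : FormT n q) : Prop :=
  (∀ I, AnisoReg T k s (u I)) ∧ eAnisoKSF T k s lam δ u ≠ ⊤

/-- Graph norm of `C^{k,𝐬(s,λ,δ)}_{T,Λ^q,𝒟_{d⊕d*}}`. -/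
def eCD {q : ℕ} (T : ℝ) (k s : ℕ) (lam δ : ℝ) (u : FormT n q) : ℝ≥0∞ :=
  eAnisoKSF T k s lam δ u + eAnisoKSF T k s lam (δ + 1) (dT u) +
    eAnisoKSF T k s lam (δ + 1) (coDT u)

/-- Membership in `C^{k,𝐬(s,λ,δ)}_{T,Λ^q,𝒟_{d⊕d*}}`. -/
def CMemD {q : ℕ} (T : ℝ) (k s : ℕ) (lam δ : ℝ) (u : FormT n q) : Prop :=
  CMemF T k s lam δ u ∧ CMemF T k s lam (δ + 1) (dT u) ∧ CMemF T k s lam (δ + 1) (coDT u)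

/-- Norm of `𝓕^{k,𝐬(s,λ,λ',δ)}_{T,Λ^q}`. -/
def eFF {q : ℕ} (T : ℝ) (k s : ℕ) (lam lam' δ : ℝ) (u : FormT n q) : ℝ≥0∞ :=
  ∑ I : Idx n q, eFn T k s lam lam' δ (u I)

/-- Membership in `𝓕^{k,𝐬(s,λ,λ',δ)}_{T,Λ^q}`. -/
def FMemF {q : ℕ} (T : ℝ) (k s : ℕ) (lam lam' δ : ℝ) (u : FormT n q) : Prop :=
  (∀ I, AnisoReg T (k + 1) s (u I)) ∧ eFF T k s lam lam' δ u ≠ ⊤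

/-- Graph norm of `𝓕^{k,𝐬(s,λ,λ',δ)}_{T,Λ^q,𝒟_{d⊕d*}}`. -/
def eFD {q : ℕ} (T : ℝ) (k s : ℕ) (lam lam' δ : ℝ) (u : FormT n q) : ℝ≥0∞ :=
  eFF T k s lam lam' δ u + eFF T k s lam lam' (δ + 1) (dT u) +
    eFF T k s lam lam' (δ + 1) (coDT u)

/-- Membership in `𝓕^{k,𝐬(s,λ,λ',δ)}_{T,Λ^q,𝒟_{d⊕d*}}`. -/
def FMemD {q : ℕ} (T : ℝ) (k s : ℕ) (lam lam' δ : ℝ) (u : FormT n q) : Prop :=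
  FMemF T k s lam lam' δ u ∧ FMemF T k s lam lam' (δ + 1) (dT u) ∧
    FMemF T k s lam lam' (δ + 1) (coDT u)

/-- Norm of the static space `C^{s,λ,δ}_{Λ^q}`. -/
def eHolSF {q : ℕ} (s : ℕ) (lam δ : ℝ) (g : FormS n q) : ℝ≥0∞ :=
  ∑ I : Idx n q, eHolS s lam δ (g I)

/-- Membership in the static space `C^{s,λ,δ}_{Λ^q}`. -/
def HolMemF {q : ℕ} (s : ℕ) (lam δ : ℝ) (g : FormS n q) : Prop :=
  (∀ I, ContDiff ℝ s (g I)) ∧ eHolSF s lam δ g ≠ ⊤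

/-- Equality of time-dependent forms on `ℝⁿ × [0,T]`. -/
def EqOnT {q : ℕ} (T : ℝ) (u v : FormT n q) : Prop :=
  ∀ I, ∀ t ∈ Set.Icc (0 : ℝ) T, ∀ x, u I t x = v I t x

/-- The form `u` is co-closed (`d^* u = 0`) on `ℝⁿ × [0,T]`. -/
def CoClosed {q : ℕ} (T : ℝ) (u : FormT n q) : Prop :=
  ∀ K, ∀ t ∈ Set.Icc (0 : ℝ) T, ∀ x, coDT u K t x = 0

/-- Type of the bilinear zero order operator `M₁^{(q)}`. -/
abbrev M1Type (n q : ℕ) := (Fib n (q + 1) × Fib n (q - 1)) →ₗ[ℝ] Fib n q →ₗ[ℝ] Fib n q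

/-- Type of the bilinear zero order operator `M₂^{(q)}`. -/
abbrev M2Type (n q : ℕ) := Fib n q →ₗ[ℝ] Fib n q →ₗ[ℝ] Fib n (q - 1)

/-- Value of a time-dependent form at a point, as an element of the fibre. -/
def fib {q : ℕ} (u : FormT n q) (t : ℝ) (x : Spc n) : Fib n q := fun I => u I t x

/-- Value of `(d_q ⊕ d_{q-1}^*) u` at a point. -/
def ddFib {q : ℕ} (u : FormT n q) (t : ℝ) (x : Spc n) : Fib n (q + 1) × Fib n (q - 1) :=
  (fun J => dT u J t x, fun K => coDT u K t x)

/-- The operator `W_q u = M₁((d⊕d^*)u, w) + M₁((d⊕d^*)w, u)`. -/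
def Wop {q : ℕ} (M₁ : M1Type n q) (w u : FormT n q) : FormT n q := fun I t x =>
  M₁ (ddFib u t x) (fib w t x) I + M₁ (ddFib w t x) (fib u t x) I

/-- The symmetric bilinearization `B_q(w,u)` of the nonlinearity. -/
def Bop {q : ℕ} (M₁ : M1Type n q) (M₂ : M2Type n q) (w u : FormT n q) : FormT n q :=
  fun I t x =>
    Wop M₁ w u I t x +
      dLowT (fun K t' x' =>
        M₂ (fib u t' x') (fib w t' x') K + M₂ (fib w t' x') (fib u t' x') K) I t x

/-- The nonlinearity `𝒩_q u = M₁((d⊕d^*)u, u) + d_{q-1} M₂(u,u)`. -/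
def Nop {q : ℕ} (M₁ : M1Type n q) (M₂ : M2Type n q) (u : FormT n q) : FormT n q :=
  fun I t x =>
    M₁ (ddFib u t x) (fib u t x) I +
      dLowT (fun K t' x' => M₂ (fib u t' x') (fib u t' x') K) I t x

/-- Fundamental solution of the heat operator `∂_t - μΔ`. -/
def heatKer (μ : ℝ) (x : Spc n) (t : ℝ) : ℝ :=
  if 0 < t then (4 * Real.pi * μ * t) ^ (-(n : ℝ) / 2) * Real.exp (-‖x‖ ^ 2 / (4 * μ * t))
  else 0

/-- Volume heat potential `Ψ_μ`. -/
def volPot (μ : ℝ) (f : ℝ → Spc n → ℝ) (t : ℝ) (x : Spc n) : ℝ :=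
  ∫ τ in Set.Ioc (0 : ℝ) t, ∫ y : Spc n, heatKer μ (x - y) (t - τ) * f τ y

/-- Poisson heat potential `Ψ_{μ,0}`. -/
def poisPot (μ : ℝ) (g : Spc n → ℝ) (t : ℝ) (x : Spc n) : ℝ :=
  ∫ y : Spc n, heatKer μ (x - y) t * g y

/-- Volume heat potential acting coefficient-wise on forms. -/
def volPotF {q : ℕ} (μ : ℝ) (f : FormT n q) : FormT n q := fun I => volPot μ (f I)

/-- Poisson heat potential acting coefficient-wise on forms. -/
def poisPotF {q : ℕ} (μ : ℝ) (g : FormS n q) : FormT n q := fun I => poisPot μ (g I)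

/-- Area of the unit sphere in `ℝⁿ`. -/
def sphArea (n : ℕ) : ℝ := 2 * Real.pi ^ ((n : ℝ) / 2) / Real.Gamma ((n : ℝ) / 2)

/-- Standard fundamental solution of the Laplace operator in `ℝⁿ`. -/
def lapKer (n : ℕ) (x : Spc n) : ℝ :=
  if n = 2 then (1 / Real.pi) * Real.log ‖x‖
  else ‖x‖ ^ (2 - (n : ℝ)) / (sphArea n * (2 - (n : ℝ)))

/-- Newtonian potential. -/
def newtPot (f : Spc n → ℝ) (x : Spc n) : ℝ := ∫ y : Spc n, lapKer n (x - y) * f y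

/-- The integral operator `Φ_q` mapping `(q+1)`-forms to `q`-forms;
concretely `Φ_q f = -d^* (e * f)`. -/
def PhiOp {q : ℕ} (f : FormT n (q + 1)) : FormT n q := fun K t x =>
  -coDS (n := n) (q := q + 1) (fun J y => newtPot (fun z => f J t z) y) K x

/-- Squared `L²` norm of a form at time `t`. -/
def l2Sq {q : ℕ} (u : FormT n q) (t : ℝ) : ℝ :=
  ∑ I : Idx n q, ∫ x : Spc n, (u I t x) ^ 2

/-- Squared `L²` norm of the spatial gradient of a form at time `t`. -/
def gradSq {q : ℕ} (u : FormT n q) (t : ℝ) : ℝ :=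
  ∑ I : Idx n q, ∑ i : Fin n, ∫ x : Spc n, (pd i (fun y => u I t y) x) ^ 2

/-- The norm of `C^{0,𝐬(0,0,δ)}_{T,Λ^q}` (weighted sup-norm). -/
def eSupT {q : ℕ} (T δ : ℝ) (u : FormT n q) : ℝ≥0∞ :=
  ∑ I : Idx n q,
    ⨆ (t : Set.Icc (0 : ℝ) T) (x : Spc n), ENNReal.ofReal (wt x ^ δ * |u I t x|)

/-- The norm `‖∇u‖_{C^{0,𝐬(0,0,δ)}_{T}}` of the spatial gradient. -/
def eSupGradT {q : ℕ} (T δ : ℝ) (u : FormT n q) : ℝ≥0∞ :=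
  ∑ I : Idx n q, ∑ i : Fin n,
    ⨆ (t : Set.Icc (0 : ℝ) T) (x : Spc n),
      ENNReal.ofReal (wt x ^ δ * |pd i (fun y => u I t y) x|)

/-- `q`-form with coefficients harmonic polynomials of degree at most `m`. -/
def HarmPolyForm {q : ℕ} (m : ℕ) (h : FormS n q) : Prop :=
  ∀ I, (∃ P : MvPolynomial (Fin n) ℝ, P.totalDegree ≤ m ∧
      ∀ x : Spc n, h I x = MvPolynomial.eval (fun i => x i) P) ∧
    ∀ x : Spc n, lap (h I) x = 0

/-- Classical solution of the Cauchy problem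
`∂_t u - μ Δ u + extra = f` on `ℝⁿ × (0,T)`, `u(·,0) = u₀`. -/
def CauchySol {q : ℕ} (T μ : ℝ) (u extra f : FormT n q) (u₀ : FormS n q) : Prop :=
  (∀ I, ∀ t ∈ Set.Ioo (0 : ℝ) T, ∀ x,
    deriv (fun τ => u I τ x) t - μ * lap (fun y => u I t y) x + extra I t x = f I t x) ∧
  ∀ I x, u I 0 x = u₀ I x

/-- `Ψ_{μ,q} 𝒩_q u`. -/
def NopPot {q : ℕ} (μ : ℝ) (M₁ : M1Type n q) (M₂ : M2Type n q) (u : FormT n q) : FormT n q :=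
  volPotF μ (Nop M₁ M₂ u)

/-- `u + Ψ_{μ,q} 𝒩_q u`. -/
def TmapN {q : ℕ} (μ : ℝ) (M₁ : M1Type n q) (M₂ : M2Type n q) (u : FormT n q) : FormT n q :=
  u + NopPot μ M₁ M₂ u

/-- The linearization `u + Ψ_{μ,q} B_q(v,u)`. -/
def LmapB {q : ℕ} (μ : ℝ) (M₁ : M1Type n q) (M₂ : M2Type n q) (v u : FormT n q) :
    FormT n q :=
  u + volPotF μ (Bop M₁ M₂ v u)

/-- `Φ_q d_q Ψ_{μ,q} 𝒩_q u`. -/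
def PhiNpot {q : ℕ} (μ : ℝ) (M₁ : M1Type n q) (M₂ : M2Type n q) (u : FormT n q) :
    FormT n q :=
  PhiOp (dT (volPotF μ (Nop M₁ M₂ u)))

/-- `u + Φ_q d_q Ψ_{μ,q} 𝒩_q u`. -/
def PhiNmap {q : ℕ} (μ : ℝ) (M₁ : M1Type n q) (M₂ : M2Type n q) (u : FormT n q) :
    FormT n q :=
  u + PhiNpot μ M₁ M₂ u

/-- The linearization `u + Φ_q d_q Ψ_{μ,q} B_q(v,u)`. -/
def PhiLmap {q : ℕ} (μ : ℝ) (M₁ : M1Type n q) (M₂ : M2Type n q) (v u : FormT n q) :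
    FormT n q :=
  u + PhiOp (dT (volPotF μ (Bop M₁ M₂ v u)))

section HeatPotential

set_option linter.unusedSectionVars false
set_option maxSynthPendingDepth 3

section Weight

theorem one_le_wt (x : Spc n) : 1 ≤ wt x :=
  Real.one_le_sqrt.2 (le_add_of_nonneg_right (sq_nonneg _))

theorem wt_pos (x : Spc n) : 0 < wt x := one_pos.trans_le (one_le_wt x)

theorem norm_le_wt (x : Spc n) : ‖x‖ ≤ wt x :=
  Real.le_sqrt_of_sq_le (by linarith)

theorem wt_mono {x y : Spc n} (h : ‖x‖ ≤ ‖y‖) : wt x ≤ wt y :=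
  Real.sqrt_le_sqrt (by gcongr)

theorem wt_le_one_add_norm (x : Spc n) : wt x ≤ 1 + ‖x‖ :=
  Real.sqrt_le_iff.2 ⟨by positivity, by nlinarith [norm_nonneg x]⟩

theorem wt_le_wt_add (x y : Spc n) : wt x ≤ wt (x - y) + ‖y‖ := by
  have h : ‖x‖ ≤ ‖x - y‖ + ‖y‖ := by simpa using norm_add_le (x - y) y
  refine Real.sqrt_le_iff.2 ⟨add_nonneg (wt_pos _).le (norm_nonneg _), ?_⟩
  have h1 : wt (x - y) ^ 2 = 1 + ‖x - y‖ ^ 2 := Real.sq_sqrt (by positivity)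
  have h2 := norm_le_wt (x - y)
  nlinarith [norm_nonneg x, norm_nonneg y, norm_nonneg (x - y)]

theorem wt_le_wt_sub_mul (x y : Spc n) : wt x ≤ wt (x - y) * (1 + ‖y‖) := by
  have := wt_le_wt_add x y
  nlinarith [one_le_wt (x - y), norm_nonneg y]

theorem wt_rpow_le_one {p : ℝ} (hp : 0 ≤ p) (x : Spc n) : wt x ^ (-p) ≤ 1 :=
  Real.rpow_le_one_of_one_le_of_nonpos (one_le_wt x) (by linarith)

theorem wt_rpow_pos (x : Spc n) (p : ℝ) : 0 < wt x ^ p := Real.rpow_pos_of_pos (wt_pos x) p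

theorem wt_rpow_anti {p p' : ℝ} (hp : p' ≤ p) (x : Spc n) : wt x ^ (-p) ≤ wt x ^ (-p') :=
  Real.rpow_le_rpow_of_exponent_le (one_le_wt x) (by linarith)

theorem wt_rpow_le_of_norm_le {p : ℝ} (hp : 0 ≤ p) {x y : Spc n} (h : ‖x‖ ≤ ‖y‖) :
    wt y ^ (-p) ≤ wt x ^ (-p) :=
  Real.rpow_le_rpow_of_nonpos (wt_pos x) (wt_mono h) (by linarith)

theorem wt_zero : wt (0 : Spc n) = 1 := by simp [wt]

end Weight

section HolderBound

variable {E E₁ E₂ : Type} [NormedAddCommGroup E] [NormedSpace ℝ E]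
  [NormedAddCommGroup E₁] [NormedSpace ℝ E₁] [NormedAddCommGroup E₂] [NormedSpace ℝ E₂]

/-- Continuity together with the weighted sup and parabolic Hölder estimates with constant `A`.
The Hölder estimates are void for `lam ≤ 0`. -/
structure HolderBound {E : Type} [NormedAddCommGroup E] (T lam p A : ℝ) (v : ℝ → Spc n → E) :
    Prop where
  cont : ContinuousOn (fun z : ℝ × Spc n => v z.1 z.2) (Set.Icc 0 T ×ˢ Set.univ)
  bound : ∀ t ∈ Set.Icc 0 T, ∀ x, ‖v t x‖ ≤ A * wt x ^ (-p)
  space : 0 < lam → ∀ t ∈ Set.Icc 0 T, ∀ x y : Spc n, ‖x‖ ≤ ‖y‖ →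
    ‖v t x - v t y‖ ≤ A * wt x ^ (-(p + lam)) * ‖x - y‖ ^ lam
  time : 0 < lam → ∀ t₁ ∈ Set.Icc 0 T, ∀ t₂ ∈ Set.Icc 0 T, ∀ x,
    ‖v t₁ x - v t₂ x‖ ≤ A * wt x ^ (-p) * |t₁ - t₂| ^ (lam / 2)

variable {T lam p p' p₁ p₂ A A' A₁ A₂ : ℝ} {v v₁ v₂ : ℝ → Spc n → E}

theorem HolderBound.nonneg (hT : 0 ≤ T) (h : HolderBound T lam p A v) : 0 ≤ A := by
  have := (norm_nonneg _).trans (h.bound 0 ⟨le_rfl, hT⟩ 0)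
  simpa [wt_zero] using this

theorem HolderBound.mono (hT : 0 ≤ T) (h : HolderBound T lam p A v) (hA : A ≤ A') (hp : p' ≤ p) :
    HolderBound T lam p' A' v := by
  have hA' := (h.nonneg hT).trans hA
  refine ⟨h.cont, fun t ht x => (h.bound t ht x).trans ?_, fun hl t ht x y hxy =>
    (h.space hl t ht x y hxy).trans ?_, fun hl t₁ ht₁ t₂ ht₂ x =>
    (h.time hl t₁ ht₁ t₂ ht₂ x).trans ?_⟩
  · exact mul_le_mul hA (wt_rpow_anti hp x) (wt_rpow_pos _ _).le hA'
  · gcongr ?_ * _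
    exact mul_le_mul hA (wt_rpow_anti (by linarith) x) (wt_rpow_pos _ _).le hA'
  · gcongr ?_ * _
    exact mul_le_mul hA (wt_rpow_anti hp x) (wt_rpow_pos _ _).le hA'

theorem HolderBound.congr (h : HolderBound T lam p A v₁)
    (he : ∀ t ∈ Set.Icc 0 T, ∀ x, v₂ t x = v₁ t x) : HolderBound T lam p A v₂ where
  cont := h.cont.congr fun z hz => he z.1 hz.1 z.2
  bound t ht x := by rw [he t ht]; exact h.bound t ht x
  space hl t ht x y hxy := by rw [he t ht, he t ht]; exact h.space hl t ht x y hxy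
  time hl t₁ ht₁ t₂ ht₂ x := by rw [he _ ht₁, he _ ht₂]; exact h.time hl _ ht₁ _ ht₂ x

theorem HolderBound.sup_only (h : HolderBound T lam p A v) : HolderBound T 0 p A v :=
  ⟨h.cont, h.bound, fun h0 => absurd h0 (lt_irrefl _), fun h0 => absurd h0 (lt_irrefl _)⟩

theorem HolderBound.add (h₁ : HolderBound T lam p A₁ v₁) (h₂ : HolderBound T lam p A₂ v₂) :
    HolderBound T lam p (A₁ + A₂) (fun t x => v₁ t x + v₂ t x) where
  cont := h₁.cont.add h₂.cont
  bound t ht x := by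
    refine (norm_add_le _ _).trans ?_
    rw [add_mul]; exact add_le_add (h₁.bound t ht x) (h₂.bound t ht x)
  space hl t ht x y hxy := by
    rw [add_sub_add_comm, add_mul, add_mul]
    exact (norm_add_le _ _).trans
      (add_le_add (h₁.space hl t ht x y hxy) (h₂.space hl t ht x y hxy))
  time hl t₁ ht₁ t₂ ht₂ x := by
    rw [add_sub_add_comm, add_mul, add_mul]
    exact (norm_add_le _ _).trans
      (add_le_add (h₁.time hl _ ht₁ _ ht₂ x) (h₂.time hl _ ht₁ _ ht₂ x))

theorem HolderBound.clm (L : E₁ →L[ℝ] E) {v : ℝ → Spc n → E₁} {b : ℝ} (hb : ‖L‖ ≤ b)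
    (h : HolderBound T lam p A v) : HolderBound T lam p (b * A) (fun t x => L (v t x)) where
  cont := L.continuous.comp_continuousOn h.cont
  bound t ht x := by
    rw [mul_assoc]
    exact (L.le_of_opNorm_le hb _).trans
      (mul_le_mul_of_nonneg_left (h.bound t ht x) ((norm_nonneg L).trans hb))
  space hl t ht x y hxy := by
    rw [← map_sub, mul_assoc, mul_assoc, ← mul_assoc A]
    exact (L.le_of_opNorm_le hb _).trans
      (mul_le_mul_of_nonneg_left (h.space hl t ht x y hxy) ((norm_nonneg L).trans hb))
  time hl t₁ ht₁ t₂ ht₂ x := by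
    rw [← map_sub, mul_assoc, mul_assoc, ← mul_assoc A]
    exact (L.le_of_opNorm_le hb _).trans
      (mul_le_mul_of_nonneg_left (h.time hl _ ht₁ _ ht₂ x) ((norm_nonneg L).trans hb))

theorem norm_bilin_sub_le (β : E₁ →L[ℝ] E₂ →L[ℝ] E) {b : ℝ} (hb : ‖β‖ ≤ b)
    (a a' : E₁) (c c' : E₂) :
    ‖β a c - β a' c'‖ ≤ b * ‖a‖ * ‖c - c'‖ + b * ‖a - a'‖ * ‖c'‖ := by
  have h : β a c - β a' c' = β a (c - c') + β (a - a') c' := by simp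
  rw [h]
  exact (norm_add_le _ _).trans (add_le_add
    ((β.le_of_opNorm₂_le_of_le hb le_rfl le_rfl)) (β.le_of_opNorm₂_le_of_le hb le_rfl le_rfl))

theorem HolderBound.bilin (hT : 0 ≤ T) (hp₂ : 0 ≤ p₂)
    (β : E₁ →L[ℝ] E₂ →L[ℝ] E) {b : ℝ} (hb : ‖β‖ ≤ b)
    {v₁ : ℝ → Spc n → E₁} {v₂ : ℝ → Spc n → E₂}
    (h₁ : HolderBound T lam p₁ A₁ v₁) (h₂ : HolderBound T lam p₂ A₂ v₂) :
    HolderBound T lam (p₁ + p₂) (2 * b * (A₁ * A₂)) (fun t x => β (v₁ t x) (v₂ t x)) := by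
  have hb0 : 0 ≤ b := (ContinuousLinearMap.opNorm_nonneg β).trans hb
  have hA₁ := h₁.nonneg hT
  have hA₂ := h₂.nonneg hT
  have hw : ∀ (x : Spc n) (a c : ℝ), wt x ^ (-(a + c)) = wt x ^ (-a) * wt x ^ (-c) := by
    intro x a c; rw [← Real.rpow_add (wt_pos x)]; ring_nf
  refine ⟨?_, fun t ht x => ?_, fun hl t ht x y hxy => ?_, fun hl t₁ ht₁ t₂ ht₂ x => ?_⟩
  · exact β.continuous₂.comp_continuousOn (h₁.cont.prodMk h₂.cont)
  · refine (β.le_of_opNorm₂_le_of_le hb (h₁.bound t ht x) (h₂.bound t ht x)).trans ?_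
    rw [hw]
    have := mul_nonneg (mul_nonneg hb0 (mul_nonneg hA₁ hA₂))
      (mul_pos (wt_rpow_pos x (-p₁)) (wt_rpow_pos x (-p₂))).le
    nlinarith
  · refine (norm_bilin_sub_le β hb _ _ _ _).trans ?_
    have e1 := h₁.bound t ht x
    have e2 := (h₂.bound t ht y).trans
      (mul_le_mul_of_nonneg_left (wt_rpow_le_of_norm_le hp₂ hxy) hA₂)
    have e3 := h₁.space hl t ht x y hxy
    have e4 := h₂.space hl t ht x y hxy
    have := wt_rpow_pos x (-p₁)
    have := wt_rpow_pos x (-p₂)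
    have := wt_rpow_pos x (-(p₁ + lam))
    calc b * ‖v₁ t x‖ * ‖v₂ t x - v₂ t y‖ + b * ‖v₁ t x - v₁ t y‖ * ‖v₂ t y‖
        ≤ b * (A₁ * wt x ^ (-p₁)) * (A₂ * wt x ^ (-(p₂ + lam)) * ‖x - y‖ ^ lam) +
          b * (A₁ * wt x ^ (-(p₁ + lam)) * ‖x - y‖ ^ lam) * (A₂ * wt x ^ (-p₂)) := by gcongr
      _ = _ := by rw [hw, hw, add_assoc p₁ p₂, hw x p₁, hw]; ring
  · refine (norm_bilin_sub_le β hb _ _ _ _).trans ?_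
    have e1 := h₁.bound t₁ ht₁ x
    have e2 := h₂.bound t₂ ht₂ x
    have e3 := h₁.time hl t₁ ht₁ t₂ ht₂ x
    have e4 := h₂.time hl t₁ ht₁ t₂ ht₂ x
    have := wt_rpow_pos x (-p₁)
    have := wt_rpow_pos x (-p₂)
    calc b * ‖v₁ t₁ x‖ * ‖v₂ t₁ x - v₂ t₂ x‖ + b * ‖v₁ t₁ x - v₁ t₂ x‖ * ‖v₂ t₂ x‖
        ≤ b * (A₁ * wt x ^ (-p₁)) * (A₂ * wt x ^ (-p₂) * |t₁ - t₂| ^ (lam / 2)) +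
          b * (A₁ * wt x ^ (-p₁) * |t₁ - t₂| ^ (lam / 2)) * (A₂ * wt x ^ (-p₂)) := by gcongr
      _ = _ := by rw [hw]; ring

end HolderBound

section ParabolicClass

/-- `v` has mixed derivatives `∂ₓˡ∂ₜʲ` for `l + 2 j ≤ N`, `j ≤ J` (independently of the order of
differentiation), and `∂ₓˡ∂ₜʲ v` satisfies the `HolderBound` estimates with weight `p + l` and
constant `A`. -/
def ParabolicClass (T lam : ℝ) : ℕ → ℕ → ℝ → ℝ →
    ∀ {E : Type} [NormedAddCommGroup E] [NormedSpace ℝ E], (ℝ → Spc n → E) → Prop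
  | 0, _, p, A, _, _, _, v => HolderBound T lam p A v
  | 1, _, p, A, E, _, _, v => HolderBound T lam p A v ∧
      ∃ v' : ℝ → Spc n → (Spc n →L[ℝ] E),
        (∀ t ∈ Set.Icc 0 T, ∀ x, HasFDerivAt (v t) (v' t x) x) ∧
        HolderBound T lam (p + 1) A v'
  | N + 2, J, p, A, E, _, _, v => HolderBound T lam p A v ∧
      (∃ v' : ℝ → Spc n → (Spc n →L[ℝ] E),
        (∀ t ∈ Set.Icc 0 T, ∀ x, HasFDerivAt (v t) (v' t x) x) ∧
        ParabolicClass T lam (N + 1) J (p + 1) A v') ∧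
      ∀ J', J = J' + 1 → ∃ w : ℝ → Spc n → E,
        (∀ t ∈ Set.Icc 0 T, ∀ x, HasDerivWithinAt (fun τ => v τ x) (w t x) (Set.Icc 0 T) t) ∧
        ParabolicClass T lam N J' p A w

variable {E E₁ E₂ : Type} [NormedAddCommGroup E] [NormedSpace ℝ E]
  [NormedAddCommGroup E₁] [NormedSpace ℝ E₁] [NormedAddCommGroup E₂] [NormedSpace ℝ E₂]
  {T lam p p' p₁ p₂ A A' A₁ A₂ : ℝ} {N N' J J' : ℕ}

theorem parabolicClass_iff {v : ℝ → Spc n → E} :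
    ParabolicClass T lam N J p A v ↔ HolderBound T lam p A v ∧
      (∀ M, N = M + 1 → ∃ v' : ℝ → Spc n → (Spc n →L[ℝ] E),
        (∀ t ∈ Set.Icc 0 T, ∀ x, HasFDerivAt (v t) (v' t x) x) ∧
        ParabolicClass T lam M J (p + 1) A v') ∧
      (∀ M K, N = M + 2 → J = K + 1 → ∃ w : ℝ → Spc n → E,
        (∀ t ∈ Set.Icc 0 T, ∀ x, HasDerivWithinAt (fun τ => v τ x) (w t x) (Set.Icc 0 T) t) ∧
        ParabolicClass T lam M K p A w) := by
  match N with
  | 0 => simp [ParabolicClass]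
  | 1 => simp [ParabolicClass]
  | N + 2 =>
    rw [ParabolicClass]
    constructor
    · rintro ⟨h, h1, h2⟩
      refine ⟨h, ?_, ?_⟩
      · rintro M hM
        obtain rfl : N + 1 = M := by omega
        exact h1
      · rintro M K hM hK
        obtain rfl : N = M := by omega
        exact h2 K hK
    · rintro ⟨h, h1, h2⟩
      exact ⟨h, h1 _ rfl, fun K hK => h2 _ K rfl hK⟩

theorem ParabolicClass.holderBound {v : ℝ → Spc n → E} (h : ParabolicClass T lam N J p A v) :
    HolderBound T lam p A v := (parabolicClass_iff.1 h).1

theorem ParabolicClass.exists_fderiv {v : ℝ → Spc n → E}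
    (h : ParabolicClass T lam (N + 1) J p A v) : ∃ v' : ℝ → Spc n → (Spc n →L[ℝ] E),
      (∀ t ∈ Set.Icc 0 T, ∀ x, HasFDerivAt (v t) (v' t x) x) ∧
      ParabolicClass T lam N J (p + 1) A v' := (parabolicClass_iff.1 h).2.1 N rfl

theorem ParabolicClass.exists_deriv {v : ℝ → Spc n → E}
    (h : ParabolicClass T lam (N + 2) (J + 1) p A v) : ∃ w : ℝ → Spc n → E,
      (∀ t ∈ Set.Icc 0 T, ∀ x, HasDerivWithinAt (fun τ => v τ x) (w t x) (Set.Icc 0 T) t) ∧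
      ParabolicClass T lam N J p A w := (parabolicClass_iff.1 h).2.2 N J rfl rfl

theorem ParabolicClass.nonneg (hT : 0 ≤ T) {v : ℝ → Spc n → E}
    (h : ParabolicClass T lam N J p A v) : 0 ≤ A := h.holderBound.nonneg hT

theorem ParabolicClass.mono (hT : 0 ≤ T) (hN : N' ≤ N) (hJ : J' ≤ J) (hp : p' ≤ p) (hA : A ≤ A')
    {v : ℝ → Spc n → E} (h : ParabolicClass T lam N J p A v) :
    ParabolicClass T lam N' J' p' A' v := by
  induction N' using Nat.strong_induction_on generalizing N J J' p p' A A' E with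
  | _ N' ih =>
    refine parabolicClass_iff.2 ⟨h.holderBound.mono hT hA hp, ?_, ?_⟩
    · rintro M rfl
      obtain ⟨N, rfl⟩ : ∃ K, N = K + 1 := ⟨N - 1, by omega⟩
      obtain ⟨v', hv', h'⟩ := h.exists_fderiv
      exact ⟨v', hv', ih M (by omega) (by omega) hJ (by linarith) hA h'⟩
    · rintro M K rfl rfl
      obtain ⟨N, rfl⟩ : ∃ K, N = K + 2 := ⟨N - 2, by omega⟩
      obtain ⟨J, rfl⟩ : ∃ K, J = K + 1 := ⟨J - 1, by omega⟩
      obtain ⟨w, hw, h'⟩ := h.exists_deriv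
      exact ⟨w, hw, ih M (by omega) (by omega) (by omega) hp hA h'⟩

theorem ParabolicClass.sup_only {v : ℝ → Spc n → E} (h : ParabolicClass T lam N J p A v) :
    ParabolicClass T 0 N J p A v := by
  induction N using Nat.strong_induction_on generalizing J p E with
  | _ N ih =>
    refine parabolicClass_iff.2 ⟨h.holderBound.sup_only, ?_, ?_⟩
    · rintro M rfl
      obtain ⟨v', hv', h'⟩ := h.exists_fderiv
      exact ⟨v', hv', ih M (by omega) h'⟩
    · rintro M K rfl rfl
      obtain ⟨w, hw, h'⟩ := h.exists_deriv
      exact ⟨w, hw, ih M (by omega) h'⟩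

theorem ParabolicClass.congr {v₁ v₂ : ℝ → Spc n → E} (h : ParabolicClass T lam N J p A v₁)
    (he : ∀ t ∈ Set.Icc 0 T, ∀ x, v₂ t x = v₁ t x) : ParabolicClass T lam N J p A v₂ := by
  refine parabolicClass_iff.2 ⟨h.holderBound.congr he, ?_, ?_⟩
  · rintro M rfl
    obtain ⟨v', hv', h'⟩ := h.exists_fderiv
    refine ⟨v', fun t ht x => ?_, h'⟩
    rw [show v₂ t = v₁ t from funext (he t ht)]
    exact hv' t ht x
  · rintro M K rfl rfl
    obtain ⟨w, hw, h'⟩ := h.exists_deriv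
    exact ⟨w, fun t ht x => (hw t ht x).congr (fun τ hτ => he τ hτ x) (he t ht x), h'⟩

theorem ParabolicClass.add {v₁ v₂ : ℝ → Spc n → E} (h₁ : ParabolicClass T lam N J p A₁ v₁)
    (h₂ : ParabolicClass T lam N J p A₂ v₂) :
    ParabolicClass T lam N J p (A₁ + A₂) (fun t x => v₁ t x + v₂ t x) := by
  induction N using Nat.strong_induction_on generalizing J p E with
  | _ N ih =>
    refine parabolicClass_iff.2 ⟨h₁.holderBound.add h₂.holderBound, ?_, ?_⟩
    · rintro M rfl
      obtain ⟨v₁', hv₁, h₁⟩ := h₁.exists_fderiv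
      obtain ⟨v₂', hv₂, h₂⟩ := h₂.exists_fderiv
      exact ⟨_, fun t ht x => (hv₁ t ht x).add (hv₂ t ht x), ih M (by omega) h₁ h₂⟩
    · rintro M K rfl rfl
      obtain ⟨w₁, hw₁, h₁⟩ := h₁.exists_deriv
      obtain ⟨w₂, hw₂, h₂⟩ := h₂.exists_deriv
      exact ⟨_, fun t ht x => (hw₁ t ht x).add (hw₂ t ht x), ih M (by omega) h₁ h₂⟩

theorem ParabolicClass.clm (L : E₁ →L[ℝ] E) {b : ℝ} (hb : ‖L‖ ≤ b) {v : ℝ → Spc n → E₁}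
    (h : ParabolicClass T lam N J p A v) :
    ParabolicClass T lam N J p (b * A) (fun t x => L (v t x)) := by
  induction N using Nat.strong_induction_on generalizing J p E E₁ with
  | _ N ih =>
    refine parabolicClass_iff.2 ⟨h.holderBound.clm L hb, ?_, ?_⟩
    · rintro M rfl
      obtain ⟨v', hv', h⟩ := h.exists_fderiv
      refine ⟨_, fun t ht x => L.hasFDerivAt.comp x (hv' t ht x), ?_⟩
      refine ih M (by omega) (ContinuousLinearMap.compL ℝ (Spc n) E₁ E L) ?_ h
      exact ContinuousLinearMap.opNorm_le_bound _ ((norm_nonneg L).trans hb) fun g =>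
        (L.opNorm_comp_le g).trans (mul_le_mul_of_nonneg_right hb (norm_nonneg g))
    · rintro M K rfl rfl
      obtain ⟨w, hw, h⟩ := h.exists_deriv
      exact ⟨_, fun t ht x => L.hasFDerivAt.comp_hasDerivWithinAt t (hw t ht x),
        ih M (by omega) L hb h⟩

theorem ParabolicClass.bilin (hT : 0 ≤ T) (hp₁ : 0 ≤ p₁) (hp₂ : 0 ≤ p₂)
    (β : E₁ →L[ℝ] E₂ →L[ℝ] E) {b : ℝ} (hb : ‖β‖ ≤ b)
    {v₁ : ℝ → Spc n → E₁} {v₂ : ℝ → Spc n → E₂}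
    (h₁ : ParabolicClass T lam N J p₁ A₁ v₁) (h₂ : ParabolicClass T lam N J p₂ A₂ v₂) :
    ParabolicClass T lam N J (p₁ + p₂) (2 ^ (N + 1) * b * (A₁ * A₂))
      (fun t x => β (v₁ t x) (v₂ t x)) := by
  have hb0 : 0 ≤ b := (ContinuousLinearMap.opNorm_nonneg β).trans hb
  have hA := mul_nonneg hb0 (mul_nonneg (h₁.nonneg hT) (h₂.nonneg hT))
  induction N using Nat.strong_induction_on generalizing J p₁ p₂ E E₁ E₂ with
  | _ N ih =>
    refine parabolicClass_iff.2
      ⟨(h₁.holderBound.bilin hT hp₂ β hb h₂.holderBound).mono hT ?_ le_rfl, ?_, ?_⟩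
    · have : (1 : ℝ) ≤ 2 ^ N := one_le_pow₀ (by norm_num)
      rw [pow_succ]; nlinarith
    · rintro M rfl
      obtain ⟨v₁', hv₁, h₁'⟩ := h₁.exists_fderiv
      obtain ⟨v₂', hv₂, h₂'⟩ := h₂.exists_fderiv
      refine ⟨_, fun t ht x => β.hasFDerivAt_of_bilinear (hv₁ t ht x) (hv₂ t ht x), ?_⟩
      have e₁ := ih M (by omega) hp₁ (by linarith) (β.precompR (Spc n))
        ((β.norm_precompR_le _).trans hb)
        (h₁.mono hT (Nat.le_succ M) le_rfl le_rfl le_rfl) h₂'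
      have e₂ := ih M (by omega) (by linarith) hp₂ (β.precompL (Spc n))
        ((β.norm_precompL_le _).trans hb) h₁'
        (h₂.mono hT (Nat.le_succ M) le_rfl le_rfl le_rfl)
      refine ((e₁.mono hT le_rfl le_rfl (by linarith) le_rfl).add
        (e₂.mono hT le_rfl le_rfl (by linarith) le_rfl)).mono hT le_rfl le_rfl le_rfl ?_
      rw [pow_succ _ (M + 1)]; linarith
    · rintro M K rfl rfl
      obtain ⟨w₁, hw₁, h₁'⟩ := h₁.exists_deriv
      obtain ⟨w₂, hw₂, h₂'⟩ := h₂.exists_deriv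
      refine ⟨_, fun t ht x => β.hasDerivWithinAt_of_bilinear (hw₁ t ht x) (hw₂ t ht x), ?_⟩
      have e₁ := ih M (by omega) hp₁ hp₂ β hb
        (h₁.mono hT (by omega) (Nat.le_succ K) le_rfl le_rfl) h₂'
      have e₂ := ih M (by omega) hp₁ hp₂ β hb h₁'
        (h₂.mono hT (by omega) (Nat.le_succ K) le_rfl le_rfl)
      refine (e₁.add e₂).mono hT le_rfl le_rfl le_rfl ?_
      have : (0 : ℝ) ≤ 2 ^ M := by positivity
      rw [pow_succ _ (M + 2), pow_succ _ (M + 1)]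
      nlinarith [mul_nonneg (pow_nonneg zero_le_two (M + 1) : (0 : ℝ) ≤ 2 ^ (M + 1)) hA]

end ParabolicClass

section TimeCalculus

variable {E : Type} [NormedAddCommGroup E] [NormedSpace ℝ E] {T : ℝ}

/-- Clamping of the time variable to `[0,T]`. -/
def clampTime (T t : ℝ) : ℝ := max 0 (min t T)

theorem continuous_clampTime : Continuous (clampTime T) := by unfold clampTime; fun_prop

theorem clampTime_mem (hT : 0 ≤ T) (t : ℝ) : clampTime T t ∈ Set.Icc 0 T :=
  ⟨le_max_left _ _, max_le hT (min_le_right _ _)⟩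

theorem clampTime_of_mem {t : ℝ} (ht : t ∈ Set.Icc 0 T) : clampTime T t = t := by
  rw [clampTime, min_eq_left ht.2, max_eq_right ht.1]

theorem hasDerivWithinAt_of_eq_integral [CompleteSpace E] (hT : 0 ≤ T) {F φ : ℝ → E} {c : E}
    (hφ : ContinuousOn φ (Set.Icc 0 T))
    (hF : ∀ t ∈ Set.Icc 0 T, F t = c + ∫ r in (0 : ℝ)..t, φ r) {t : ℝ} (ht : t ∈ Set.Icc 0 T) :
    HasDerivWithinAt F (φ t) (Set.Icc 0 T) t := by
  have hc : Continuous fun r => φ (clampTime T r) :=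
    hφ.comp_continuous continuous_clampTime (clampTime_mem hT)
  have h := ((intervalIntegral.integral_hasDerivAt_right (hc.intervalIntegrable 0 t)
    (hc.stronglyMeasurableAtFilter _ _) hc.continuousAt).const_add c).hasDerivWithinAt
      (s := Set.Icc 0 T)
  rw [clampTime_of_mem ht] at h
  have he : ∀ τ ∈ Set.Icc 0 T, F τ = c + ∫ r in (0 : ℝ)..τ, φ (clampTime T r) := by
    intro τ hτ
    rw [hF τ hτ]
    congr 1
    refine intervalIntegral.integral_congr fun r hr => ?_
    rw [Set.uIcc_of_le hτ.1] at hr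
    simp only [clampTime_of_mem ⟨hr.1, hr.2.trans hτ.2⟩]
  exact h.congr he (he t ht)

theorem eq_add_integral_of_hasDerivWithinAt [CompleteSpace E] {F φ : ℝ → E}
    (hφ : ContinuousOn φ (Set.Icc 0 T))
    (hF : ∀ t ∈ Set.Icc 0 T, HasDerivWithinAt F (φ t) (Set.Icc 0 T) t) {t : ℝ}
    (ht : t ∈ Set.Icc 0 T) : F t = F 0 + ∫ r in (0 : ℝ)..t, φ r := by
  have hsub : Set.Icc 0 t ⊆ Set.Icc 0 T := Set.Icc_subset_Icc_right ht.2
  rw [intervalIntegral.integral_eq_sub_of_hasDerivAt_of_le ht.1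
    (f := F) (fun r hr => ((hF r (hsub hr)).continuousWithinAt).mono hsub)
    (fun r hr => (hF r (hsub ⟨hr.1.le, hr.2.le⟩)).hasDerivAt
      (Icc_mem_nhds hr.1 (hr.2.trans_le ht.2)))
    ((hφ.mono (by rw [Set.uIcc_of_le ht.1]; exact hsub)).intervalIntegrable)]
  abel

theorem continuousOn_slice {X : Type*} [TopologicalSpace X] {g : ℝ → Spc n → X}
    (h : ContinuousOn (fun z : ℝ × Spc n => g z.1 z.2) (Set.Icc 0 T ×ˢ Set.univ)) (x : Spc n) :
    ContinuousOn (fun t => g t x) (Set.Icc 0 T) :=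
  h.comp (f := fun t => (t, x)) (by fun_prop) fun t ht => ⟨ht, Set.mem_univ _⟩

/-- Exchange of one time derivative and one space derivative. -/
theorem hasDerivWithinAt_fderiv [CompleteSpace E] (hT : 0 ≤ T)
    {g w : ℝ → Spc n → E} {g' w' : ℝ → Spc n → (Spc n →L[ℝ] E)} {A : ℝ}
    (hgw : ∀ t ∈ Set.Icc 0 T, ∀ x, HasDerivWithinAt (fun τ => g τ x) (w t x) (Set.Icc 0 T) t)
    (hg : ∀ t ∈ Set.Icc 0 T, ∀ x, HasFDerivAt (g t) (g' t x) x)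
    (hw : ∀ t ∈ Set.Icc 0 T, ∀ x, HasFDerivAt (w t) (w' t x) x)
    (hwc : ContinuousOn (fun z : ℝ × Spc n => w z.1 z.2) (Set.Icc 0 T ×ˢ Set.univ))
    (hwc' : ContinuousOn (fun z : ℝ × Spc n => w' z.1 z.2) (Set.Icc 0 T ×ˢ Set.univ))
    (hb : ∀ t ∈ Set.Icc 0 T, ∀ x, ‖w' t x‖ ≤ A) {t : ℝ} (ht : t ∈ Set.Icc 0 T) (x : Spc n) :
    HasDerivWithinAt (fun τ => g' τ x) (w' t x) (Set.Icc 0 T) t := by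
  refine hasDerivWithinAt_of_eq_integral (c := g' 0 x) hT (continuousOn_slice hwc' x) ?_ ht
  intro τ hτ
  have hsub : Set.Icc 0 τ ⊆ Set.Icc 0 T := Set.Icc_subset_Icc_right hτ.2
  have hmeas : ∀ {F : Type} [NormedAddCommGroup F] (f : ℝ → F), ContinuousOn f (Set.Icc 0 T) →
      IntervalIntegrable f volume 0 τ := fun f hf =>
    (hf.mono (by rw [Set.uIcc_of_le hτ.1]; exact hsub)).intervalIntegrable
  have hI : ∀ r ∈ Set.uIoc 0 τ, r ∈ Set.Icc 0 T := fun r hr => by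
    rw [Set.uIoc_of_le hτ.1] at hr; exact hsub ⟨hr.1.le, hr.2⟩
  have h1 : HasFDerivAt (fun y => ∫ r in (0 : ℝ)..τ, w r y) (∫ r in (0 : ℝ)..τ, w' r x) x := by
    refine intervalIntegral.hasFDerivAt_integral_of_dominated_of_fderiv_le (s := Set.univ)
      (bound := fun _ => A) (F' := fun y r => w' r y) univ_mem
      (Eventually.of_forall fun y => (hmeas _ (continuousOn_slice hwc y)).def'.1)
      (hmeas _ (continuousOn_slice hwc x)) (hmeas _ (continuousOn_slice hwc' x)).def'.1
      (ae_of_all _ fun r hr y _ => hb r (hI r hr) y) intervalIntegrable_const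
      (ae_of_all _ fun r hr y _ => hw r (hI r hr) y)
  have h2 : g τ = fun y => g 0 y + ∫ r in (0 : ℝ)..τ, w r y := funext fun y =>
    eq_add_integral_of_hasDerivWithinAt (F := fun r => g r y) (continuousOn_slice hwc y)
      (fun r hr => hgw r hr y) hτ
  have h3 := hg τ hτ x
  rw [h2] at h3
  exact h3.unique ((hg 0 ⟨le_rfl, hT⟩ x).add h1)

end TimeCalculus

theorem HolderBound.comp_isometry {E F : Type} [NormedAddCommGroup E] [NormedAddCommGroup F]
    {T lam p A : ℝ} {v : ℝ → Spc n → E} (h : HolderBound T lam p A v) {L : E → F}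
    (hL : Isometry L) (hL0 : L 0 = 0) : HolderBound T lam p A (fun t x => L (v t x)) := by
  have h1 : ∀ a b, ‖L a - L b‖ = ‖a - b‖ := fun a b => by
    rw [← dist_eq_norm, ← dist_eq_norm, hL.dist_eq]
  have h0 : ∀ a, ‖L a‖ = ‖a‖ := fun a => by simpa [hL0] using h1 a 0
  refine ⟨hL.continuous.comp_continuousOn h.cont, ?_, ?_, ?_⟩
  · intro t ht x
    rw [h0]; exact h.bound t ht x
  · intro hl t ht x y hxy
    rw [h1]; exact h.space hl t ht x y hxy
  · intro hl t₁ ht₁ t₂ ht₂ x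
    rw [h1]; exact h.time hl t₁ ht₁ t₂ ht₂ x

section Jets

variable {E : Type} [NormedAddCommGroup E] [NormedSpace ℝ E] {T lam p A : ℝ} {N J : ℕ}

/-- Iterated time derivative within `[0,T]` of a vector-valued function. -/
def timeDeriv (T : ℝ) (j : ℕ) (u : ℝ → Spc n → E) (t : ℝ) (x : Spc n) : E :=
  iteratedDerivWithin j (fun τ => u τ x) (Set.Icc 0 T) t

theorem timeDeriv_succ (j : ℕ) (u : ℝ → Spc n → E) (t : ℝ) (x : Spc n) :
    timeDeriv T (j + 1) u t x = derivWithin (fun τ => timeDeriv T j u τ x) (Set.Icc 0 T) t := by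
  rw [timeDeriv, iteratedDerivWithin_succ]; rfl

theorem timeDeriv_succ_of_hasDerivWithinAt (hT : 0 < T) {u w : ℝ → Spc n → E}
    (h : ∀ t ∈ Set.Icc 0 T, ∀ x, HasDerivWithinAt (fun τ => u τ x) (w t x) (Set.Icc 0 T) t)
    (j : ℕ) {t : ℝ} (ht : t ∈ Set.Icc 0 T) (x : Spc n) :
    timeDeriv T (j + 1) u t x = timeDeriv T j w t x := by
  rw [timeDeriv, iteratedDerivWithin_succ']
  refine iteratedDerivWithin_congr (fun τ hτ => ?_) ht
  exact (h τ hτ x).derivWithin (uniqueDiffOn_Icc hT τ hτ)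

/-- All the mixed derivatives, time derivatives being taken first, satisfy `HolderBound`. -/
structure MixedJets (T lam : ℝ) (N J : ℕ) (p A : ℝ) (v : ℝ → Spc n → E) : Prop where
  time : ∀ j ≤ J, 2 * j ≤ N → ∀ x, ContDiffOn ℝ j (fun t => v t x) (Set.Icc 0 T)
  space : ∀ j ≤ J, 2 * j ≤ N → ∀ t ∈ Set.Icc 0 T,
    ContDiff ℝ (N - 2 * j : ℕ) (fun x => timeDeriv T j v t x)
  bound : ∀ j ≤ J, ∀ l, l + 2 * j ≤ N →
    HolderBound T lam (p + l) A (fun t => iteratedFDeriv ℝ l (fun x => timeDeriv T j v t x))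

theorem HolderBound.of_iteratedFDeriv_zero {v : ℝ → Spc n → E}
    (h : HolderBound T lam p A (fun t => iteratedFDeriv ℝ 0 (v t))) : HolderBound T lam p A v := by
  have h0 := h.comp_isometry (L := continuousMultilinearCurryFin0 ℝ (Spc n) E)
    (LinearIsometryEquiv.isometry _) (by simp)
  simpa using h0

theorem MixedJets.timeDeriv_bound {v : ℝ → Spc n → E} (h : MixedJets T lam N J p A v) {j : ℕ}
    (hj : j ≤ J) (hN : 2 * j ≤ N) : HolderBound T lam p A (timeDeriv T j v) := by
  have h0 := h.bound j hj 0 (by omega)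
  simp only [Nat.cast_zero, add_zero] at h0
  exact h0.of_iteratedFDeriv_zero

theorem MixedJets.fderiv_bound {v : ℝ → Spc n → E} (h : MixedJets T lam N J p A v) {j l : ℕ}
    (hj : j ≤ J) (hN : l + 1 + 2 * j ≤ N) :
    HolderBound T lam (p + 1 + l) A
      (fun t => iteratedFDeriv ℝ l (fderiv ℝ (fun x => timeDeriv T j v t x))) := by
  have h0 := (h.bound j hj (l + 1) hN).comp_isometry
    (L := continuousMultilinearCurryRightEquiv' ℝ l (Spc n) E)
    (LinearIsometryEquiv.isometry _)
      (LinearIsometryEquiv.map_zero _)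
  have hp : p + ((l + 1 : ℕ) : ℝ) = p + 1 + l := by push_cast; ring
  rw [hp] at h0
  refine h0.congr fun t _ x => ?_
  rw [iteratedFDeriv_succ_eq_comp_right]
  simp

theorem MixedJets.differentiable {v : ℝ → Spc n → E} (h : MixedJets T lam N J p A v) {j : ℕ}
    (hj : j ≤ J) (hN : 2 * j + 1 ≤ N) {t : ℝ} (ht : t ∈ Set.Icc 0 T) (x : Spc n) :
    HasFDerivAt (fun x => timeDeriv T j v t x) (fderiv ℝ (fun x => timeDeriv T j v t x) x) x :=
  ((h.space j hj (by omega) t ht).differentiable (by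
    norm_cast; omega) x).hasFDerivAt

theorem MixedJets.hasDerivWithinAt (hT : 0 < T) {v : ℝ → Spc n → E}
    (h : MixedJets T lam N J p A v) {j : ℕ}
    (hj : j + 1 ≤ J) (hN : 2 * (j + 1) ≤ N) {t : ℝ} (ht : t ∈ Set.Icc 0 T) (x : Spc n) :
    HasDerivWithinAt (fun τ => timeDeriv T j v τ x) (timeDeriv T (j + 1) v t x)
      (Set.Icc 0 T) t := by
  have h1 := (h.time (j + 1) hj hN x).differentiableOn_iteratedDerivWithin (m := j)
    (by norm_cast; omega) (uniqueDiffOn_Icc hT) t ht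
  rw [timeDeriv_succ]
  exact h1.hasDerivWithinAt

theorem MixedJets.fderiv_hasDerivWithinAt [CompleteSpace E] (hT : 0 < T) (hp : 0 ≤ p)
    {v : ℝ → Spc n → E} (h : MixedJets T lam N J p A v) {j : ℕ}
    (hj : j + 1 ≤ J) (hN : 2 * (j + 1) + 1 ≤ N) {t : ℝ} (ht : t ∈ Set.Icc 0 T) (x : Spc n) :
    HasDerivWithinAt (fun τ => fderiv ℝ (fun x => timeDeriv T j v τ x) x)
      (fderiv ℝ (fun x => timeDeriv T (j + 1) v t x) x) (Set.Icc 0 T) t := by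
  have hb : HolderBound T lam (p + 1) A
      (fun t => fderiv ℝ (fun x => timeDeriv T (j + 1) v t x)) := by
    have h0 := h.fderiv_bound (l := 0) hj (by omega)
    simp only [Nat.cast_zero, add_zero] at h0
    exact h0.of_iteratedFDeriv_zero
  refine hasDerivWithinAt_fderiv (w := fun t x => timeDeriv T (j + 1) v t x) (A := A) hT.le
    (fun t ht x => h.hasDerivWithinAt hT hj (by omega) ht x)
    (fun t ht x => h.differentiable (by omega) (by omega) ht x)
    (fun t ht x => h.differentiable hj (by omega) ht x)
    (h.timeDeriv_bound hj (by omega)).cont hb.cont (fun t ht x => ?_) ht x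
  exact (hb.bound t ht x).trans
    (mul_le_of_le_one_right (hb.nonneg hT.le) (wt_rpow_le_one (by linarith) x))

theorem MixedJets.timeDeriv_fderiv [CompleteSpace E] (hT : 0 < T) (hp : 0 ≤ p)
    {v : ℝ → Spc n → E} (h : MixedJets T lam N J p A v) {j : ℕ}
    (hj : j ≤ J) (hN : 2 * j + 1 ≤ N) {t : ℝ} (ht : t ∈ Set.Icc 0 T) (x : Spc n) :
    timeDeriv T j (fun τ => fderiv ℝ (v τ)) t x = fderiv ℝ (fun x => timeDeriv T j v t x) x := by
  induction j generalizing t x with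
  | zero => simp [timeDeriv]
  | succ j ih =>
    rw [timeDeriv_succ]
    have h1 := h.fderiv_hasDerivWithinAt hT hp hj hN ht x
    exact (h1.congr (fun τ hτ => ih (by omega) (by omega) hτ x)
      (ih (by omega) (by omega) ht x)).derivWithin (uniqueDiffOn_Icc hT t ht)

theorem MixedJets.fderiv [CompleteSpace E] (hT : 0 < T) (hp : 0 ≤ p) {v : ℝ → Spc n → E}
    (h : MixedJets T lam (N + 1) J p A v) :
    MixedJets T lam N J (p + 1) A (fun t => fderiv ℝ (v t)) := by
  refine ⟨fun j hj hN x => ?_, fun j hj hN t ht => ?_, fun j hj l hN => ?_⟩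
  · rw [contDiffOn_nat_iff_continuousOn_differentiableOn_deriv (uniqueDiffOn_Icc hT)]
    have key : ∀ i, i + 1 ≤ j → ∀ t ∈ Set.Icc 0 T, HasDerivWithinAt
        (fun τ => timeDeriv T i (fun τ => _root_.fderiv ℝ (v τ)) τ x)
        (_root_.fderiv ℝ (fun x => timeDeriv T (i + 1) v t x) x) (Set.Icc 0 T) t := by
      intro i hi t ht
      exact (h.fderiv_hasDerivWithinAt hT hp (by omega) (by omega) ht x).congr
        (fun τ hτ => h.timeDeriv_fderiv hT hp (by omega) (by omega) hτ x)
        (h.timeDeriv_fderiv hT hp (by omega) (by omega) ht x)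
    refine ⟨fun i hi => ?_, fun i hi t ht => (key i (by omega) t ht).differentiableWithinAt⟩
    have h0 := h.fderiv_bound (j := i) (l := 0) (by omega) (by omega)
    refine (continuousOn_slice
      (g := fun t => _root_.fderiv ℝ (fun x => NSdeRham.timeDeriv T i v t x))
      h0.of_iteratedFDeriv_zero.cont x).congr fun t ht => ?_
    exact h.timeDeriv_fderiv (j := i) hT hp (by omega) (by omega) ht x
  · have h1 := h.space j hj (by omega) t ht
    rw [show N + 1 - 2 * j = (N - 2 * j) + 1 by omega] at h1
    have h2 := h1.fderiv_right (m := (N - 2 * j : ℕ)) (by norm_cast)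
    rwa [show (fun x => timeDeriv T j (fun t => _root_.fderiv ℝ (v t)) t x) =
      _root_.fderiv ℝ (fun x => timeDeriv T j v t x) from
      funext fun x => h.timeDeriv_fderiv hT hp hj (by omega) ht x]
  · refine (h.fderiv_bound (j := j) (l := l) hj (by omega)).congr fun t ht x => ?_
    rw [show (fun x => timeDeriv T j (fun t => _root_.fderiv ℝ (v t)) t x) =
      _root_.fderiv ℝ (fun x => timeDeriv T j v t x) from
      funext fun x => h.timeDeriv_fderiv hT hp hj (by omega) ht x]

theorem MixedJets.timeDeriv_one (hT : 0 < T) {v : ℝ → Spc n → E}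
    (h : MixedJets T lam (N + 2) (J + 1) p A v) :
    MixedJets T lam N J p A (timeDeriv T 1 v) := by
  have hd : ∀ t ∈ Set.Icc 0 T, ∀ x,
      HasDerivWithinAt (fun τ => v τ x) (timeDeriv T 1 v t x) (Set.Icc 0 T) t := fun t ht x => by
    simpa [timeDeriv] using h.hasDerivWithinAt (j := 0) hT (by omega) (by omega) ht x
  refine ⟨fun j hj hN x => ?_, fun j hj hN t ht => ?_, fun j hj l hN => ?_⟩
  · have h1 := h.time (j + 1) (by omega) (by omega) x
    push_cast at h1
    rw [contDiffOn_succ_iff_derivWithin (uniqueDiffOn_Icc hT)] at h1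
    exact h1.2.2.congr fun t ht => ((hd t ht x).derivWithin (uniqueDiffOn_Icc hT t ht)).symm
  · have h1 := h.space (j + 1) (by omega) (by omega) t ht
    rw [show N + 2 - 2 * (j + 1) = N - 2 * j by omega] at h1
    rwa [show (fun x => timeDeriv T j (timeDeriv T 1 v) t x) =
      fun x => timeDeriv T (j + 1) v t x from
      funext fun x => (timeDeriv_succ_of_hasDerivWithinAt hT hd j ht x).symm]
  · refine (h.bound (j + 1) (by omega) l (by omega)).congr fun t ht x => ?_
    rw [show (fun x => timeDeriv T j (timeDeriv T 1 v) t x) =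
      fun x => timeDeriv T (j + 1) v t x from
      funext fun x => (timeDeriv_succ_of_hasDerivWithinAt hT hd j ht x).symm]

theorem MixedJets.parabolicClass [CompleteSpace E] (hT : 0 < T) (hp : 0 ≤ p) {v : ℝ → Spc n → E}
    (h : MixedJets T lam N J p A v) : ParabolicClass T lam N J p A v := by
  induction N using Nat.strong_induction_on generalizing J p E with
  | _ N ih =>
    refine parabolicClass_iff.2 ⟨?_, ?_, ?_⟩
    · exact (h.timeDeriv_bound (j := 0) (by omega) (by omega)).congr fun t _ x => by
        simp [timeDeriv]
    · rintro M rfl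
      refine ⟨_, fun t ht x => ?_, ih M (by omega) (by linarith) (h.fderiv hT hp)⟩
      simpa [timeDeriv] using h.differentiable (j := 0) (by omega) (by omega) ht x
    · rintro M K rfl rfl
      refine ⟨_, fun t ht x => ?_, ih M (by omega) hp (h.timeDeriv_one hT)⟩
      simpa [timeDeriv] using h.hasDerivWithinAt (j := 0) hT (by omega) (by omega) ht x

theorem ParabolicClass.iteratedFDeriv {v : ℝ → Spc n → E} (h : ParabolicClass T lam N J p A v)
    {l : ℕ} (hl : l ≤ N) : HolderBound T lam (p + l) A (fun t => iteratedFDeriv ℝ l (v t)) := by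
  induction l generalizing N p E with
  | zero =>
    have h0 := h.holderBound.comp_isometry (L := (continuousMultilinearCurryFin0 ℝ (Spc n) E).symm)
      (LinearIsometryEquiv.isometry _)
      (LinearIsometryEquiv.map_zero _)
    simp only [Nat.cast_zero, add_zero]
    refine h0.congr fun t ht x => ?_
    rw [iteratedFDeriv_zero_eq_comp]; simp
  | succ l ih =>
    obtain ⟨N, rfl⟩ : ∃ M, N = M + 1 := ⟨N - 1, by omega⟩
    obtain ⟨v', hv', h'⟩ := h.exists_fderiv
    have h0 := (ih h' (by omega)).comp_isometry
      (L := (continuousMultilinearCurryRightEquiv' ℝ l (Spc n) E).symm)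
      (LinearIsometryEquiv.isometry _)
      (LinearIsometryEquiv.map_zero _)
    have hp : p + ((l + 1 : ℕ) : ℝ) = p + 1 + l := by push_cast; ring
    rw [hp]
    refine h0.congr fun t ht x => ?_
    rw [iteratedFDeriv_succ_eq_comp_right, show (fun y => fderiv ℝ (v t) y) = v' t from
      funext fun y => (hv' t ht y).fderiv]
    simp

theorem ParabolicClass.contDiff {v : ℝ → Spc n → E} (h : ParabolicClass T lam N J p A v) {t : ℝ}
    (ht : t ∈ Set.Icc 0 T) : ContDiff ℝ N (v t) := by
  induction N generalizing p E with
  | zero =>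
    have h0 := h.holderBound.cont.comp_continuous (f := fun x => (t, x)) (by fun_prop)
      fun x => ⟨ht, Set.mem_univ _⟩
    exact contDiff_zero.2 h0
  | succ N ih =>
    obtain ⟨v', hv', h'⟩ := h.exists_fderiv
    push_cast
    exact contDiff_succ_iff_hasFDerivAt.2 ⟨v' t, ih h', hv' t ht⟩

theorem ParabolicClass.timeDeriv (hT : 0 < T) {v : ℝ → Spc n → E}
    (h : ParabolicClass T lam N J p A v) {j : ℕ} (hj : j ≤ J) (hN : 2 * j ≤ N) :
    ParabolicClass T lam (N - 2 * j) (J - j) p A (timeDeriv T j v) := by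
  induction j generalizing N J v with
  | zero => exact h.congr fun t _ x => by simp [NSdeRham.timeDeriv]
  | succ j ih =>
    obtain ⟨N, rfl⟩ : ∃ M, N = M + 2 := ⟨N - 2, by omega⟩
    obtain ⟨J, rfl⟩ : ∃ M, J = M + 1 := ⟨J - 1, by omega⟩
    obtain ⟨w, hw, h'⟩ := h.exists_deriv
    rw [show N + 2 - 2 * (j + 1) = N - 2 * j by omega, show J + 1 - (j + 1) = J - j by omega]
    exact (ih h' (by omega) (by omega)).congr fun t ht x =>
      timeDeriv_succ_of_hasDerivWithinAt hT hw j ht x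

theorem ParabolicClass.contDiffOn_time (hT : 0 < T) {v : ℝ → Spc n → E}
    (h : ParabolicClass T lam N J p A v) {j : ℕ} (hj : j ≤ J) (hN : 2 * j ≤ N) (x : Spc n) :
    ContDiffOn ℝ j (fun t => v t x) (Set.Icc 0 T) := by
  induction j generalizing N J v with
  | zero => simpa using continuousOn_slice h.holderBound.cont x
  | succ j ih =>
    obtain ⟨N, rfl⟩ : ∃ M, N = M + 2 := ⟨N - 2, by omega⟩
    obtain ⟨J, rfl⟩ : ∃ M, J = M + 1 := ⟨J - 1, by omega⟩
    obtain ⟨w, hw, h'⟩ := h.exists_deriv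
    push_cast
    rw [contDiffOn_succ_iff_derivWithin (uniqueDiffOn_Icc hT)]
    refine ⟨fun t ht => (hw t ht x).differentiableWithinAt, by simp, ?_⟩
    exact (ih h' (by omega) (by omega)).congr fun t ht =>
      (hw t ht x).derivWithin (uniqueDiffOn_Icc hT t ht)

end Jets

section NormComparison

variable {E : Type} [NormedAddCommGroup E] [NormedSpace ℝ E] {T lam p A : ℝ}
  {v : ℝ → Spc n → E}

/-- Constant relating `HolderBound` and `eAniso0`. -/
def normConst (lam p : ℝ) : ℝ := 2 ^ (p + lam) + 8

theorem normConst_pos : 0 < normConst lam p := by unfold normConst; positivity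

theorem normConst_mono {p' : ℝ} (h : p ≤ p') : normConst lam p ≤ normConst lam p' := by
  unfold normConst
  gcongr
  norm_num

theorem le_mul_rpow_neg_of_mul_rpow_le {a b c p : ℝ} (ha : 0 < a) (h : a ^ p * b ≤ c) :
    b ≤ c * a ^ (-p) := by
  rw [Real.rpow_neg ha.le, ← div_eq_mul_inv, le_div_iff₀ (Real.rpow_pos_of_pos ha p)]
  linarith

theorem HolderBound.of_eAniso0 (h1 : 0 < lam) (h2 : lam < 1) (hp : 0 ≤ p) (hA : 0 ≤ A)
    (hc : ContinuousOn (fun z : ℝ × Spc n => v z.1 z.2) (Set.Icc 0 T ×ˢ Set.univ))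
    (h : eAniso0 T lam p v ≤ ENNReal.ofReal A) :
    HolderBound T lam p (normConst lam p * A) v := by
  have hC : A ≤ normConst lam p * A := by
    have : (0 : ℝ) < 2 ^ (p + lam) := by positivity
    unfold normConst
    nlinarith
  have hH : ∀ t ∈ Set.Icc 0 T, eHol0 lam p (v t) ≤ ENNReal.ofReal A := fun t ht =>
    (le_iSup (fun t : Set.Icc (0 : ℝ) T => eHol0 lam p (v t)) ⟨t, ht⟩).trans
      (le_self_add.trans h)
  simp only [eHol0, if_neg h1.ne'] at hH
  have hS : ∀ t ∈ Set.Icc 0 T, ∀ x, ‖v t x‖ ≤ A * wt x ^ (-p) := fun t ht x => by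
    refine le_mul_rpow_neg_of_mul_rpow_le (wt_pos x) ((ENNReal.ofReal_le_ofReal_iff hA).1 ?_)
    exact (le_iSup (fun x => ENNReal.ofReal (wt x ^ p * ‖v t x‖)) x).trans
      ((le_add_self.trans le_self_add).trans (hH t ht))
  refine ⟨hc, fun t ht x => (hS t ht x).trans (by gcongr; exact (wt_rpow_pos _ _).le), ?_, ?_⟩
  · intro _ t ht x y hxy
    rcases eq_or_ne x y with rfl | hne
    · simp [Real.zero_rpow h1.ne']
    have hd : 0 < ‖x - y‖ := norm_pos_iff.2 (sub_ne_zero.2 hne)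
    have hdl : 0 < ‖x - y‖ ^ lam := Real.rpow_pos_of_pos hd lam
    have hw := wt_rpow_pos x (-(p + lam))
    rcases le_or_gt ‖y‖ 1 with hy | hy
    · have h3 : ‖v t x - v t y‖ ≤ A * ‖x - y‖ ^ lam := by
        rw [← div_le_iff₀ hdl, ← ENNReal.ofReal_le_ofReal_iff hA]
        refine le_trans ?_ ((le_add_self.trans (le_self_add.trans le_self_add)).trans (hH t ht))
        exact le_iSup₂_of_le x y (le_iSup_of_le ⟨hxy.trans hy, hy, hne⟩ le_rfl)
      have h4 : (1 : ℝ) ≤ 2 ^ (p + lam) * wt x ^ (-(p + lam)) := by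
        rw [Real.rpow_neg (wt_pos x).le, ← div_eq_mul_inv,
          one_le_div (wt_rpow_pos x _)]
        refine Real.rpow_le_rpow (wt_pos x).le ?_ (by linarith)
        linarith [wt_le_one_add_norm x]
      calc _ ≤ A * ‖x - y‖ ^ lam := h3
        _ ≤ (A * ‖x - y‖ ^ lam) * (2 ^ (p + lam) * wt x ^ (-(p + lam))) :=
          le_mul_of_one_le_right (by positivity) h4
        _ = 2 ^ (p + lam) * A * wt x ^ (-(p + lam)) * ‖x - y‖ ^ lam := by ring
        _ ≤ _ := by gcongr; unfold normConst; linarith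
    rcases le_or_gt ‖x - y‖ (‖y‖ / 2) with hxy' | hxy'
    · have h3 : wt2 y x ^ (p + lam) * ‖v t y - v t x‖ / ‖y - x‖ ^ lam ≤ A := by
        rw [← ENNReal.ofReal_le_ofReal_iff hA]
        refine le_trans ?_ (le_add_self.trans (hH t ht))
        exact le_iSup₂_of_le y x (le_iSup_of_le ⟨hne.symm, by rwa [norm_sub_rev]⟩ le_rfl)
      rw [norm_sub_rev y x, norm_sub_rev (v t y), div_le_iff₀ hdl] at h3
      have h4 : wt x ^ (p + lam) * ‖v t x - v t y‖ ≤ A * ‖x - y‖ ^ lam := by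
        refine le_trans (mul_le_mul_of_nonneg_right ?_ (norm_nonneg _)) h3
        exact Real.rpow_le_rpow (wt_pos x).le (le_max_right _ _) (by linarith)
      calc _ ≤ A * ‖x - y‖ ^ lam * wt x ^ (-(p + lam)) :=
            le_mul_rpow_neg_of_mul_rpow_le (wt_pos x) h4
        _ = A * wt x ^ (-(p + lam)) * ‖x - y‖ ^ lam := by ring
        _ ≤ _ := by gcongr
    · have h3 : wt x ^ lam ≤ 4 * ‖x - y‖ ^ lam := by
        calc wt x ^ lam ≤ (4 * ‖x - y‖) ^ lam := by
              refine Real.rpow_le_rpow (wt_pos x).le ?_ h1.le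
              linarith [wt_mono hxy, wt_le_one_add_norm y]
          _ = 4 ^ lam * ‖x - y‖ ^ lam := Real.mul_rpow (by norm_num) hd.le
          _ ≤ 4 ^ (1 : ℝ) * ‖x - y‖ ^ lam := by gcongr; norm_num
          _ = _ := by norm_num
      have h4 : wt x ^ (-p) = wt x ^ (-(p + lam)) * wt x ^ lam := by
        rw [← Real.rpow_add (wt_pos x)]; congr 1; ring
      calc ‖v t x - v t y‖ ≤ ‖v t x‖ + ‖v t y‖ := norm_sub_le _ _
        _ ≤ A * wt x ^ (-p) + A * wt x ^ (-p) := by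
          refine add_le_add (hS t ht x) ((hS t ht y).trans ?_)
          exact mul_le_mul_of_nonneg_left (wt_rpow_le_of_norm_le hp hxy) hA
        _ = 2 * A * wt x ^ (-(p + lam)) * wt x ^ lam := by rw [h4]; ring
        _ ≤ 2 * A * wt x ^ (-(p + lam)) * (4 * ‖x - y‖ ^ lam) := by gcongr
        _ = 8 * A * wt x ^ (-(p + lam)) * ‖x - y‖ ^ lam := by ring
        _ ≤ _ := by
          gcongr
          unfold normConst
          linarith [Real.rpow_pos_of_pos (two_pos (α := ℝ)) (p + lam)]
  · intro _ t₁ ht₁ t₂ ht₂ x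
    rcases eq_or_ne t₁ t₂ with rfl | hne
    · simp [Real.zero_rpow (half_pos h1).ne']
    have hd : 0 < |t₁ - t₂| ^ (lam / 2) := Real.rpow_pos_of_pos (abs_pos.2 (sub_ne_zero.2 hne)) _
    have h3 : wt x ^ p * ‖v t₁ x - v t₂ x‖ / |t₁ - t₂| ^ (lam / 2) ≤ A := by
      rw [← ENNReal.ofReal_le_ofReal_iff hA]
      refine le_trans ?_ (le_add_self.trans h)
      rw [if_neg h1.ne']
      exact le_iSup₂_of_le (⟨t₁, ht₁⟩ : Set.Icc (0 : ℝ) T) (⟨t₂, ht₂⟩ : Set.Icc (0 : ℝ) T)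
        (le_iSup₂_of_le hne x le_rfl)
    rw [div_le_iff₀ hd] at h3
    calc _ ≤ A * |t₁ - t₂| ^ (lam / 2) * wt x ^ (-p) :=
          le_mul_rpow_neg_of_mul_rpow_le (wt_pos x) h3
      _ = A * wt x ^ (-p) * |t₁ - t₂| ^ (lam / 2) := by ring
      _ ≤ _ := by gcongr; exact (wt_rpow_pos _ _).le

theorem wt_le_two_mul_wt {x y : Spc n} (h : ‖x‖ ≤ 2 * ‖y‖) : wt x ≤ 2 * wt y := by
  have h2 : (2 : ℝ) * wt y = Real.sqrt (4 * (1 + ‖y‖ ^ 2)) := by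
    rw [Real.sqrt_mul (by norm_num), show (4 : ℝ) = 2 ^ 2 by norm_num,
      Real.sqrt_sq (by norm_num)]; rfl
  rw [h2]
  exact Real.sqrt_le_sqrt (by nlinarith [norm_nonneg x, norm_nonneg y])

theorem HolderBound.eAniso0_le (hT : 0 ≤ T) (h1 : 0 < lam) (hp : 0 ≤ p)
    (h : HolderBound T lam p A v) :
    eAniso0 T lam p v ≤ ENNReal.ofReal (normConst lam p * A) := by
  have hA := h.nonneg hT
  have h2 : (0 : ℝ) < 2 ^ (p + lam) := by positivity
  have hS : ∀ t ∈ Set.Icc 0 T, ∀ x, wt x ^ p * ‖v t x‖ ≤ A := fun t ht x => by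
    have := h.bound t ht x
    rw [Real.rpow_neg (wt_pos x).le, ← div_eq_mul_inv, le_div_iff₀ (wt_rpow_pos x p)] at this
    linarith
  have hX : ∀ t ∈ Set.Icc 0 T, ∀ x y : Spc n, ‖x‖ ≤ ‖y‖ →
      wt x ^ (p + lam) * ‖v t x - v t y‖ ≤ A * ‖x - y‖ ^ lam := fun t ht x y hxy => by
    have := h.space h1 t ht x y hxy
    rw [Real.rpow_neg (wt_pos x).le, mul_right_comm, ← div_eq_mul_inv,
      le_div_iff₀ (wt_rpow_pos x _)] at this
    linarith
  have hX1 : ∀ t ∈ Set.Icc 0 T, ∀ x y : Spc n, ‖v t x - v t y‖ ≤ A * ‖x - y‖ ^ lam := by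
    have key : ∀ t ∈ Set.Icc 0 T, ∀ x y : Spc n, ‖x‖ ≤ ‖y‖ →
        ‖v t x - v t y‖ ≤ A * ‖x - y‖ ^ lam := fun t ht x y hxy =>
      (le_mul_of_one_le_left (norm_nonneg _)
        (Real.one_le_rpow (one_le_wt x) (by linarith))).trans (hX t ht x y hxy)
    intro t ht x y
    rcases le_total ‖x‖ ‖y‖ with hxy | hxy
    · exact key t ht x y hxy
    · rw [norm_sub_rev, norm_sub_rev x]; exact key t ht y x hxy
  have hX2 : ∀ t ∈ Set.Icc 0 T, ∀ x y : Spc n, ‖x‖ ≤ 2 * ‖y‖ → ‖y‖ ≤ 2 * ‖x‖ →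
      wt2 x y ^ (p + lam) * ‖v t x - v t y‖ ≤ 2 ^ (p + lam) * A * ‖x - y‖ ^ lam := by
    have key : ∀ t ∈ Set.Icc 0 T, ∀ x y : Spc n, ‖x‖ ≤ ‖y‖ → ‖y‖ ≤ 2 * ‖x‖ →
        wt2 x y ^ (p + lam) * ‖v t x - v t y‖ ≤ 2 ^ (p + lam) * A * ‖x - y‖ ^ lam := by
      intro t ht x y hxy hyx
      have h3 : wt2 x y ^ (p + lam) ≤ 2 ^ (p + lam) * wt x ^ (p + lam) := by
        rw [← Real.mul_rpow zero_le_two (wt_pos x).le]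
        refine Real.rpow_le_rpow ((wt_pos x).le.trans (le_max_left _ _)) ?_ (by linarith)
        exact max_le (by linarith [wt_pos x]) (wt_le_two_mul_wt hyx)
      calc _ ≤ 2 ^ (p + lam) * wt x ^ (p + lam) * ‖v t x - v t y‖ := by gcongr
        _ ≤ _ := by
          rw [mul_assoc, mul_assoc]
          exact mul_le_mul_of_nonneg_left (hX t ht x y hxy) h2.le
    intro t ht x y hxy hyx
    rcases le_total ‖x‖ ‖y‖ with hxy' | hxy'
    · exact key t ht x y hxy' hyx
    · rw [norm_sub_rev, norm_sub_rev x, wt2, max_comm]; exact key t ht y x hxy' hxy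
  have hpos : ∀ {x y : Spc n}, x ≠ y → 0 < ‖x - y‖ ^ lam := fun hne =>
    Real.rpow_pos_of_pos (norm_pos_iff.2 (sub_ne_zero.2 hne)) lam
  have hsplit : ENNReal.ofReal (normConst lam p * A) =
      ((ENNReal.ofReal A + ENNReal.ofReal A) + ENNReal.ofReal A +
        ENNReal.ofReal (2 ^ (p + lam) * A)) + ENNReal.ofReal (5 * A) := by
    rw [← ENNReal.ofReal_add hA hA, ← ENNReal.ofReal_add (by positivity) hA,
      ← ENNReal.ofReal_add (by positivity) (by positivity),
      ← ENNReal.ofReal_add (by positivity) (by positivity)]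
    congr 1
    unfold normConst
    ring
  rw [hsplit]
  refine add_le_add (iSup_le fun t => ?_) ?_
  · rw [eHol0, if_neg h1.ne']
    refine add_le_add (add_le_add (add_le_add ?_ ?_) ?_) ?_
    · refine iSup₂_le fun x _ => ENNReal.ofReal_le_ofReal ?_
      exact (le_mul_of_one_le_left (norm_nonneg _)
        (Real.one_le_rpow (one_le_wt x) hp)).trans (hS t t.2 x)
    · refine iSup₂_le fun x y => iSup_le fun hxy => ENNReal.ofReal_le_ofReal ?_
      rw [div_le_iff₀ (hpos hxy.2.2)]
      exact hX1 t t.2 x y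
    · exact iSup_le fun x => ENNReal.ofReal_le_ofReal (hS t t.2 x)
    · refine iSup₂_le fun x y => iSup_le fun hxy => ENNReal.ofReal_le_ofReal ?_
      rw [div_le_iff₀ (hpos hxy.1)]
      have h3 := norm_sub_norm_le x y
      have h4 := norm_sub_norm_le y x
      rw [norm_sub_rev] at h4
      exact hX2 t t.2 x y (by linarith [hxy.2]) (by linarith [hxy.2, norm_nonneg x])
  · rw [if_neg h1.ne']
    refine iSup₂_le fun t₁ t₂ => iSup₂_le fun hne x => ENNReal.ofReal_le_ofReal ?_
    rw [div_le_iff₀ (Real.rpow_pos_of_pos (abs_pos.2 (sub_ne_zero.2 hne)) _)]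
    have h3 := h.time h1 t₁ t₁.2 t₂ t₂.2 x
    rw [Real.rpow_neg (wt_pos x).le, mul_right_comm, ← div_eq_mul_inv,
      le_div_iff₀ (wt_rpow_pos x _)] at h3
    have h4 : 0 ≤ |(t₁ : ℝ) - t₂| ^ (lam / 2) := by positivity
    nlinarith [mul_nonneg hA h4]

end NormComparison

section AnisoComparison

variable {T lam p A : ℝ} {k s : ℕ} {v : ℝ → Spc n → ℝ}

/-- Constant relating the norm of `C^{k,𝐬(s,λ,δ)}_T` and `ParabolicClass`. -/
def anisoConst (k s : ℕ) (lam p : ℝ) : ℝ :=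
  (k + 1) * (2 * s + 1) * (s + 1) * normConst lam (p + (2 * s + k))

theorem anisoConst_pos : 0 < anisoConst k s lam p := by
  unfold anisoConst
  have := normConst_pos (lam := lam) (p := p + (2 * s + k))
  positivity

theorem mixedJets_of_eAnisoKS (h1 : 0 < lam) (h2 : lam < 1) (hp : 0 ≤ p) (hA : 0 ≤ A)
    (hv : AnisoReg T k s v) (h : eAnisoKS T k s lam p v ≤ ENNReal.ofReal A) :
    MixedJets T lam (2 * s + k) s p (anisoConst k s lam p * A) v := by
  have hs1 : normConst lam (p + (2 * s + k)) ≤ anisoConst k s lam p := by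
    unfold anisoConst
    refine le_mul_of_one_le_left normConst_pos.le ?_
    norm_cast
    nlinarith [Nat.zero_le k, Nat.zero_le s, Nat.zero_le (k * s), Nat.zero_le (s * s),
      Nat.zero_le (k * s * s)]
  refine ⟨fun j hj _ x => (hv.1 x).of_le (by exact_mod_cast hj), fun j hj hN t ht => ?_,
    fun j hj l hl => ?_⟩
  · refine (hv.2.1 j hj t ht).of_le ?_
    rw [show 2 * s + k - 2 * j = 2 * (s - j) + k by omega]
    push_cast
    exact le_rfl
  · obtain ⟨b, m, hb, hm, rfl⟩ : ∃ b m, b ≤ k ∧ m + 2 * j ≤ 2 * s ∧ l = b + m := by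
      by_cases hlk : l ≤ k
      · exact ⟨l, 0, hlk, by omega, by omega⟩
      · exact ⟨k, l - k, le_rfl, by omega, by omega⟩
    have h3 : eAniso0 T lam (p + b + m) (mixDeriv T (b + m) j v) ≤ ENNReal.ofReal A := by
      refine le_trans ?_ h
      unfold eAnisoKS
      refine le_trans ?_ (Finset.single_le_sum (f := fun b : ℕ => ∑ m ∈ Finset.range (2 * s + 1),
        ∑ j ∈ Finset.range (s + 1), if m + 2 * j ≤ 2 * s then
          eAniso0 T lam (p + b + m) (mixDeriv T (b + m) j v) else 0)
        (fun _ _ => zero_le) (Finset.mem_range.2 (Nat.lt_succ_of_le hb)))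
      refine le_trans ?_ (Finset.single_le_sum (f := fun m : ℕ =>
        ∑ j ∈ Finset.range (s + 1), if m + 2 * j ≤ 2 * s then
          eAniso0 T lam (p + b + m) (mixDeriv T (b + m) j v) else 0)
        (fun _ _ => zero_le) (Finset.mem_range.2 (show m < 2 * s + 1 by omega)))
      refine le_trans ?_ (Finset.single_le_sum (f := fun j : ℕ => if m + 2 * j ≤ 2 * s then
          eAniso0 T lam (p + b + m) (mixDeriv T (b + m) j v) else 0)
        (fun _ _ => zero_le) (Finset.mem_range.2 (show j < s + 1 by omega)))
      simp only [if_pos hm, le_refl]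
    have hc : ContinuousOn (fun z : ℝ × Spc n => mixDeriv T (b + m) j v z.1 z.2)
        (Set.Icc 0 T ×ˢ Set.univ) := by
      have h4 := hv.2.2 j (b + m) hj hl
      rw [continuousOn_iff_continuous_domRestrict]
      exact h4.comp (g := fun p : Set.Icc (0 : ℝ) T × Spc n => mixDeriv T (b + m) j v p.1 p.2)
        (f := fun z : (Set.Icc 0 T ×ˢ Set.univ : Set (ℝ × Spc n)) =>
          ((⟨z.1.1, z.2.1⟩ : Set.Icc (0 : ℝ) T), z.1.2)) (by fun_prop)
    have h5 := HolderBound.of_eAniso0 h1 h2 (by positivity) hA hc h3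
    rw [show p + b + m = p + ((b + m : ℕ) : ℝ) by push_cast; ring] at h5
    rcases le_or_gt 0 T with hT | hT
    · refine h5.mono hT ?_ le_rfl
      refine mul_le_mul_of_nonneg_right ((normConst_mono ?_).trans hs1) hA
      have : ((b + m : ℕ) : ℝ) ≤ ((2 * s + k : ℕ) : ℝ) := by exact_mod_cast (by omega)
      push_cast at this ⊢
      linarith
    · exact ⟨by simp [Set.Icc_eq_empty (not_le.2 hT)],
        by simp [Set.Icc_eq_empty (not_le.2 hT)], by simp [Set.Icc_eq_empty (not_le.2 hT)],
        by simp [Set.Icc_eq_empty (not_le.2 hT)]⟩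

theorem ParabolicClass.of_eAnisoKS (hT : 0 < T) (h1 : 0 < lam) (h2 : lam < 1) (hp : 0 ≤ p)
    (hA : 0 ≤ A) (hv : AnisoReg T k s v) (h : eAnisoKS T k s lam p v ≤ ENNReal.ofReal A) :
    ParabolicClass T lam (2 * s + k) s p (anisoConst k s lam p * A) v :=
  (mixedJets_of_eAnisoKS h1 h2 hp hA hv h).parabolicClass hT hp

theorem ParabolicClass.holderBound_mixDeriv (hT : 0 < T)
    (h : ParabolicClass T lam (2 * s + k) s p A v) {j l : ℕ} (hj : j ≤ s)
    (hl : l + 2 * j ≤ 2 * s + k) : HolderBound T lam (p + l) A (mixDeriv T l j v) :=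
  (h.timeDeriv hT hj (by omega)).iteratedFDeriv (by omega)

theorem ParabolicClass.anisoReg (hT : 0 < T) (h : ParabolicClass T lam (2 * s + k) s p A v) :
    AnisoReg T k s v := by
  refine ⟨fun x => h.contDiffOn_time hT le_rfl (by omega) x, fun j hj t ht => ?_,
    fun j m hj hm => ?_⟩
  · refine ((h.timeDeriv hT hj (by omega)).contDiff ht).of_le ?_
    rw [show 2 * s + k - 2 * j = 2 * (s - j) + k by omega]
    push_cast
    exact le_rfl
  · have h3 := (h.holderBound_mixDeriv hT hj hm).cont
    exact h3.comp_continuous (f := fun p : Set.Icc (0 : ℝ) T × Spc n => ((p.1 : ℝ), p.2))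
      (by fun_prop) fun z => ⟨z.1.2, Set.mem_univ _⟩

theorem ParabolicClass.eAnisoKS_le (hT : 0 < T) (h1 : 0 < lam) (hp : 0 ≤ p)
    (h : ParabolicClass T lam (2 * s + k) s p A v) :
    eAnisoKS T k s lam p v ≤ ENNReal.ofReal (anisoConst k s lam p * A) := by
  have hA := h.nonneg hT.le
  have hterm : ∀ b ∈ Finset.range (k + 1), ∀ m ∈ Finset.range (2 * s + 1),
      ∀ j ∈ Finset.range (s + 1), (if m + 2 * j ≤ 2 * s then
        eAniso0 T lam (p + b + m) (mixDeriv T (b + m) j v) else 0) ≤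
      ENNReal.ofReal (normConst lam (p + (2 * s + k)) * A) := by
    intro b hb m hm j hj
    rw [Finset.mem_range] at hb hm hj
    split_ifs with hmj
    · have h3 := h.holderBound_mixDeriv hT (j := j) (l := b + m) (by omega) (by omega)
      rw [show p + ((b + m : ℕ) : ℝ) = p + b + m by push_cast; ring] at h3
      refine (h3.eAniso0_le hT.le h1 (by positivity)).trans (ENNReal.ofReal_le_ofReal ?_)
      refine mul_le_mul_of_nonneg_right (normConst_mono ?_) hA
      have : ((b + m : ℕ) : ℝ) ≤ ((2 * s + k : ℕ) : ℝ) := by exact_mod_cast (by omega)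
      push_cast at this ⊢
      linarith
    · exact zero_le
  refine (Finset.sum_le_sum fun b hb => Finset.sum_le_sum fun m hm =>
    Finset.sum_le_sum fun j hj => hterm b hb m hm j hj).trans ?_
  simp only [Finset.sum_const, Finset.card_range, nsmul_eq_mul]
  unfold anisoConst
  have hc := normConst_pos (lam := lam) (p := p + (2 * s + k))
  have hcast : ∀ m : ℕ, ((m : ℕ) : ℝ≥0∞) = ENNReal.ofReal m := fun m =>
    (ENNReal.ofReal_natCast m).symm
  rw [hcast, hcast, hcast, ← ENNReal.ofReal_mul (by positivity),
    ← ENNReal.ofReal_mul (by positivity), ← ENNReal.ofReal_mul (by positivity)]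
  refine ENNReal.ofReal_le_ofReal (le_of_eq ?_)
  push_cast
  ring

end AnisoComparison

section Kernels

variable {G G' : Type} [NormedAddCommGroup G] [NormedSpace ℝ G]
  [NormedAddCommGroup G'] [NormedSpace ℝ G']

/-- Continuous kernels decaying faster than any power. -/
structure RapidDecay (κ : Spc n → G) : Prop where
  cont : Continuous κ
  decay : ∀ M : ℕ, ∃ C : ℝ, ∀ z, (1 + ‖z‖) ^ M * ‖κ z‖ ≤ C

theorem RapidDecay.clm {κ : Spc n → G} (h : RapidDecay κ) (L : G →L[ℝ] G') :
    RapidDecay fun z => L (κ z) := by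
  refine ⟨L.continuous.comp h.cont, fun M => ?_⟩
  obtain ⟨C, hC⟩ := h.decay M
  refine ⟨‖L‖ * C, fun z => ?_⟩
  calc (1 + ‖z‖) ^ M * ‖L (κ z)‖ ≤ (1 + ‖z‖) ^ M * (‖L‖ * ‖κ z‖) := by
        gcongr; exact L.le_opNorm _
    _ = ‖L‖ * ((1 + ‖z‖) ^ M * ‖κ z‖) := by ring
    _ ≤ _ := by gcongr; exact hC z

theorem integrable_one_add_norm_rpow_neg : Integrable fun z : Spc n =>
    (1 + ‖z‖) ^ (-((n : ℝ) + 1)) :=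
  integrable_one_add_norm (by simp)

theorem RapidDecay.exists_le {κ : Spc n → G} (h : RapidDecay κ) (p : ℝ) :
    ∃ C : ℝ, 0 ≤ C ∧ ∀ z, (1 + ‖z‖) ^ p * ‖κ z‖ ≤ C * (1 + ‖z‖) ^ (-((n : ℝ) + 1)) := by
  obtain ⟨M, hM⟩ := exists_nat_ge (p + (n + 1))
  obtain ⟨C, hC⟩ := h.decay M
  refine ⟨C, (by positivity : (0 : ℝ) ≤ _).trans (hC 0), fun z => ?_⟩
  have hz : 0 < 1 + ‖z‖ := by positivity
  have hz1 : 1 ≤ 1 + ‖z‖ := by linarith [norm_nonneg z]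
  have h2 : (1 + ‖z‖) ^ p ≤ (1 + ‖z‖) ^ (-((n : ℝ) + 1)) * (1 + ‖z‖) ^ M := by
    rw [← Real.rpow_natCast, ← Real.rpow_add hz]
    exact Real.rpow_le_rpow_of_exponent_le hz1 (by linarith)
  calc _ ≤ (1 + ‖z‖) ^ (-((n : ℝ) + 1)) * (1 + ‖z‖) ^ M * ‖κ z‖ := by gcongr
    _ = (1 + ‖z‖) ^ (-((n : ℝ) + 1)) * ((1 + ‖z‖) ^ M * ‖κ z‖) := by ring
    _ ≤ (1 + ‖z‖) ^ (-((n : ℝ) + 1)) * C := by gcongr; exact hC z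
    _ = _ := mul_comm _ _

theorem RapidDecay.integrable_weight {κ : Spc n → G} (h : RapidDecay κ) (p : ℝ) :
    Integrable fun z => (1 + ‖z‖) ^ p * ‖κ z‖ := by
  obtain ⟨C, _, hC⟩ := h.exists_le p
  refine (integrable_one_add_norm_rpow_neg.const_mul C).mono' ?_ (ae_of_all _ fun z => ?_)
  · refine Continuous.aestronglyMeasurable ((Continuous.rpow_const (by fun_prop) fun z => ?_).mul
      h.cont.norm)
    exact Or.inl (by positivity)
  · rw [Real.norm_of_nonneg (by positivity)]
    exact hC z

/-- Weighted `L¹` norm of a kernel. -/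
def kerMass (κ : Spc n → G) (p : ℝ) : ℝ := ∫ z, (1 + ‖z‖) ^ p * ‖κ z‖

theorem kerMass_nonneg (κ : Spc n → G) (p : ℝ) : 0 ≤ kerMass κ p :=
  integral_nonneg fun z => by positivity

theorem RapidDecay.integrable_norm {κ : Spc n → G} (h : RapidDecay κ) :
    Integrable fun z => ‖κ z‖ := by simpa using h.integrable_weight 0

/-- The Gaussian kernel at time one. -/
def gaussKer (μ : ℝ) (z : Spc n) : ℝ :=
  (4 * Real.pi * μ) ^ (-(n : ℝ) / 2) * Real.exp (-‖z‖ ^ 2 / (4 * μ))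

/-- The derivative of the Gaussian kernel at time one. -/
def gaussGrad (μ : ℝ) (z : Spc n) : Spc n →L[ℝ] ℝ :=
  (-(1 / (2 * μ)) * gaussKer μ z) • innerSL ℝ z

variable {μ : ℝ}

theorem hasFDerivAt_gaussKer (z : Spc n) : HasFDerivAt (gaussKer μ) (gaussGrad μ z) z := by
  have h1 : HasFDerivAt (fun z : Spc n => -‖z‖ ^ 2 / (4 * μ)) (-(1 / (2 * μ)) • innerSL ℝ z) z := by
    have := ((hasStrictFDerivAt_norm_sq z).hasFDerivAt).const_mul (-(1 / (4 * μ)))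
    have h2 : (fun z : Spc n => -‖z‖ ^ 2 / (4 * μ)) = fun z => -(1 / (4 * μ)) * ‖z‖ ^ 2 := by
      funext z; ring
    rw [h2]
    refine this.congr_fderiv ?_
    ext y
    simp
    ring
  have h3 := (h1.exp).const_mul ((4 * Real.pi * μ) ^ (-(n : ℝ) / 2))
  refine h3.congr_fderiv ?_
  ext y
  simp [gaussGrad, gaussKer]
  ring

theorem continuous_gaussKer : Continuous (gaussKer μ : Spc n → ℝ) := by
  unfold gaussKer; fun_prop

theorem continuous_gaussGrad : Continuous (gaussGrad μ : Spc n → _) := by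
  unfold gaussGrad
  exact (continuous_const.mul continuous_gaussKer).smul (innerSL ℝ).continuous

theorem rapidDecay_gaussKer (hμ : 0 < μ) : RapidDecay (gaussKer μ : Spc n → ℝ) := by
  refine ⟨continuous_gaussKer, fun M => ?_⟩
  refine ⟨M.factorial * ((4 * Real.pi * μ) ^ (-(n : ℝ) / 2) * Real.exp (1 + μ)), fun z => ?_⟩
  have h1 : (1 + ‖z‖) ^ M ≤ M.factorial * Real.exp (1 + ‖z‖) := by
    have := Real.pow_div_factorial_le_exp (1 + ‖z‖) (by positivity) M
    rwa [div_le_iff₀' (by positivity)] at this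
  have h2 : Real.exp (1 + ‖z‖) * Real.exp (-‖z‖ ^ 2 / (4 * μ)) ≤ Real.exp (1 + μ) := by
    rw [← Real.exp_add]
    refine Real.exp_le_exp.2 ?_
    have h3 : ‖z‖ - ‖z‖ ^ 2 / (4 * μ) ≤ μ := by
      rw [sub_le_iff_le_add, ← sub_le_iff_le_add', le_div_iff₀ (by positivity)]
      nlinarith [sq_nonneg (‖z‖ - 2 * μ)]
    rw [neg_div]
    linarith
  have hc : 0 ≤ (4 * Real.pi * μ) ^ (-(n : ℝ) / 2) := by positivity
  rw [gaussKer, Real.norm_of_nonneg (by positivity)]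
  calc _ ≤ M.factorial * Real.exp (1 + ‖z‖) *
        ((4 * Real.pi * μ) ^ (-(n : ℝ) / 2) * Real.exp (-‖z‖ ^ 2 / (4 * μ))) := by gcongr
    _ = M.factorial * ((4 * Real.pi * μ) ^ (-(n : ℝ) / 2) *
        (Real.exp (1 + ‖z‖) * Real.exp (-‖z‖ ^ 2 / (4 * μ)))) := by ring
    _ ≤ _ := by gcongr

theorem rapidDecay_gaussGrad (hμ : 0 < μ) : RapidDecay (gaussGrad μ : Spc n → _) := by
  refine ⟨continuous_gaussGrad, fun M => ?_⟩
  obtain ⟨C, hC⟩ := (rapidDecay_gaussKer (n := n) hμ).decay (M + 1)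
  refine ⟨1 / (2 * μ) * C, fun z => ?_⟩
  have h1 : ‖gaussGrad μ z‖ = 1 / (2 * μ) * (‖gaussKer μ z‖ * ‖z‖) := by
    rw [gaussGrad, norm_smul, innerSL_apply_norm, norm_mul, norm_neg,
      Real.norm_of_nonneg (by positivity : 0 ≤ 1 / (2 * μ)), mul_assoc]
  rw [h1]
  calc _ = 1 / (2 * μ) * ((1 + ‖z‖) ^ M * ‖z‖ * ‖gaussKer μ z‖) := by ring
    _ ≤ 1 / (2 * μ) * ((1 + ‖z‖) ^ M * (1 + ‖z‖) * ‖gaussKer μ z‖) := by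
      gcongr; linarith
    _ = 1 / (2 * μ) * ((1 + ‖z‖) ^ (M + 1) * ‖gaussKer μ z‖) := by ring
    _ ≤ _ := by gcongr; exact hC z

theorem integral_gaussKer (hμ : 0 < μ) : ∫ z : Spc n, gaussKer μ z = 1 := by
  have h1 := GaussianFourier.integral_rexp_neg_mul_sq_norm (V := Spc n) (b := 1 / (4 * μ))
    (by positivity)
  have h2 : ∀ z : Spc n, gaussKer μ z =
      (4 * Real.pi * μ) ^ (-(n : ℝ) / 2) * Real.exp (-(1 / (4 * μ)) * ‖z‖ ^ 2) := fun z => by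
    rw [gaussKer]; congr 2; ring
  simp_rw [h2]
  rw [integral_const_mul, h1, finrank_euclideanSpace_fin,
    show Real.pi / (1 / (4 * μ)) = 4 * Real.pi * μ by field_simp,
    ← Real.rpow_add (by positivity), neg_div, neg_add_cancel, Real.rpow_zero]

variable {E F : Type} [NormedAddCommGroup E] [NormedSpace ℝ E]
  [NormedAddCommGroup F] [NormedSpace ℝ F]

/-- Averages of `g` over translations, with an operator valued kernel. -/
def heatAvg (κ : Spc n → (E →L[ℝ] F)) (g : Spc n → E) (ρ : ℝ) (x : Spc n) : F :=
  ∫ z, κ z (g (x - ρ • z))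

theorem integrable_heatAvg {κ : Spc n → (E →L[ℝ] F)} (hκ : RapidDecay κ) {g : Spc n → E} {A : ℝ}
    (hg : Continuous g) (hb : ∀ y, ‖g y‖ ≤ A) (ρ : ℝ) (x : Spc n) :
    Integrable fun z => κ z (g (x - ρ • z)) := by
  refine (hκ.integrable_norm.mul_const A).mono'
    (Continuous.aestronglyMeasurable (hκ.cont.clm_apply (by fun_prop)))
    (ae_of_all _ fun z => ?_)
  exact (κ z).le_of_opNorm_le_of_le le_rfl (hb _)

theorem norm_integral_kernel_le {κ : Spc n → (E →L[ℝ] F)} (hκ : RapidDecay κ) {g : Spc n → E}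
    {B p : ℝ} (hg : ∀ z, ‖g z‖ ≤ B * (1 + ‖z‖) ^ p) :
    ‖∫ z, κ z (g z)‖ ≤ kerMass κ p * B := by
  rw [kerMass, ← integral_mul_const]
  refine norm_integral_le_of_norm_le ((hκ.integrable_weight p).mul_const B)
    (ae_of_all _ fun z => ?_)
  calc ‖κ z (g z)‖ ≤ ‖κ z‖ * (B * (1 + ‖z‖) ^ p) := (κ z).le_of_opNorm_le_of_le le_rfl (hg z)
    _ = _ := by ring

theorem heatAvg_sub {κ : Spc n → (E →L[ℝ] F)} (hκ : RapidDecay κ) {g₁ g₂ : Spc n → E} {A : ℝ}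
    (hg₁ : Continuous g₁) (hb₁ : ∀ y, ‖g₁ y‖ ≤ A) (hg₂ : Continuous g₂) (hb₂ : ∀ y, ‖g₂ y‖ ≤ A)
    (ρ : ℝ) (x₁ x₂ : Spc n) : heatAvg κ g₁ ρ x₁ - heatAvg κ g₂ ρ x₂ =
      ∫ z, κ z (g₁ (x₁ - ρ • z) - g₂ (x₂ - ρ • z)) := by
  simp_rw [map_sub]
  exact (integral_sub (integrable_heatAvg hκ hg₁ hb₁ ρ x₁)
    (integrable_heatAvg hκ hg₂ hb₂ ρ x₂)).symm

theorem wt_rpow_translate_le {p R ρ : ℝ} (hp : 0 ≤ p) (hρ : |ρ| ≤ R) {x y : Spc n}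
    (hxy : ‖x‖ ≤ ‖y‖) (z : Spc n) :
    wt (y - ρ • z) ^ (-p) ≤ (1 + R) ^ p * wt x ^ (-p) * (1 + ‖z‖) ^ p := by
  have hR : 0 ≤ R := (abs_nonneg ρ).trans hρ
  have h1 : wt x ≤ wt (y - ρ • z) * ((1 + R) * (1 + ‖z‖)) := by
    refine (wt_mono hxy).trans ((wt_le_wt_sub_mul y (ρ • z)).trans ?_)
    refine mul_le_mul_of_nonneg_left ?_ (wt_pos _).le
    rw [norm_smul, Real.norm_eq_abs]
    nlinarith [norm_nonneg z, mul_le_mul_of_nonneg_right hρ (norm_nonneg z)]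
  have h2 : wt x ^ p ≤ wt (y - ρ • z) ^ p * ((1 + R) ^ p * (1 + ‖z‖) ^ p) := by
    rw [← Real.mul_rpow (by positivity) (by positivity),
      ← Real.mul_rpow (wt_pos _).le (by positivity)]
    exact Real.rpow_le_rpow (wt_pos x).le h1 hp
  rw [Real.rpow_neg (wt_pos _).le, Real.rpow_neg (wt_pos _).le,
    inv_le_iff_one_le_mul₀ (wt_rpow_pos _ _)]
  have h3 := wt_rpow_pos x p
  rw [show (1 + R) ^ p * (wt x ^ p)⁻¹ * (1 + ‖z‖) ^ p * wt (y - ρ • z) ^ p =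
    (wt (y - ρ • z) ^ p * ((1 + R) ^ p * (1 + ‖z‖) ^ p)) / wt x ^ p by ring]
  exact (one_le_div h3).2 h2

theorem continuous_heatAvg {κ : Spc n → (E →L[ℝ] F)} (hκ : RapidDecay κ) {X : Type}
    [TopologicalSpace X] [FirstCountableTopology X] {g : X → Spc n → E} {ρ : X → ℝ}
    {x : X → Spc n} {A : ℝ} (hg : Continuous fun a : X × Spc n => g a.1 a.2)
    (hb : ∀ a y, ‖g a y‖ ≤ A) (hρ : Continuous ρ) (hx : Continuous x) :
    Continuous fun a => heatAvg κ (g a) (ρ a) (x a) := by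
  have hg' : ∀ a, Continuous (g a) := fun a => hg.comp (by fun_prop : Continuous fun y => (a, y))
  refine continuous_of_dominated (bound := fun z => ‖κ z‖ * A)
    (fun a => (integrable_heatAvg hκ (hg' a) (hb a) _ _).aestronglyMeasurable)
    (fun a => ae_of_all _ fun z => (κ z).le_of_opNorm_le_of_le le_rfl (hb _ _))
    (hκ.integrable_norm.mul_const A) (ae_of_all _ fun z => ?_)
  exact (κ z).continuous.comp (hg.comp
    (by fun_prop : Continuous fun a => (a, x a - ρ a • z)))

end Kernels

section GaussDerivatives

variable {μ : ℝ}

/-- The scalar Gaussian kernel acting on `E`. -/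
def gaussOp (μ : ℝ) (E : Type) [NormedAddCommGroup E] [NormedSpace ℝ E] (z : Spc n) : E →L[ℝ] E :=
  gaussKer μ z • ContinuousLinearMap.id ℝ E

/-- The gradient of the Gaussian kernel acting on `E`. -/
def gradOp (μ : ℝ) (E : Type) [NormedAddCommGroup E] [NormedSpace ℝ E] (z : Spc n) :
    E →L[ℝ] (Spc n →L[ℝ] E) :=
  ContinuousLinearMap.smulRightL ℝ (Spc n) E (gaussGrad μ z)

variable {E : Type} [NormedAddCommGroup E] [NormedSpace ℝ E]

@[simp] theorem gaussOp_apply (z : Spc n) (e : E) : gaussOp μ E z e = gaussKer μ z • e := rfl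

@[simp] theorem gradOp_apply (z v : Spc n) (e : E) :
    gradOp μ E z e v = gaussGrad μ z v • e := rfl

theorem rapidDecay_gaussOp (hμ : 0 < μ) : RapidDecay (gaussOp μ E : Spc n → _) :=
  (rapidDecay_gaussKer hμ).clm
    ((ContinuousLinearMap.id ℝ ℝ).smulRight (ContinuousLinearMap.id ℝ E))

theorem rapidDecay_gradOp (hμ : 0 < μ) : RapidDecay (gradOp μ E : Spc n → _) :=
  (rapidDecay_gaussGrad hμ).clm (ContinuousLinearMap.smulRightL ℝ (Spc n) E)

theorem hasFDerivAt_heatAvg_of_hasFDerivAt (hμ : 0 < μ) {g : Spc n → E}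
    {g' : Spc n → Spc n →L[ℝ] E} {A : ℝ} (hg : ∀ y, HasFDerivAt g (g' y) y) (hg' : Continuous g')
    (hb : ∀ y, ‖g y‖ ≤ A) (hb' : ∀ y, ‖g' y‖ ≤ A) (ρ : ℝ) (x : Spc n) :
    HasFDerivAt (heatAvg (gaussOp μ E) g ρ) (heatAvg (gaussOp μ (Spc n →L[ℝ] E)) g' ρ x) x := by
  have hgc : Continuous g := continuous_iff_continuousAt.2 fun y => (hg y).continuousAt
  refine hasFDerivAt_integral_of_dominated_of_fderiv_le
    (F' := fun x z => gaussOp μ (Spc n →L[ℝ] E) z (g' (x - ρ • z)))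
    (bound := fun z => ‖(gaussOp μ (Spc n →L[ℝ] E) z)‖ * A) (s := Set.univ) univ_mem
    (Eventually.of_forall fun y =>
      (integrable_heatAvg (rapidDecay_gaussOp hμ) hgc hb ρ y).aestronglyMeasurable)
    (integrable_heatAvg (rapidDecay_gaussOp hμ) hgc hb ρ x)
    (integrable_heatAvg (rapidDecay_gaussOp hμ) hg' hb' ρ x).aestronglyMeasurable
    (ae_of_all _ fun z y _ => ContinuousLinearMap.le_of_opNorm_le_of_le _ le_rfl (hb' _))
    ((rapidDecay_gaussOp hμ).integrable_norm.mul_const A)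
    (ae_of_all _ fun z y _ => ?_)
  have h1 : HasFDerivAt (fun y => g (y - ρ • z)) (g' (y - ρ • z)) y := by
    have h2 := (hg (y - ρ • z)).comp y ((hasFDerivAt_id y).sub_const (ρ • z))
    rwa [ContinuousLinearMap.comp_id] at h2
  exact h1.const_smul (gaussKer μ z)

theorem hasFDerivAt_heatAvg (hμ : 0 < μ) {g : Spc n → E} {A : ℝ} (hg : Continuous g)
    (hb : ∀ y, ‖g y‖ ≤ A) {ρ : ℝ} (hρ : ρ ≠ 0) (x : Spc n) :
    HasFDerivAt (heatAvg (gaussOp μ E) g ρ) (ρ⁻¹ • heatAvg (gradOp μ E) g ρ x) x := by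
  have hA : 0 ≤ A := (norm_nonneg _).trans (hb 0)
  obtain ⟨C, hC0, hC⟩ := (rapidDecay_gradOp (n := n) (E := E) hμ).exists_le 0
  have key : HasFDerivAt (fun a : Spc n => ∫ z, gaussOp μ E (z + a) (g (x - ρ • z)))
      (∫ z, gradOp μ E (z + 0) (g (x - ρ • z))) 0 := by
    refine hasFDerivAt_integral_of_dominated_of_fderiv_le
      (F' := fun a z => gradOp μ E (z + a) (g (x - ρ • z)))
      (bound := fun z => (C * 2 ^ ((n : ℝ) + 1)) * (1 + ‖z‖) ^ (-((n : ℝ) + 1)) * A)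
      (s := Metric.ball 0 1) (Metric.ball_mem_nhds _ one_pos)
      (Eventually.of_forall fun a => Continuous.aestronglyMeasurable
        (((rapidDecay_gaussOp hμ).cont.comp (by fun_prop : Continuous fun z => z + a)).clm_apply
          (by fun_prop))) ?_
      (Continuous.aestronglyMeasurable
        (((rapidDecay_gradOp hμ).cont.comp
          (by fun_prop : Continuous fun z : Spc n => z + 0)).clm_apply
          (by fun_prop)))
      (ae_of_all _ fun z a ha => ?_)
      ((integrable_one_add_norm_rpow_neg.const_mul _).mul_const A)
      (ae_of_all _ fun z a _ => ?_)
    · simpa using integrable_heatAvg (rapidDecay_gaussOp (E := E) hμ) hg hb ρ x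
    · refine ContinuousLinearMap.le_of_opNorm_le_of_le _ ?_ (hb _)
      have h1 := hC (z + a)
      rw [Real.rpow_zero, one_mul] at h1
      refine h1.trans ?_
      rw [mul_assoc]
      refine mul_le_mul_of_nonneg_left ?_ hC0
      have h2 : (1 + ‖z‖) / 2 ≤ 1 + ‖z + a‖ := by
        have h3 : ‖z‖ ≤ ‖z + a‖ + ‖a‖ := by simpa using norm_sub_le (z + a) a
        have h4 : ‖a‖ < 1 := by simpa using ha
        linarith [norm_nonneg (z + a)]
      calc (1 + ‖z + a‖) ^ (-((n : ℝ) + 1)) ≤ ((1 + ‖z‖) / 2) ^ (-((n : ℝ) + 1)) :=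
            Real.rpow_le_rpow_of_nonpos (by positivity) h2 (by linarith [n.cast_nonneg (α := ℝ)])
        _ = _ := by
            rw [Real.div_rpow (by positivity) (by norm_num), Real.rpow_neg (x := 2) (by norm_num)]
            field_simp
    · have h1 : HasFDerivAt (fun a => gaussKer μ (z + a)) (gaussGrad μ (z + a)) a := by
        have h2 := (hasFDerivAt_gaussKer (μ := μ) (z + a)).comp a ((hasFDerivAt_id a).const_add z)
        rwa [ContinuousLinearMap.comp_id] at h2
      exact h1.smul_const _
  have h2 : heatAvg (gaussOp μ E) g ρ =
      (fun a : Spc n => ∫ z, gaussOp μ E (z + a) (g (x - ρ • z))) ∘ fun y => ρ⁻¹ • (y - x) := by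
    funext y
    have h3 := integral_add_right_eq_self (μ := volume)
      (fun z => gaussOp μ E z (g (y - ρ • z))) (ρ⁻¹ • (y - x))
    rw [heatAvg, ← h3, Function.comp_apply]
    congr 1
    funext z
    rw [smul_add, smul_inv_smul₀ hρ]
    congr 2
    abel
  rw [h2]
  have h4 : HasFDerivAt (fun y : Spc n => ρ⁻¹ • (y - x))
      (ρ⁻¹ • ContinuousLinearMap.id ℝ (Spc n)) x :=
    ((hasFDerivAt_id x).sub_const x).const_smul ρ⁻¹
  have h5 := HasFDerivAt.comp x (g := fun a : Spc n => ∫ z, gaussOp μ E (z + a) (g (x - ρ • z)))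
    (by simpa using key) h4
  refine h5.congr_fderiv ?_
  simp [heatAvg]

theorem heatAvg_gradOp_eq (hμ : 0 < μ) {g : Spc n → E}
    {g' : Spc n → Spc n →L[ℝ] E} {A : ℝ} (hg : ∀ y, HasFDerivAt g (g' y) y) (hg' : Continuous g')
    (hb : ∀ y, ‖g y‖ ≤ A) (hb' : ∀ y, ‖g' y‖ ≤ A) {ρ : ℝ} (hρ : ρ ≠ 0) (x : Spc n) :
    heatAvg (gradOp μ E) g ρ x = ρ • heatAvg (gaussOp μ (Spc n →L[ℝ] E)) g' ρ x := by
  have hgc : Continuous g := continuous_iff_continuousAt.2 fun y => (hg y).continuousAt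
  rw [← (hasFDerivAt_heatAvg hμ hgc hb hρ x).unique
    (hasFDerivAt_heatAvg_of_hasFDerivAt hμ hg hg' hb hb' ρ x), smul_inv_smul₀ hρ]

/-- The trace of a bilinear map. -/
def traceL (n : ℕ) (E : Type) [NormedAddCommGroup E] [NormedSpace ℝ E] :
    (Spc n →L[ℝ] Spc n →L[ℝ] E) →L[ℝ] E :=
  ∑ i : Fin n, (ContinuousLinearMap.apply ℝ E (EuclideanSpace.single i (1 : ℝ))).comp
    (ContinuousLinearMap.apply ℝ (Spc n →L[ℝ] E) (EuclideanSpace.single i (1 : ℝ)))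

theorem traceL_apply (L : Spc n →L[ℝ] Spc n →L[ℝ] E) : traceL n E L =
    ∑ i : Fin n, L (EuclideanSpace.single i (1 : ℝ)) (EuclideanSpace.single i (1 : ℝ)) := by
  simp [traceL]

theorem traceL_gradOp (hμ : 0 < μ) (z : Spc n) (L : Spc n →L[ℝ] E) :
    (2 * μ) • traceL n E (gradOp μ (Spc n →L[ℝ] E) z L) = gaussOp μ E z (-(L z)) := by
  have h1 : L z = ∑ i, z i • L (EuclideanSpace.single i (1 : ℝ)) := by
    conv_lhs => rw [← (EuclideanSpace.basisFun (Fin n) ℝ).sum_repr z]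
    simp
  rw [traceL_apply, h1, gaussOp_apply, ← Finset.sum_neg_distrib, Finset.smul_sum, Finset.smul_sum]
  refine Finset.sum_congr rfl fun i _ => ?_
  simp only [gradOp_apply, gaussGrad, _root_.smul_apply, innerSL_apply_apply,
    EuclideanSpace.inner_single_right, smul_smul, ← neg_smul]
  congr 1
  simp
  field_simp

theorem hasDerivAt_heatAvg [CompleteSpace E] (hμ : 0 < μ) {g : Spc n → E}
    {g' : Spc n → Spc n →L[ℝ] E} {A : ℝ} (hg : ∀ y, HasFDerivAt g (g' y) y) (hg' : Continuous g')
    (hb : ∀ y, ‖g y‖ ≤ A) (hb' : ∀ y, ‖g' y‖ ≤ A) (ρ : ℝ) (x : Spc n) :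
    HasDerivAt (fun ρ => heatAvg (gaussOp μ E) g ρ x)
      ((2 * μ) • traceL n E (heatAvg (gradOp μ (Spc n →L[ℝ] E)) g' ρ x)) ρ := by
  have hgc : Continuous g := continuous_iff_continuousAt.2 fun y => (hg y).continuousAt
  have hA : 0 ≤ A := (norm_nonneg _).trans (hb 0)
  have hInt := fun ρ => integrable_heatAvg (rapidDecay_gradOp (E := Spc n →L[ℝ] E) hμ) hg' hb' ρ x
  have h0 := hasDerivAt_integral_of_dominated_loc_of_deriv_le (μ := (volume : Measure (Spc n)))
    (F := fun ρ z => gaussOp μ E z (g (x - ρ • z)))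
    (F' := fun ρ z => gaussOp μ E z (-(g' (x - ρ • z) z))) (x₀ := ρ) (s := Set.univ)
    (bound := fun z => ((2 * μ) * ‖traceL n E‖) * (‖gradOp μ (Spc n →L[ℝ] E) z‖ * A)) univ_mem
    (Eventually.of_forall fun r =>
      (integrable_heatAvg (rapidDecay_gaussOp hμ) hgc hb r x).aestronglyMeasurable)
    (integrable_heatAvg (rapidDecay_gaussOp hμ) hgc hb ρ x)
    (Continuous.aestronglyMeasurable ((rapidDecay_gaussOp hμ).cont.clm_apply (by fun_prop)))
    (ae_of_all _ fun z r _ => ?_)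
    (((rapidDecay_gradOp hμ).integrable_norm.mul_const A).const_mul _)
    (ae_of_all _ fun z r _ => ?_)
  · refine h0.2.congr_deriv ?_
    simp_rw [← traceL_gradOp hμ]
    rw [integral_smul, ContinuousLinearMap.integral_comp_comm _ (hInt ρ)]
    rfl
  · have h2 : ‖2 * μ‖ = 2 * μ := Real.norm_of_nonneg (by positivity)
    rw [← traceL_gradOp hμ, norm_smul, h2, mul_assoc (2 * μ)]
    have h3 := (traceL n E).le_of_opNorm_le_of_le le_rfl
      ((gradOp μ (Spc n →L[ℝ] E) z).le_of_opNorm_le_of_le le_rfl (hb' (x - r • z)))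
    gcongr
  · have h2 : HasDerivAt (fun r : ℝ => x - r • z) (-z) r := by
      have h4 := ((hasDerivAt_id r).smul_const z).const_sub x
      rwa [one_smul] at h4
    have h3 := (hg (x - r • z)).comp_hasDerivAt r h2
    rw [ContinuousLinearMap.map_neg] at h3
    exact h3.const_smul (gaussKer μ z)

end GaussDerivatives

section VolterraPotential

variable {E F : Type} [NormedAddCommGroup E] [NormedSpace ℝ E]
  [NormedAddCommGroup F] [NormedSpace ℝ F] {T lam p A : ℝ}

theorem norm_integral_kernel_le_wt {κ : Spc n → (E →L[ℝ] F)} (hκ : RapidDecay κ) {h : Spc n → E}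
    {B r q R : ℝ} {x : Spc n} (hB : 0 ≤ B) (hrq : r ≤ q) (hR : 0 ≤ R)
    (hh : ∀ z, ‖h z‖ ≤ B * ((1 + R) ^ r * wt x ^ (-r) * (1 + ‖z‖) ^ r)) :
    ‖∫ z, κ z (h z)‖ ≤ kerMass κ q * (1 + R) ^ q * (B * wt x ^ (-r)) := by
  have hw := (wt_rpow_pos x (-r)).le
  refine (norm_integral_kernel_le hκ (p := q) (B := (1 + R) ^ q * (B * wt x ^ (-r)))
    fun z => (hh z).trans ?_).trans_eq (by ring)
  calc _ = (1 + R) ^ r * (B * wt x ^ (-r)) * (1 + ‖z‖) ^ r := by ring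
    _ ≤ _ := by
      have h1 : (1 + R) ^ r ≤ (1 + R) ^ q :=
        Real.rpow_le_rpow_of_exponent_le (by linarith) hrq
      have h2 : (1 + ‖z‖) ^ r ≤ (1 + ‖z‖) ^ q :=
        Real.rpow_le_rpow_of_exponent_le (by linarith [norm_nonneg z]) hrq
      gcongr

theorem HolderBound.continuous_clamp (hT : 0 ≤ T) {f : ℝ → Spc n → E}
    (h : HolderBound T lam p A f) : Continuous fun z : ℝ × Spc n => f (clampTime T z.1) z.2 :=
  h.cont.comp_continuous (f := fun z : ℝ × Spc n => (clampTime T z.1, z.2))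
    ((continuous_clampTime.comp continuous_fst).prodMk continuous_snd)
    fun _ => ⟨clampTime_mem hT _, Set.mem_univ _⟩

theorem HolderBound.norm_le (hT : 0 ≤ T) (hp : 0 ≤ p) {f : ℝ → Spc n → E}
    (h : HolderBound T lam p A f) {t : ℝ} (ht : t ∈ Set.Icc 0 T) (y : Spc n) : ‖f t y‖ ≤ A :=
  (h.bound t ht y).trans (mul_le_of_le_one_right (h.nonneg hT) (wt_rpow_le_one hp y))

/-- The Volterra potential with kernel `κ` and time density `φ`, in the variable `ρ = √(t - τ)`. -/
def pot (κ : Spc n → (E →L[ℝ] F)) (φ : ℝ → ℝ) (T : ℝ) (f : ℝ → Spc n → E) (t : ℝ) (x : Spc n) :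
    F :=
  ∫ ρ in (0 : ℝ)..√t, φ ρ • heatAvg κ (f (clampTime T (t - ρ ^ 2))) ρ x

/-- Mass and Hölder bounds for the density of a Volterra potential. -/
structure TimeDensity (T lam m : ℝ) (φ : ℝ → ℝ) : Prop where
  cont : Continuous φ
  mass : ∀ b, 0 ≤ b → b ≤ √T → ∫ ρ in (0 : ℝ)..b, |φ ρ| ≤ m
  part : ∀ a b, 0 ≤ a → a ≤ b → b ≤ √T → ∫ ρ in a..b, |φ ρ| ≤ m * (b - a) ^ lam

theorem TimeDensity.nonneg {m : ℝ} {φ : ℝ → ℝ} (h : TimeDensity T lam m φ) : 0 ≤ m := by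
  simpa using h.mass 0 le_rfl (Real.sqrt_nonneg T)

theorem norm_integral_smul_le {φ : ℝ → ℝ} (hφ : Continuous φ) {h : ℝ → F} {a b D : ℝ}
    (hab : a ≤ b) (hh : ∀ ρ ∈ Set.Ioc a b, ‖h ρ‖ ≤ D) :
    ‖∫ ρ in a..b, φ ρ • h ρ‖ ≤ (∫ ρ in a..b, |φ ρ|) * D := by
  rw [← intervalIntegral.integral_mul_const]
  refine intervalIntegral.norm_integral_le_of_norm_le hab (ae_of_all _ fun ρ hρ => ?_)
    ((by fun_prop : Continuous fun ρ => |φ ρ| * D).intervalIntegrable _ _)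
  rw [norm_smul, Real.norm_eq_abs]
  exact mul_le_mul_of_nonneg_left (hh ρ hρ) (abs_nonneg _)

theorem continuous_pot_integrand {κ : Spc n → (E →L[ℝ] F)} (hκ : RapidDecay κ) (hT : 0 ≤ T)
    (hp : 0 ≤ p) {φ : ℝ → ℝ} (hφ : Continuous φ) {f : ℝ → Spc n → E}
    (hf : HolderBound T lam p A f) :
    Continuous fun a : (ℝ × Spc n) × ℝ =>
      φ a.2 • heatAvg κ (f (clampTime T (a.1.1 - a.2 ^ 2))) a.2 a.1.2 := by
  refine (hφ.comp continuous_snd).smul ?_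
  refine continuous_heatAvg (g := fun a : (ℝ × Spc n) × ℝ => f (clampTime T (a.1.1 - a.2 ^ 2)))
    (ρ := fun a => a.2) (x := fun a => a.1.2) (A := A) hκ ?_
    (fun a y => hf.norm_le hT hp (clampTime_mem hT _) y) continuous_snd (by fun_prop)
  exact (hf.continuous_clamp hT).comp
    (by fun_prop : Continuous fun b : ((ℝ × Spc n) × ℝ) × Spc n => (b.1.1.1 - b.1.2 ^ 2, b.2))

theorem continuous_pot {κ : Spc n → (E →L[ℝ] F)} (hκ : RapidDecay κ) (hT : 0 ≤ T)
    (hp : 0 ≤ p) {φ : ℝ → ℝ} (hφ : Continuous φ) {f : ℝ → Spc n → E}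
    (hf : HolderBound T lam p A f) : Continuous fun z : ℝ × Spc n => pot κ φ T f z.1 z.2 :=
  intervalIntegral.continuous_parametric_intervalIntegral_of_continuous
    (f := fun (z : ℝ × Spc n) ρ => φ ρ • heatAvg κ (f (clampTime T (z.1 - ρ ^ 2))) ρ z.2)
    (continuous_pot_integrand hκ hT hp hφ hf) (s := fun z => √z.1)
    (Real.continuous_sqrt.comp continuous_fst)

theorem continuous_pot_slice {κ : Spc n → (E →L[ℝ] F)} (hκ : RapidDecay κ) (hT : 0 ≤ T)
    (hp : 0 ≤ p) {φ : ℝ → ℝ} (hφ : Continuous φ) {f : ℝ → Spc n → E}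
    (hf : HolderBound T lam p A f) (t : ℝ) (x : Spc n) :
    Continuous fun ρ : ℝ => φ ρ • heatAvg κ (f (clampTime T (t - ρ ^ 2))) ρ x :=
  (continuous_pot_integrand hκ hT hp hφ hf).comp
    (by fun_prop : Continuous fun ρ : ℝ => ((t, x), ρ))

/-- Constant in the estimate of Volterra potentials. -/
def potConst (κ : Spc n → F) (T p : ℝ) : ℝ := 2 * (kerMass κ (p + 1) * (1 + √T) ^ (p + 1))

theorem potConst_nonneg (κ : Spc n → F) (T p : ℝ) : 0 ≤ potConst κ T p := by
  have := kerMass_nonneg κ (p + 1)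
  unfold potConst; positivity

theorem sqrt_sub_sqrt_le {a b : ℝ} (ha : 0 ≤ a) (hab : a ≤ b) : √b - √a ≤ √(b - a) := by
  have h1 : √b ≤ √(b - a) + √a := by
    rw [Real.sqrt_le_left (by positivity)]
    nlinarith [Real.sq_sqrt ha, Real.sq_sqrt (sub_nonneg.2 hab), Real.sqrt_nonneg a,
      Real.sqrt_nonneg (b - a), mul_nonneg (Real.sqrt_nonneg a) (Real.sqrt_nonneg (b - a))]
  linarith

theorem HolderBound.pot {κ : Spc n → (E →L[ℝ] F)} (hκ : RapidDecay κ) (hT : 0 ≤ T)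
    (hp : 0 ≤ p) (hl0 : 0 ≤ lam) (hl1 : lam ≤ 1) {φ : ℝ → ℝ} {m : ℝ} (hφ : TimeDensity T lam m φ)
    {f : ℝ → Spc n → E} (hf : HolderBound T lam p A f) :
    HolderBound T lam p (potConst κ T p * m * A) (pot κ φ T f) := by
  have hA := hf.nonneg hT
  have hm := hφ.nonneg
  set K := kerMass κ (p + 1) * (1 + √T) ^ (p + 1) with hK
  have hK0 : 0 ≤ K := mul_nonneg (kerMass_nonneg _ _) (by positivity)
  have hC : potConst κ T p = 2 * K := rfl
  rw [hC]
  have hrho : ∀ t ∈ Set.Icc 0 T, ∀ ρ ∈ Set.Ioc 0 (√t), |ρ| ≤ √T := fun t ht ρ hρ => by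
    rw [abs_of_pos hρ.1]; exact hρ.2.trans (Real.sqrt_le_sqrt ht.2)
  have hsl : ∀ s, Continuous (f (clampTime T s)) := fun s => (hf.continuous_clamp hT).comp
    (by fun_prop : Continuous fun y : Spc n => ((s : ℝ), y))
  have hbd := fun s y => hf.norm_le hT hp (clampTime_mem hT s) y
  have havg : ∀ s ρ, |ρ| ≤ √T → ∀ x, ‖heatAvg κ (f (clampTime T s)) ρ x‖ ≤ K * (A * wt x ^ (-p)) :=
    fun s ρ hρ x => norm_integral_kernel_le_wt hκ hA (by linarith) (Real.sqrt_nonneg T) fun z =>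
      (hf.bound _ (clampTime_mem hT s) _).trans
        (mul_le_mul_of_nonneg_left (wt_rpow_translate_le hp hρ le_rfl z) hA)
  refine ⟨(continuous_pot hκ hT hp hφ.cont hf).continuousOn, fun t ht x => ?_,
    fun hl t ht x y hxy => ?_, ?_⟩
  · refine (norm_integral_smul_le hφ.cont (Real.sqrt_nonneg t) (fun ρ hρ =>
      havg _ ρ (hrho t ht ρ hρ) x)).trans ?_
    have hw := (wt_rpow_pos x (-p)).le
    calc _ ≤ m * (K * (A * wt x ^ (-p))) := by
          gcongr; exact hφ.mass _ (Real.sqrt_nonneg t) (Real.sqrt_le_sqrt ht.2)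
      _ ≤ 2 * (m * (K * (A * wt x ^ (-p)))) := by
          linarith [mul_nonneg hm (mul_nonneg hK0 (mul_nonneg hA hw))]
      _ = _ := by ring
  · have h1 : NSdeRham.pot κ φ T f t x - NSdeRham.pot κ φ T f t y =
        ∫ ρ in (0 : ℝ)..√t, φ ρ • (heatAvg κ (f (clampTime T (t - ρ ^ 2))) ρ x -
          heatAvg κ (f (clampTime T (t - ρ ^ 2))) ρ y) := by
      simp_rw [smul_sub]
      exact (intervalIntegral.integral_sub
        ((continuous_pot_slice hκ hT hp hφ.cont hf t x).intervalIntegrable _ _)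
        ((continuous_pot_slice hκ hT hp hφ.cont hf t y).intervalIntegrable _ _)).symm
    have hd : 0 ≤ ‖x - y‖ ^ lam := by positivity
    have h2 : ∀ ρ ∈ Set.Ioc 0 (√t), ‖heatAvg κ (f (clampTime T (t - ρ ^ 2))) ρ x -
          heatAvg κ (f (clampTime T (t - ρ ^ 2))) ρ y‖ ≤
        K * (A * ‖x - y‖ ^ lam * wt x ^ (-(p + lam))) := fun ρ hρ => by
      rw [heatAvg_sub hκ (hsl _) (hbd _) (hsl _) (hbd _)]
      refine norm_integral_kernel_le_wt hκ (mul_nonneg hA hd) (by linarith)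
        (Real.sqrt_nonneg T) fun z => ?_
      have hpl : 0 ≤ p + lam := by linarith
      have hsp := hf.space hl _ (clampTime_mem hT (t - ρ ^ 2))
      rcases le_total ‖x - ρ • z‖ ‖y - ρ • z‖ with hc | hc
      · refine (hsp _ _ hc).trans ?_
        rw [sub_sub_sub_cancel_right, mul_right_comm]
        exact mul_le_mul_of_nonneg_left
          (wt_rpow_translate_le hpl (hrho t ht ρ hρ) le_rfl z) (by positivity)
      · rw [norm_sub_rev]
        refine (hsp _ _ hc).trans ?_
        rw [sub_sub_sub_cancel_right, mul_right_comm, norm_sub_rev y x]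
        exact mul_le_mul_of_nonneg_left
          (wt_rpow_translate_le hpl (hrho t ht ρ hρ) hxy z) (by positivity)
    rw [h1]
    refine (norm_integral_smul_le hφ.cont (Real.sqrt_nonneg t) h2).trans ?_
    have hw := (wt_rpow_pos x (-(p + lam))).le
    calc _ ≤ m * (K * (A * ‖x - y‖ ^ lam * wt x ^ (-(p + lam)))) := by
          gcongr; exact hφ.mass _ (Real.sqrt_nonneg t) (Real.sqrt_le_sqrt ht.2)
      _ ≤ 2 * (m * (K * (A * ‖x - y‖ ^ lam * wt x ^ (-(p + lam))))) := by
          linarith [mul_nonneg hm (mul_nonneg hK0 (mul_nonneg (mul_nonneg hA hd) hw))]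
      _ = _ := by ring
  · intro hl
    suffices H : ∀ t₁ ∈ Set.Icc 0 T, ∀ t₂ ∈ Set.Icc 0 T, t₁ ≤ t₂ → ∀ x,
        ‖NSdeRham.pot κ φ T f t₂ x - NSdeRham.pot κ φ T f t₁ x‖ ≤
          2 * K * m * A * wt x ^ (-p) * |t₂ - t₁| ^ (lam / 2) by
      intro t₁ ht₁ t₂ ht₂ x
      rcases le_total t₁ t₂ with h | h
      · rw [norm_sub_rev, abs_sub_comm]; exact H t₁ ht₁ t₂ ht₂ h x
      · exact H t₂ ht₂ t₁ ht₁ h x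
    intro t₁ ht₁ t₂ ht₂ h12 x
    have hInt := fun t a b => (continuous_pot_slice hκ hT hp hφ.cont hf t x).intervalIntegrable
      (μ := volume) a b
    have h1 : NSdeRham.pot κ φ T f t₂ x - NSdeRham.pot κ φ T f t₁ x =
        (∫ ρ in (0 : ℝ)..√t₁, φ ρ • (heatAvg κ (f (clampTime T (t₂ - ρ ^ 2))) ρ x -
          heatAvg κ (f (clampTime T (t₁ - ρ ^ 2))) ρ x)) +
        ∫ ρ in √t₁..√t₂, φ ρ • heatAvg κ (f (clampTime T (t₂ - ρ ^ 2))) ρ x := by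
      simp_rw [smul_sub]
      rw [intervalIntegral.integral_sub (hInt _ _ _) (hInt _ _ _), NSdeRham.pot, NSdeRham.pot,
        ← intervalIntegral.integral_add_adjacent_intervals (hInt t₂ 0 √t₁) (hInt t₂ √t₁ √t₂)]
      abel
    have hs12 := Real.sqrt_le_sqrt h12
    have hs2 := Real.sqrt_le_sqrt ht₂.2
    have hd : 0 ≤ |t₂ - t₁| ^ (lam / 2) := by positivity
    have h2 : ∀ ρ ∈ Set.Ioc 0 (√t₁), ‖heatAvg κ (f (clampTime T (t₂ - ρ ^ 2))) ρ x -
          heatAvg κ (f (clampTime T (t₁ - ρ ^ 2))) ρ x‖ ≤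
        K * (A * |t₂ - t₁| ^ (lam / 2) * wt x ^ (-p)) := fun ρ hρ => by
      rw [heatAvg_sub hκ (hsl _) (hbd _) (hsl _) (hbd _)]
      refine norm_integral_kernel_le_wt hκ (mul_nonneg hA hd) (by linarith)
        (Real.sqrt_nonneg T) fun z => ?_
      have hρ2 : ρ ^ 2 ≤ t₁ := by
        rw [← Real.sq_sqrt ht₁.1]; exact pow_le_pow_left₀ hρ.1.le hρ.2 2
      have hm₁ : t₁ - ρ ^ 2 ∈ Set.Icc 0 T := ⟨by linarith, by linarith [ht₁.2, sq_nonneg ρ]⟩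
      have hm₂ : t₂ - ρ ^ 2 ∈ Set.Icc 0 T := ⟨by linarith, by linarith [ht₂.2, sq_nonneg ρ]⟩
      rw [clampTime_of_mem hm₁, clampTime_of_mem hm₂]
      refine (hf.time hl _ hm₂ _ hm₁ _).trans ?_
      rw [sub_sub_sub_cancel_right, mul_right_comm]
      exact mul_le_mul_of_nonneg_left
        (wt_rpow_translate_le hp (hrho t₁ ht₁ ρ hρ) le_rfl z) (by positivity)
    have h3 := norm_integral_smul_le hφ.cont (Real.sqrt_nonneg t₁) h2
    have h4 := norm_integral_smul_le hφ.cont hs12 (fun ρ hρ => havg (t₂ - ρ ^ 2) ρ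
      (hrho t₂ ht₂ ρ ⟨(Real.sqrt_nonneg t₁).trans_lt hρ.1, hρ.2⟩) x)
    have hw := (wt_rpow_pos x (-p)).le
    have h5 : (∫ ρ in √t₁..√t₂, |φ ρ|) ≤ m * |t₂ - t₁| ^ (lam / 2) := by
      refine (hφ.part _ _ (Real.sqrt_nonneg _) hs12 hs2).trans
        (mul_le_mul_of_nonneg_left ?_ hm)
      calc (√t₂ - √t₁) ^ lam ≤ √(t₂ - t₁) ^ lam :=
            Real.rpow_le_rpow (sub_nonneg.2 hs12) (sqrt_sub_sqrt_le ht₁.1 h12) hl0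
        _ = |t₂ - t₁| ^ (lam / 2) := by
            rw [abs_of_nonneg (sub_nonneg.2 h12), Real.sqrt_eq_rpow,
              ← Real.rpow_mul (sub_nonneg.2 h12)]
            congr 1; ring
    rw [h1]
    calc _ ≤ m * (K * (A * |t₂ - t₁| ^ (lam / 2) * wt x ^ (-p))) +
          m * |t₂ - t₁| ^ (lam / 2) * (K * (A * wt x ^ (-p))) := by
          refine (norm_add_le _ _).trans (add_le_add (h3.trans ?_) (h4.trans ?_))
          · gcongr
            exact hφ.mass _ (Real.sqrt_nonneg _) (hs12.trans hs2)
          · gcongr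
      _ = _ := by ring

end VolterraPotential

section HeatPotential

variable {E : Type} [NormedAddCommGroup E] [NormedSpace ℝ E] {T lam p A μ ω : ℝ}

/-- Time density of the heat potential with exponential damping `ω`. -/
def heatDensity (ω ρ : ℝ) : ℝ := 2 * ρ * Real.exp (-ω * ρ ^ 2)

/-- Time density of the gradient of the heat potential with exponential damping `ω`. -/
def gradDensity (ω ρ : ℝ) : ℝ := 2 * Real.exp (-ω * ρ ^ 2)

theorem continuous_heatDensity (ω : ℝ) : Continuous (heatDensity ω) := by
  unfold heatDensity; fun_prop

theorem continuous_gradDensity (ω : ℝ) : Continuous (gradDensity ω) := by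
  unfold gradDensity; fun_prop

theorem heatDensity_eq (ω ρ : ℝ) : heatDensity ω ρ = gradDensity ω ρ * ρ := by
  unfold heatDensity gradDensity; ring

theorem abs_gradDensity_le {B ρ : ℝ} (hB : 2 ≤ B) :
    |gradDensity ω ρ| ≤ B * Real.exp (-ω * ρ ^ 2) := by
  rw [gradDensity, abs_of_pos (by positivity)]
  gcongr

theorem abs_heatDensity_le {B : ℝ} (hB : 2 * √T ≤ B) {ρ : ℝ} (hρ : ρ ∈ Set.Icc 0 √T) :
    |heatDensity ω ρ| ≤ B * Real.exp (-ω * ρ ^ 2) := by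
  rw [heatDensity, abs_of_nonneg (by have := hρ.1; positivity)]
  have := hρ.2
  gcongr
  linarith

theorem integral_abs_density_le {φ : ℝ → ℝ} {B : ℝ} (hφ : Continuous φ)
    (hb : ∀ ρ ∈ Set.Icc 0 √T, |φ ρ| ≤ B * Real.exp (-ω * ρ ^ 2)) {a b : ℝ}
    (ha : 0 ≤ a) (hab : a ≤ b) (hbT : b ≤ √T) :
    ∫ ρ in a..b, |φ ρ| ≤ B * ∫ ρ in a..b, Real.exp (-ω * ρ ^ 2) := by
  rw [← intervalIntegral.integral_const_mul]
  exact intervalIntegral.integral_mono_on hab (hφ.abs.intervalIntegrable _ _)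
    ((by fun_prop : Continuous fun ρ : ℝ => B * Real.exp (-ω * ρ ^ 2)).intervalIntegrable _ _)
    fun ρ hρ => hb ρ ⟨ha.trans hρ.1, hρ.2.trans hbT⟩

theorem integral_exp_le_sub (hω : 0 ≤ ω) {a b : ℝ} (hab : a ≤ b) :
    ∫ ρ in a..b, Real.exp (-ω * ρ ^ 2) ≤ b - a := by
  have := intervalIntegral.integral_mono_on (μ := volume)
    (f := fun ρ : ℝ => Real.exp (-ω * ρ ^ 2)) (g := fun _ => (1 : ℝ)) hab ((by fun_prop : Continuous fun ρ : ℝ =>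
      Real.exp (-ω * ρ ^ 2)).intervalIntegrable _ _) (continuous_const.intervalIntegrable _ _)
    fun ρ _ => Real.exp_le_one_iff.2 (by nlinarith [sq_nonneg ρ])
  simpa using this

theorem integral_exp_le_gaussian (hω : 0 < ω) {a b : ℝ} (ha : 0 ≤ a) (hab : a ≤ b) :
    ∫ ρ in a..b, Real.exp (-ω * ρ ^ 2) ≤ √(Real.pi / ω) / 2 := by
  rw [← integral_gaussian_Ioi, intervalIntegral.integral_of_le hab]
  exact setIntegral_mono_set (integrable_exp_neg_mul_sq hω).integrableOn
    (ae_of_all _ fun ρ => (Real.exp_pos _).le)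
    (LE.le.eventuallyLE fun ρ hρ => ha.trans_lt hρ.1)

theorem timeDensity_of_le {φ : ℝ → ℝ} {B : ℝ} (hφ : Continuous φ) (hB : 0 ≤ B) (hl0 : 0 ≤ lam)
    (hl1 : lam ≤ 1) (hω : 0 ≤ ω) (hb : ∀ ρ ∈ Set.Icc 0 √T, |φ ρ| ≤ B * Real.exp (-ω * ρ ^ 2)) :
    TimeDensity T lam (B * (1 + √T)) φ := by
  have key := fun {a b : ℝ} (ha : 0 ≤ a) (hab : a ≤ b) (hbT : b ≤ √T) =>
    (integral_abs_density_le hφ hb ha hab hbT).trans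
      (mul_le_mul_of_nonneg_left (integral_exp_le_sub hω hab) hB)
  refine ⟨hφ, fun b hb0 hbT => (key le_rfl hb0 hbT).trans ?_, fun a b ha hab hbT =>
    (key ha hab hbT).trans ?_⟩
  · gcongr; linarith
  · rw [mul_assoc]
    have hd : 0 ≤ b - a := by linarith
    refine mul_le_mul_of_nonneg_left ?_ hB
    calc b - a = (b - a) ^ (1 - lam) * (b - a) ^ lam := by
          rcases hl0.eq_or_lt with rfl | hl0
          · simp
          rcases hd.eq_or_lt with hd | hd
          · rw [← hd, Real.zero_rpow hl0.ne', mul_zero]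
          · rw [← Real.rpow_add hd]; simp
      _ ≤ (1 + √T) ^ (1 - lam) * (b - a) ^ lam := by
          have : b - a ≤ 1 + √T := by linarith
          have h1 : 0 ≤ 1 - lam := by linarith
          gcongr
      _ ≤ (1 + √T) * (b - a) ^ lam := by
          gcongr
          exact Real.rpow_le_self_of_one_le (by linarith [Real.sqrt_nonneg T]) (by linarith)

theorem exists_damping (T : ℝ) {lam B ε : ℝ} (hB : 0 ≤ B) (hl0 : 0 ≤ lam) (hl1 : lam < 1)
    (hε : 0 < ε) : ∃ ω : ℝ, 0 < ω ∧ ∀ φ : ℝ → ℝ, Continuous φ →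
      (∀ ρ ∈ Set.Icc 0 √T, |φ ρ| ≤ B * Real.exp (-ω * ρ ^ 2)) → TimeDensity T lam ε φ := by
  have h1l : 0 < 1 - lam := by linarith
  have hlim : Tendsto (fun ω : ℝ => √(Real.pi / ω) / 2) atTop (nhds 0) := by
    have h1 : Tendsto (fun ω : ℝ => Real.pi / ω) atTop (nhds 0) :=
      tendsto_const_nhds.div_atTop tendsto_id
    simpa using (((Real.continuous_sqrt.tendsto 0).comp (by simpa using h1))).div_const 2
  have hlim2 : Tendsto (fun ω : ℝ => B * (√(Real.pi / ω) / 2) ^ (1 - lam)) atTop (nhds 0) := by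
    have := (hlim.rpow_const (p := 1 - lam) (Or.inr h1l.le)).const_mul B
    rwa [Real.zero_rpow h1l.ne', mul_zero] at this
  obtain ⟨ω, hω1, hω2, hω⟩ := ((hlim.eventually (eventually_le_nhds one_pos)).and
    ((hlim2.eventually (eventually_le_nhds hε)).and (eventually_gt_atTop 0))).exists
  refine ⟨ω, hω, fun φ hφ hb => ?_⟩
  set g := √(Real.pi / ω) / 2 with hg
  have hg0 : 0 ≤ g := by positivity
  refine ⟨hφ, fun b hb0 hbT => (integral_abs_density_le hφ hb le_rfl hb0 hbT).trans ?_,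
    fun a b ha hab hbT => (integral_abs_density_le hφ hb ha hab hbT).trans ?_⟩
  · refine le_trans (mul_le_mul_of_nonneg_left
      ((integral_exp_le_gaussian hω le_rfl hb0).trans ?_) hB) hω2
    rcases hg0.eq_or_lt with h0 | h0
    · rw [← hg, ← h0]; positivity
    · calc g = g ^ (1 : ℝ) := by simp
        _ ≤ _ := Real.rpow_le_rpow_of_exponent_ge h0 hω1 (by linarith)
  · set I := ∫ ρ in a..b, Real.exp (-ω * ρ ^ 2) with hI
    have hI0 : 0 ≤ I := intervalIntegral.integral_nonneg hab fun ρ _ => (Real.exp_pos _).le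
    have hId : I ≤ b - a := integral_exp_le_sub hω.le hab
    have hIg : I ≤ g := integral_exp_le_gaussian hω ha hab
    calc B * I = B * (I ^ (1 - lam) * I ^ lam) := by
          congr 1
          rcases hl0.eq_or_lt with rfl | hl0
          · simp
          rcases hI0.eq_or_lt with hd | hd
          · rw [← hd, Real.zero_rpow hl0.ne', mul_zero]
          · rw [← Real.rpow_add hd]; simp
      _ ≤ B * (g ^ (1 - lam) * (b - a) ^ lam) := by
          have := h1l.le
          gcongr
      _ = B * g ^ (1 - lam) * (b - a) ^ lam := by ring
      _ ≤ _ := mul_le_mul_of_nonneg_right hω2 (by have : 0 ≤ b - a := by linarith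
                                                  positivity)

/-- The heat potential with exponential damping `ω`. -/
def heatPot (μ ω T : ℝ) (f : ℝ → Spc n → E) : ℝ → Spc n → E :=
  pot (gaussOp μ E) (heatDensity ω) T f

/-- The gradient of the heat potential with exponential damping `ω`. -/
def gradPot (μ ω T : ℝ) (f : ℝ → Spc n → E) : ℝ → Spc n → (Spc n →L[ℝ] E) :=
  pot (gradOp μ E) (gradDensity ω) T f

theorem HolderBound.continuous_slice_clamp (hT : 0 ≤ T) {f : ℝ → Spc n → E}
    (h : HolderBound T lam p A f) (s : ℝ) : Continuous (f (clampTime T s)) :=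
  (h.continuous_clamp hT).comp (by fun_prop : Continuous fun y : Spc n => ((s : ℝ), y))

theorem hasFDerivAt_heatPot (hμ : 0 < μ) (hT : 0 ≤ T) (hp : 0 ≤ p) {f : ℝ → Spc n → E}
    (hf : HolderBound T lam p A f) (t : ℝ) (x : Spc n) :
    HasFDerivAt (heatPot μ ω T f t) (gradPot μ ω T f t x) x := by
  have hA := hf.nonneg hT
  have hφ := continuous_gradDensity ω
  have hb := fun s y => hf.norm_le hT hp (clampTime_mem hT s) y
  refine intervalIntegral.hasFDerivAt_integral_of_dominated_of_fderiv_le (s := Set.univ)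
    (F' := fun x ρ => gradDensity ω ρ • heatAvg (gradOp μ E) (f (clampTime T (t - ρ ^ 2))) ρ x)
    (bound := fun ρ => |gradDensity ω ρ| * (kerMass (gradOp μ E : Spc n → _) 0 * A)) univ_mem
    (Eventually.of_forall fun y => ?_) ?_ ?_ (ae_of_all _ fun ρ _ y _ => ?_) ?_
    (ae_of_all _ fun ρ hρ y _ => ?_)
  · exact (continuous_pot_slice (rapidDecay_gaussOp hμ) hT hp (continuous_heatDensity ω) hf t
      y).aestronglyMeasurable
  · exact (continuous_pot_slice (rapidDecay_gaussOp hμ) hT hp (continuous_heatDensity ω) hf t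
      x).intervalIntegrable _ _
  · exact (continuous_pot_slice (rapidDecay_gradOp hμ) hT hp hφ hf t x).aestronglyMeasurable
  · rw [norm_smul, Real.norm_eq_abs]
    refine mul_le_mul_of_nonneg_left (norm_integral_kernel_le (rapidDecay_gradOp hμ)
      (p := 0) (B := A) fun z => ?_) (abs_nonneg _)
    simpa using hb _ _
  · exact (by fun_prop : Continuous fun ρ => |gradDensity ω ρ| *
      (kerMass (gradOp μ E : Spc n → _) 0 * A)).intervalIntegrable _ _
  · have hρ0 : ρ ≠ 0 := by
      rw [Set.uIoc_of_le (Real.sqrt_nonneg t)] at hρ; exact hρ.1.ne'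
    refine ((hasFDerivAt_heatAvg hμ (hf.continuous_slice_clamp hT _) (hb _) hρ0 y).const_smul
      (heatDensity ω ρ)).congr_fderiv ?_
    rw [heatDensity_eq, smul_smul, mul_assoc, mul_inv_cancel₀ hρ0, mul_one]

theorem gradPot_eq_heatPot (hμ : 0 < μ) (hT : 0 ≤ T) (hp : 0 ≤ p) {f : ℝ → Spc n → E}
    {f' : ℝ → Spc n → (Spc n →L[ℝ] E)} (hf : HolderBound T lam p A f)
    (hf' : HolderBound T lam p A f') (hd : ∀ t ∈ Set.Icc 0 T, ∀ x, HasFDerivAt (f t) (f' t x) x)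
    (t : ℝ) (x : Spc n) : gradPot μ ω T f t x = heatPot μ ω T f' t x := by
  refine intervalIntegral.integral_congr_ae (ae_of_all _ fun ρ hρ => ?_)
  have hρ0 : ρ ≠ 0 := by
    rw [Set.uIoc_of_le (Real.sqrt_nonneg t)] at hρ; exact hρ.1.ne'
  rw [heatAvg_gradOp_eq hμ (hd _ (clampTime_mem hT _)) (hf'.continuous_slice_clamp hT _)
    (hf.norm_le hT hp (clampTime_mem hT _)) (hf'.norm_le hT hp (clampTime_mem hT _)) hρ0,
    smul_smul, ← heatDensity_eq]

theorem intervalIntegral_swap_graph {a b : ℝ} (ha : 0 ≤ a) (hb : 0 ≤ b) {γ η : ℝ → ℝ}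
    (hγ : Continuous γ) (hγm : ∀ x ∈ Set.Ioc 0 a, γ x ∈ Set.Icc 0 b)
    (hηm : ∀ y ∈ Set.Ioc 0 b, η y ∈ Set.Ioc 0 a)
    (hγη : ∀ x ∈ Set.Ioc 0 a, ∀ y ∈ Set.Ioc 0 b, y ≤ γ x ↔ η y ≤ x) {G : ℝ → ℝ → E}
    (hG : Continuous fun z : ℝ × ℝ => G z.1 z.2) :
    ∫ x in (0 : ℝ)..a, ∫ y in (0 : ℝ)..γ x, G x y =
      ∫ y in (0 : ℝ)..b, ∫ x in η y..a, G x y := by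
  have hS : MeasurableSet {z : ℝ × ℝ | z.2 ≤ γ z.1} :=
    (isClosed_le continuous_snd (hγ.comp continuous_fst)).measurableSet
  have h := integral_integral_swap (μ := volume.restrict (Set.Ioc 0 a))
    (ν := volume.restrict (Set.Ioc 0 b))
    (f := fun x y => {z : ℝ × ℝ | z.2 ≤ γ z.1}.indicator (fun z => G z.1 z.2) (x, y)) (by
      rw [Measure.prod_restrict]
      refine Integrable.indicator ?_ hS
      exact (hG.continuousOn.integrableOn_compact
        (isCompact_Icc.prod isCompact_Icc : IsCompact (Set.Icc 0 a ×ˢ Set.Icc 0 b))).mono_set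
        (Set.prod_mono Set.Ioc_subset_Icc_self Set.Ioc_subset_Icc_self))
  rw [intervalIntegral.integral_of_le ha, intervalIntegral.integral_of_le hb]
  convert h using 1
  · refine setIntegral_congr_fun measurableSet_Ioc fun x hx => ?_
    have h1 := hγm x hx
    rw [intervalIntegral.integral_of_le h1.1]
    have h2 : ∀ y, {z : ℝ × ℝ | z.2 ≤ γ z.1}.indicator (fun z => G z.1 z.2) (x, y) =
      (Set.Iic (γ x)).indicator (G x) y := fun y => rfl
    simp_rw [h2]
    rw [setIntegral_indicator measurableSet_Iic, Set.Ioc_inter_Iic, min_eq_right h1.2]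
  · refine setIntegral_congr_fun measurableSet_Ioc fun y hy => ?_
    have h1 := hηm y hy
    rw [intervalIntegral.integral_of_le h1.2, ← integral_Icc_eq_integral_Ioc]
    have h2 : ∀ x ∈ Set.Ioc 0 a, {z : ℝ × ℝ | z.2 ≤ γ z.1}.indicator (fun z => G z.1 z.2) (x, y) =
        (Set.Ici (η y)).indicator (fun x => G x y) x := fun x hx => by
      by_cases hc : y ≤ γ x
      · rw [Set.indicator_of_mem (by exact hc), Set.indicator_of_mem (by exact (hγη x hx y hy).1 hc)]
      · rw [Set.indicator_of_notMem (by exact hc),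
          Set.indicator_of_notMem (by exact fun h => hc ((hγη x hx y hy).2 h))]
    rw [setIntegral_congr_fun measurableSet_Ioc h2, setIntegral_indicator measurableSet_Ici]
    congr 2
    ext x
    simp only [Set.mem_Icc, Set.mem_inter_iff, Set.mem_Ioc, Set.mem_Ici]
    exact ⟨fun h => ⟨⟨h1.1.trans_le h.1, h.2⟩, h.1⟩, fun h => ⟨h.2, h.1.2⟩⟩


theorem heatPot_zero_eq_integral (f : ℝ → Spc n → E) {t : ℝ} (ht : 0 ≤ t) (x : Spc n)
    (hc : Continuous fun z : ℝ × ℝ =>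
      heatAvg (gaussOp μ E) (f (clampTime T z.1)) z.2 x) :
    heatPot μ 0 T f t x =
      ∫ σ in (0 : ℝ)..t, heatAvg (gaussOp μ E) (f (clampTime T (t - σ))) (√σ) x := by
  have h := intervalIntegral.integral_deriv_smul_comp (a := 0) (b := √t) (f := fun ρ => ρ ^ 2)
    (f' := fun ρ => 2 * ρ)
    (g := fun σ => heatAvg (gaussOp μ E) (f (clampTime T (t - σ))) (√σ) x)
    (fun ρ _ => by simpa using hasDerivAt_pow 2 ρ) (by fun_prop)
    (hc.comp (by fun_prop : Continuous fun σ : ℝ => (t - σ, √σ)))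
  simp only [Real.sq_sqrt ht, ne_eq, OfNat.ofNat_ne_zero, not_false_eq_true, zero_pow] at h
  rw [← h]
  refine intervalIntegral.integral_congr fun ρ hρ => ?_
  rw [Set.uIcc_of_le (Real.sqrt_nonneg t)] at hρ
  simp [heatDensity, Real.sqrt_sq hρ.1]

theorem HolderBound.continuous_heatAvg_clamp {F : Type} [NormedAddCommGroup F] [NormedSpace ℝ F]
    {κ : Spc n → (E →L[ℝ] F)} (hκ : RapidDecay κ) (hT : 0 ≤ T)
    (hp : 0 ≤ p) {f : ℝ → Spc n → E} (hf : HolderBound T lam p A f) (x : Spc n) :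
    Continuous fun z : ℝ × ℝ => heatAvg κ (f (clampTime T z.1)) z.2 x :=
  continuous_heatAvg (g := fun z : ℝ × ℝ => f (clampTime T z.1)) (ρ := fun z => z.2)
    (x := fun _ => x) (A := A) hκ
    ((hf.continuous_clamp hT).comp
      (by fun_prop : Continuous fun b : (ℝ × ℝ) × Spc n => (b.1.1, b.2)))
    (fun a y => hf.norm_le hT hp (clampTime_mem hT _) y) continuous_snd continuous_const

theorem heatAvg_zero (hμ : 0 < μ) [CompleteSpace E] (g : Spc n → E) (x : Spc n) :
    heatAvg (gaussOp μ E) g 0 x = g x := by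
  simp only [heatAvg, gaussOp_apply, zero_smul, sub_zero]
  rw [integral_smul_const, integral_gaussKer hμ, one_smul]

/-- The integrated form of the heat equation for the heat potential. -/
theorem heatPot_zero_eq [CompleteSpace E] (hμ : 0 < μ) (hT : 0 ≤ T) (hp : 0 ≤ p)
    {f : ℝ → Spc n → E} {f' : ℝ → Spc n → (Spc n →L[ℝ] E)} (hf : HolderBound T lam p A f)
    (hf' : HolderBound T lam p A f') (hd : ∀ t ∈ Set.Icc 0 T, ∀ x, HasFDerivAt (f t) (f' t x) x)
    {t : ℝ} (ht : t ∈ Set.Icc 0 T) (x : Spc n) :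
    heatPot μ 0 T f t x = 0 + ∫ s in (0 : ℝ)..t,
      (f (clampTime T s) x + μ • traceL n E (gradPot μ 0 T f' (clampTime T s) x)) := by
  set d : ℝ → ℝ → E := fun s r => (2 * μ) • traceL n E
    (heatAvg (gradOp μ (Spc n →L[ℝ] E)) (f' (clampTime T s)) r x) with hddef
  have hdc : Continuous fun z : ℝ × ℝ => d z.1 z.2 := by
    have := hf'.continuous_heatAvg_clamp (rapidDecay_gradOp hμ) hT hp x
    fun_prop
  have hhc := hf.continuous_heatAvg_clamp (rapidDecay_gaussOp hμ) hT hp x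
  have hfx : Continuous fun s => f (clampTime T s) x :=
    (hf.continuous_clamp hT).comp (by fun_prop : Continuous fun s : ℝ => (s, x))
  have hFTC : ∀ s r, heatAvg (gaussOp μ E) (f (clampTime T s)) r x =
      f (clampTime T s) x + ∫ ρ in (0 : ℝ)..r, d s ρ := fun s r => by
    have h1 := intervalIntegral.integral_eq_sub_of_hasDerivAt (a := 0) (b := r)
      (f := fun r => heatAvg (gaussOp μ E) (f (clampTime T s)) r x) (f' := d s)
      (fun ρ _ => hasDerivAt_heatAvg hμ (hd _ (clampTime_mem hT _))
        (hf'.continuous_slice_clamp hT _) (hf.norm_le hT hp (clampTime_mem hT _))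
        (hf'.norm_le hT hp (clampTime_mem hT _)) ρ x)
      ((hdc.comp (by fun_prop : Continuous fun ρ : ℝ => (s, ρ))).intervalIntegrable _ _)
    rw [h1, heatAvg_zero hμ]; abel
  have hmem : ∀ y ∈ Set.Ioc 0 √t, y ^ 2 ∈ Set.Ioc 0 t := fun y hy =>
    ⟨by have := hy.1; positivity, (Real.le_sqrt' hy.1).1 hy.2⟩
  have hsqrt : ∀ s ∈ Set.Ioc 0 t, √s ∈ Set.Icc 0 √t := fun s hs =>
    ⟨Real.sqrt_nonneg _, Real.sqrt_le_sqrt hs.2⟩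
  have hiff : ∀ s ∈ Set.Ioc 0 t, ∀ y ∈ Set.Ioc 0 √t, y ≤ √s ↔ y ^ 2 ≤ s :=
    fun s _ y hy => Real.le_sqrt' hy.1
  have hI₁ := intervalIntegral_swap_graph (E := E) ht.1 (Real.sqrt_nonneg t)
    Real.continuous_sqrt hsqrt hmem hiff (G := fun σ r => d (t - σ) r)
    (hdc.comp (by fun_prop : Continuous fun z : ℝ × ℝ => (t - z.1, z.2)))
  have hI₂ := intervalIntegral_swap_graph (E := E) ht.1 (Real.sqrt_nonneg t)
    Real.continuous_sqrt hsqrt hmem hiff (G := fun σ r => d (σ - r ^ 2) r)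
    (hdc.comp (by fun_prop : Continuous fun z : ℝ × ℝ => (z.1 - z.2 ^ 2, z.2)))
  have hI : (∫ σ in (0 : ℝ)..t, ∫ r in (0 : ℝ)..√σ, d (t - σ) r) =
      ∫ σ in (0 : ℝ)..t, ∫ r in (0 : ℝ)..√σ, d (σ - r ^ 2) r := by
    rw [hI₁, hI₂]
    refine intervalIntegral.integral_congr fun r _ => ?_
    have h1 := intervalIntegral.integral_comp_sub_left (a := r ^ 2) (b := t)
      (fun s => d (s - r ^ 2) r) (t + r ^ 2)
    simp only [add_sub_cancel_right, add_sub_cancel_left] at h1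
    rw [← h1]
    refine intervalIntegral.integral_congr fun s _ => ?_
    ring_nf
  have hJ₁ : Continuous fun σ => ∫ r in (0 : ℝ)..√σ, d (t - σ) r :=
    intervalIntegral.continuous_parametric_intervalIntegral_of_continuous
      (f := fun σ r => d (t - σ) r)
      (hdc.comp (by fun_prop : Continuous fun z : ℝ × ℝ => (t - z.1, z.2))) Real.continuous_sqrt
  have hJ₂ : Continuous fun σ => ∫ r in (0 : ℝ)..√σ, d (σ - r ^ 2) r :=
    intervalIntegral.continuous_parametric_intervalIntegral_of_continuous
      (f := fun σ r => d (σ - r ^ 2) r)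
      (hdc.comp (by fun_prop : Continuous fun z : ℝ × ℝ => (z.1 - z.2 ^ 2, z.2)))
      Real.continuous_sqrt
  rw [heatPot_zero_eq_integral f ht.1 x hhc, zero_add]
  simp_rw [hFTC]
  have hfx' : Continuous fun σ => f (clampTime T (t - σ)) x :=
    hfx.comp (by fun_prop : Continuous fun σ : ℝ => t - σ)
  have hrefl : (∫ σ in (0 : ℝ)..t, f (clampTime T (t - σ)) x) =
      ∫ σ in (0 : ℝ)..t, f (clampTime T σ) x := by
    have h1 := intervalIntegral.integral_comp_sub_left (a := 0) (b := t)
      (fun s => f (clampTime T s) x) t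
    simpa using h1
  rw [intervalIntegral.integral_add (hfx'.intervalIntegrable _ _) (hJ₁.intervalIntegrable _ _),
    hI, hrefl, ← intervalIntegral.integral_add (hfx.intervalIntegrable _ _)
      (hJ₂.intervalIntegrable _ _)]
  refine intervalIntegral.integral_congr fun s hs => ?_
  rw [Set.uIcc_of_le ht.1] at hs
  have hs' : s ∈ Set.Icc 0 T := ⟨hs.1, hs.2.trans ht.2⟩
  have hci : IntervalIntegrable (fun r => heatAvg (gradOp μ (Spc n →L[ℝ] E))
      (f' (clampTime T (s - r ^ 2))) r x) volume 0 (√s) :=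
    ((hf'.continuous_heatAvg_clamp (rapidDecay_gradOp hμ) hT hp x).comp
      (by fun_prop : Continuous fun r : ℝ => (s - r ^ 2, r))).intervalIntegrable _ _
  have h2 : ∀ r, d (s - r ^ 2) r = ((2 * μ) • traceL n E)
      (heatAvg (gradOp μ (Spc n →L[ℝ] E)) (f' (clampTime T (s - r ^ 2))) r x) := fun r => rfl
  have h3 : gradPot μ 0 T f' (clampTime T s) x = (2 : ℝ) • ∫ r in (0 : ℝ)..√s,
      heatAvg (gradOp μ (Spc n →L[ℝ] E)) (f' (clampTime T (s - r ^ 2))) r x := by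
    rw [clampTime_of_mem hs', ← intervalIntegral.integral_smul]
    simp [gradPot, pot, gradDensity]
  simp_rw [h2, h3]
  rw [ContinuousLinearMap.intervalIntegral_comp_comm _ hci, map_smul, smul_smul, mul_comm μ 2]
  rfl

theorem hasDerivWithinAt_heatPot [CompleteSpace E] (hμ : 0 < μ) (hT : 0 ≤ T) (hp : 0 ≤ p)
    {f : ℝ → Spc n → E} {f' : ℝ → Spc n → (Spc n →L[ℝ] E)} (hf : HolderBound T lam p A f)
    (hf' : HolderBound T lam p A f') (hd : ∀ t ∈ Set.Icc 0 T, ∀ x, HasFDerivAt (f t) (f' t x) x)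
    {t : ℝ} (ht : t ∈ Set.Icc 0 T) (x : Spc n) :
    HasDerivWithinAt (fun τ => heatPot μ 0 T f τ x)
      (f t x + μ • traceL n E (gradPot μ 0 T f' t x)) (Set.Icc 0 T) t := by
  have hc : Continuous fun s => f (clampTime T s) x +
      μ • traceL n E (gradPot μ 0 T f' (clampTime T s) x) := by
    have h1 : Continuous fun s => f (clampTime T s) x :=
      (hf.continuous_clamp hT).comp (by fun_prop : Continuous fun s : ℝ => (s, x))
    have hcp : Continuous fun z : ℝ × Spc n => gradPot μ 0 T f' z.1 z.2 :=
      continuous_pot (rapidDecay_gradOp hμ) hT hp (continuous_gradDensity 0) hf'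
    have h2 : Continuous fun s => gradPot μ 0 T f' (clampTime T s) x :=
      hcp.comp (f := fun s => (clampTime T s, x)) (continuous_clampTime.prodMk continuous_const)
    exact h1.add (((traceL n E).continuous.comp h2).const_smul μ)
  have h := hasDerivWithinAt_of_eq_integral hT hc.continuousOn
    (fun t ht => heatPot_zero_eq hμ hT hp hf hf' hd ht x) ht
  simpa only [clampTime_of_mem ht] using h

theorem integral_heatKer_eq (hμ : 0 < μ) (g : Spc n → ℝ) {r : ℝ} (hr : 0 < r) (x : Spc n) :
    ∫ y, heatKer μ (x - y) r * g y = heatAvg (gaussOp μ ℝ) g (√r) x := by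
  have hρ : 0 < √r := Real.sqrt_pos.2 hr
  have h1 := integral_sub_left_eq_self (fun y => heatKer μ (x - y) r * g y)
    (volume : Measure (Spc n)) x
  have h2 := Measure.integral_comp_smul (volume : Measure (Spc n))
    (fun z => heatKer μ (x - (x - z)) r * g (x - z)) (√r)
  simp only [sub_sub_cancel] at h1 h2
  rw [← h1, heatAvg]
  have h3 : ∀ z : Spc n, gaussOp μ ℝ z (g (x - √r • z)) =
      (√r) ^ n * (heatKer μ (√r • z) r * g (x - √r • z)) := fun z => by
    rw [gaussOp_apply, smul_eq_mul, ← mul_assoc, gaussKer, heatKer, if_pos hr,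
      Real.mul_rpow (by positivity) hr.le, norm_smul, Real.norm_eq_abs, abs_of_pos hρ, mul_pow,
      Real.sq_sqrt hr.le]
    have h4 : r ^ (-(n : ℝ) / 2) = ((√r) ^ n)⁻¹ := by
      rw [Real.sqrt_eq_rpow, ← Real.rpow_natCast, ← Real.rpow_mul hr.le, ← Real.rpow_neg hr.le]
      congr 1; ring
    have h5 : -(r * ‖z‖ ^ 2) / (4 * μ * r) = -‖z‖ ^ 2 / (4 * μ) := by field_simp
    rw [h4, h5]
    have : (√r) ^ n ≠ 0 := by positivity
    field_simp
  simp_rw [h3]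
  rw [integral_const_mul, h2, finrank_euclideanSpace_fin, abs_of_pos (by positivity),
    smul_eq_mul, mul_inv_cancel_left₀ (by positivity)]

theorem volPot_eq_heatPot (hμ : 0 < μ) (hT : 0 ≤ T) (hp : 0 ≤ p) {f : ℝ → Spc n → ℝ}
    (hf : HolderBound T lam p A f) {t : ℝ} (ht : t ∈ Set.Icc 0 T) (x : Spc n) :
    volPot μ f t x = heatPot μ 0 T f t x := by
  rw [heatPot_zero_eq_integral f ht.1 x (hf.continuous_heatAvg_clamp (rapidDecay_gaussOp hμ) hT hp x)]
  have h1 := intervalIntegral.integral_comp_sub_left (a := 0) (b := t)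
    (fun s => heatAvg (gaussOp μ ℝ) (f (clampTime T s)) (√(t - s)) x) t
  simp only [sub_sub_cancel, sub_zero, sub_self] at h1
  rw [h1, volPot, intervalIntegral.integral_of_le ht.1, integral_Ioc_eq_integral_Ioo,
    integral_Ioc_eq_integral_Ioo]
  refine setIntegral_congr_fun measurableSet_Ioo fun τ hτ => ?_
  rw [integral_heatKer_eq hμ _ (sub_pos.2 hτ.2), clampTime_of_mem ⟨hτ.1.le, hτ.2.le.trans ht.2⟩]

end HeatPotential

section Smoothing

variable {E E₁ E₂ : Type} [NormedAddCommGroup E] [NormedSpace ℝ E] [NormedAddCommGroup E₁]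
  [NormedSpace ℝ E₁] [NormedAddCommGroup E₂] [NormedSpace ℝ E₂] {T lam p A μ ω : ℝ}

theorem exists_heatPot_space_bound (hμ : 0 < μ) (hT : 0 ≤ T) (hl0 : 0 ≤ lam) (hl1 : lam ≤ 1)
    (hp : 0 ≤ p) (M : ℕ) (E : Type) [NormedAddCommGroup E] [NormedSpace ℝ E] :
    ∃ C : ℝ, 0 ≤ C ∧ ∀ (ω m A : ℝ) (f : ℝ → Spc n → E), TimeDensity T lam m (heatDensity ω) →
      TimeDensity T lam m (gradDensity ω) → ParabolicClass T lam M 0 (p + 1) A f →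
      ParabolicClass T lam (M + 1) 0 p (C * m * A) (heatPot μ ω T f) := by
  have hp1 : 0 ≤ p + 1 := by linarith
  induction M generalizing p E with
  | zero =>
    have hC₁ := potConst_nonneg (gaussOp μ E : Spc n → _) T (p + 1)
    have hC₂ := potConst_nonneg (gradOp μ E : Spc n → _) T (p + 1)
    refine ⟨potConst (gaussOp μ E : Spc n → _) T (p + 1) +
      potConst (gradOp μ E : Spc n → _) T (p + 1), add_nonneg hC₁ hC₂,
      fun ω m A f h₁ h₂ hf => ?_⟩
    have hf := hf.holderBound
    have hA := hf.nonneg hT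
    have hm := h₁.nonneg
    refine parabolicClass_iff.2 ⟨(hf.pot (rapidDecay_gaussOp hμ) hT hp1 hl0 hl1 h₁).mono hT ?_
      (by linarith), ?_, ?_⟩
    · gcongr; linarith
    · intro M hM
      obtain rfl : M = 0 := by omega
      refine ⟨gradPot μ ω T f, fun t _ x => hasFDerivAt_heatPot hμ hT hp1 hf t x,
        parabolicClass_iff.2 ⟨(hf.pot (rapidDecay_gradOp hμ) hT hp1 hl0 hl1 h₂).mono hT ?_
          le_rfl, by omega, by omega⟩⟩
      gcongr; linarith
    · omega
  | succ M ih =>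
    obtain ⟨C, hC, h⟩ := ih hp1 (Spc n →L[ℝ] E) (by linarith)
    have hC₁ := potConst_nonneg (gaussOp μ E : Spc n → _) T (p + 1)
    refine ⟨potConst (gaussOp μ E : Spc n → _) T (p + 1) + C, add_nonneg hC₁ hC,
      fun ω m A f h₁ h₂ hf => ?_⟩
    have hfh := hf.holderBound
    have hA := hfh.nonneg hT
    have hm := h₁.nonneg
    refine parabolicClass_iff.2 ⟨(hfh.pot (rapidDecay_gaussOp hμ) hT hp1 hl0 hl1 h₁).mono hT ?_
      (by linarith), ?_, by omega⟩
    · gcongr; linarith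
    · intro M' hM
      obtain rfl : M' = M + 1 := by omega
      obtain ⟨f', hd, hf'⟩ := hf.exists_fderiv
      refine ⟨heatPot μ ω T f', fun t _ x => ?_, (h ω m A f' h₁ h₂ hf').mono hT le_rfl le_rfl
        le_rfl ?_⟩
      · rw [← gradPot_eq_heatPot hμ hT hp1 hfh (hf'.holderBound.mono hT le_rfl (by linarith)) hd]
        exact hasFDerivAt_heatPot hμ hT hp1 hfh t x
      · gcongr; linarith

theorem exists_heatPot_bound (hμ : 0 < μ) (hT : 0 ≤ T) (hl0 : 0 ≤ lam) (hl1 : lam ≤ 1)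
    (hp : 0 ≤ p) (M J : ℕ) (E : Type) [NormedAddCommGroup E] [NormedSpace ℝ E]
    [CompleteSpace E] :
    ∃ C : ℝ, 0 ≤ C ∧ ∀ (A : ℝ) (f : ℝ → Spc n → E), ParabolicClass T lam M J (p + 1) A f →
      ParabolicClass T lam (M + 1) (J + 1) p (C * A) (heatPot μ 0 T f) := by
  have hp1 : 0 ≤ p + 1 := by linarith
  have hm₁ : TimeDensity T lam ((2 * √T + 2) * (1 + √T)) (heatDensity 0) :=
    timeDensity_of_le (continuous_heatDensity 0) (by positivity) hl0 hl1 le_rfl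
      fun ρ hρ => abs_heatDensity_le (by linarith) hρ
  have hm₂ : TimeDensity T lam ((2 * √T + 2) * (1 + √T)) (gradDensity 0) :=
    timeDensity_of_le (continuous_gradDensity 0) (by positivity) hl0 hl1 le_rfl
      fun ρ _ => abs_gradDensity_le (by linarith [Real.sqrt_nonneg T])
  have hm := hm₁.nonneg
  set m := (2 * √T + 2) * (1 + √T)
  induction M generalizing p E with
  | zero =>
    obtain ⟨C, hC, h⟩ := exists_heatPot_space_bound (n := n) hμ hT hl0 hl1 hp 0 E
    refine ⟨C * m, mul_nonneg hC hm, fun A f hf => ?_⟩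
    have h0 := h 0 m A f hm₁ hm₂ (hf.mono hT le_rfl (Nat.zero_le J) le_rfl le_rfl)
    refine parabolicClass_iff.2 ⟨h0.holderBound, fun M hM => ?_, by omega⟩
    obtain rfl : M = 0 := by omega
    obtain ⟨v', hv, hv'⟩ := h0.exists_fderiv
    exact ⟨v', hv, parabolicClass_iff.2 ⟨hv'.holderBound, by omega, by omega⟩⟩
  | succ M ih =>
    obtain ⟨C₁, hC₁, h₁⟩ := exists_heatPot_space_bound (n := n) hμ hT hl0 hl1 hp 0 E
    obtain ⟨C₂, hC₂, h₂⟩ := ih hp1 (Spc n →L[ℝ] E) (by linarith)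
    have hL := norm_nonneg (μ • traceL n E)
    set b := ‖μ • traceL n E‖ with hb
    set C := C₁ * m + C₂ + (1 + b * (C₂)) with hCdef
    have hbC := mul_nonneg hL hC₂
    have hCm := mul_nonneg hC₁ hm
    refine ⟨C, by positivity, fun A f hf => ?_⟩
    have hA := hf.nonneg hT
    have hfh := hf.holderBound
    have h0 := h₁ 0 m A f hm₁ hm₂ (hf.mono hT (Nat.zero_le _) (Nat.zero_le J) le_rfl le_rfl)
    obtain ⟨f', hd, hf'⟩ := hf.exists_fderiv
    have hf'h : HolderBound T lam (p + 1) A f' := hf'.holderBound.mono hT le_rfl (by linarith)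
    have h3 := h₂ A f' hf'
    refine parabolicClass_iff.2 ⟨h0.holderBound.mono hT ?_ le_rfl, ?_, ?_⟩
    · gcongr; linarith
    · intro M' hM
      obtain rfl : M' = M + 1 := by omega
      refine ⟨heatPot μ 0 T f', fun t _ x => ?_, h3.mono hT le_rfl le_rfl le_rfl ?_⟩
      · rw [← gradPot_eq_heatPot hμ hT hp1 hfh hf'h hd]
        exact hasFDerivAt_heatPot hμ hT hp1 hfh t x
      · gcongr; linarith
    · intro M' K hM hK
      obtain rfl : M' = M := by omega
      obtain rfl : K = J := by omega
      obtain ⟨g, hg, hg'⟩ := h3.exists_fderiv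
      have hgeq : ∀ t ∈ Set.Icc 0 T, ∀ x, gradPot μ 0 T f' t x = g t x := fun t ht x =>
        (hasFDerivAt_heatPot hμ hT hp1 hf'h t x).unique (hg t ht x)
      refine ⟨_, fun t ht x => hasDerivWithinAt_heatPot hμ hT hp1 hfh hf'h hd ht x, ?_⟩
      have hgL := ((hg'.congr hgeq).clm (μ • traceL n E) le_rfl).mono hT le_rfl
        (Nat.le_succ K) (p' := p) (by linarith) le_rfl
      refine ((hf.mono hT (Nat.le_succ M') le_rfl (p' := p) (by linarith) le_rfl).add hgL).mono
        hT le_rfl le_rfl le_rfl ?_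
      have e : A + b * (C₂ * A) = (1 + b * C₂) * A := by ring
      rw [← hb, e]
      gcongr; linarith

/-- The bilinear first order operator `b₁(w, Du) + b₂(Dw, u)`. -/
def bilinOp (b₁ : E₁ →L[ℝ] (Spc n →L[ℝ] E₂) →L[ℝ] E) (b₂ : (Spc n →L[ℝ] E₁) →L[ℝ] E₂ →L[ℝ] E)
    (w : ℝ → Spc n → E₁) (u : ℝ → Spc n → E₂) (t : ℝ) (x : Spc n) : E :=
  b₁ (w t x) (fderiv ℝ (u t) x) + b₂ (fderiv ℝ (w t) x) (u t x)

/-- Constant in the estimate of `bilinOp`. -/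
def bilinConst (b₁ : E₁ →L[ℝ] (Spc n →L[ℝ] E₂) →L[ℝ] E)
    (b₂ : (Spc n →L[ℝ] E₁) →L[ℝ] E₂ →L[ℝ] E) (N : ℕ) : ℝ :=
  2 ^ (N + 1) * ‖b₁‖ + 2 ^ (N + 1) * ‖b₂‖

theorem bilinConst_nonneg (b₁ : E₁ →L[ℝ] (Spc n →L[ℝ] E₂) →L[ℝ] E)
    (b₂ : (Spc n →L[ℝ] E₁) →L[ℝ] E₂ →L[ℝ] E) (N : ℕ) : 0 ≤ bilinConst b₁ b₂ N :=
  add_nonneg (mul_nonneg (by positivity) (norm_nonneg b₁))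
    (mul_nonneg (by positivity) (norm_nonneg b₂))

theorem ParabolicClass.bilinOp (hT : 0 ≤ T) {p₁ p₂ A₁ A₂ : ℝ} (hp₁ : 0 ≤ p₁) (hp₂ : 0 ≤ p₂)
    {N J : ℕ} (b₁ : E₁ →L[ℝ] (Spc n →L[ℝ] E₂) →L[ℝ] E)
    (b₂ : (Spc n →L[ℝ] E₁) →L[ℝ] E₂ →L[ℝ] E) {w : ℝ → Spc n → E₁} {u : ℝ → Spc n → E₂}
    (hw : ParabolicClass T lam (N + 1) J p₁ A₁ w) (hu : ParabolicClass T lam (N + 1) J p₂ A₂ u) :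
    ParabolicClass T lam N J (p₁ + p₂ + 1) (bilinConst b₁ b₂ N * (A₁ * A₂))
      (bilinOp b₁ b₂ w u) := by
  obtain ⟨w', hdw, hw'⟩ := hw.exists_fderiv
  obtain ⟨u', hdu, hu'⟩ := hu.exists_fderiv
  have hw0 := hw.mono hT (Nat.le_succ N) le_rfl le_rfl le_rfl
  have hu0 := hu.mono hT (Nat.le_succ N) le_rfl le_rfl le_rfl
  have h₁ := hw0.bilin hT hp₁ (by linarith) b₁ le_rfl hu'
  have h₂ := hw'.bilin hT (by linarith) hp₂ b₂ le_rfl hu0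
  have e₁ : p₁ + (p₂ + 1) = p₁ + p₂ + 1 := by ring
  have e₂ : p₁ + 1 + p₂ = p₁ + p₂ + 1 := by ring
  rw [e₁] at h₁
  rw [e₂] at h₂
  refine ((h₁.add h₂).mono hT le_rfl le_rfl le_rfl
    (by rw [bilinConst]; exact (add_mul _ _ _).ge)).congr fun t ht x => ?_
  rw [NSdeRham.bilinOp, (hdw t ht x).fderiv, (hdu t ht x).fderiv]

end Smoothing

section Volterra

variable {E F : Type} [NormedAddCommGroup E] [NormedSpace ℝ E] [NormedAddCommGroup F]
  [NormedSpace ℝ F] {T lam p A μ ω : ℝ} {N : ℕ}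

theorem ParabolicClass.neg {J : ℕ} {v : ℝ → Spc n → E} (h : ParabolicClass T lam N J p A v) :
    ParabolicClass T lam N J p A (fun t x => -v t x) := by
  have h1 : ‖-(1 : E →L[ℝ] E)‖ ≤ 1 := by
    rw [norm_neg]; exact ContinuousLinearMap.norm_id_le
  have h2 := h.clm (-(1 : E →L[ℝ] E)) h1
  rw [one_mul] at h2
  exact h2

theorem HolderBound.tsum [CompleteSpace E] (hp : 0 ≤ p)
    {v : ℕ → ℝ → Spc n → E} {a : ℕ → ℝ}
    (h : ∀ k, HolderBound T lam p (a k) (v k)) (ha : Summable a) (ha0 : ∀ k, 0 ≤ a k) :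
    HolderBound T lam p (∑' k, a k) (fun t x => ∑' k, v k t x) := by
  have hle : ∀ k, ∀ t ∈ Set.Icc 0 T, ∀ x, ‖v k t x‖ ≤ a k := fun k t ht x =>
    ((h k).bound t ht x).trans (mul_le_of_le_one_right (ha0 k) (wt_rpow_le_one hp x))
  have hsum : ∀ t ∈ Set.Icc 0 T, ∀ x, Summable fun k => v k t x := fun t ht x =>
    ha.of_norm_bounded fun k => hle k t ht x
  refine ⟨continuousOn_tsum (fun k => (h k).cont) ha fun k z hz => hle k _ hz.1 _,
    fun t ht x => ?_, fun hl t ht x y hxy => ?_, fun hl t₁ ht₁ t₂ ht₂ x => ?_⟩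
  · rw [← tsum_mul_right]
    exact tsum_of_norm_bounded (ha.mul_right _).hasSum fun k => (h k).bound t ht x
  · rw [← (hsum t ht x).tsum_sub (hsum t ht y), ← tsum_mul_right, ← tsum_mul_right]
    exact tsum_of_norm_bounded ((ha.mul_right _).mul_right _).hasSum
      fun k => (h k).space hl t ht x y hxy
  · rw [← (hsum t₁ ht₁ x).tsum_sub (hsum t₂ ht₂ x), ← tsum_mul_right, ← tsum_mul_right]
    exact tsum_of_norm_bounded ((ha.mul_right _).mul_right _).hasSum
      fun k => (h k).time hl t₁ ht₁ t₂ ht₂ x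

theorem ParabolicClass.tsum [CompleteSpace E] (hT : 0 ≤ T) (hp : 0 ≤ p)
    {v : ℕ → ℝ → Spc n → E} {a : ℕ → ℝ} (h : ∀ k, ParabolicClass T lam N 0 p (a k) (v k))
    (ha : Summable a) : ParabolicClass T lam N 0 p (∑' k, a k) (fun t x => ∑' k, v k t x) := by
  have ha0 : ∀ k, 0 ≤ a k := fun k => (h k).nonneg hT
  induction N generalizing p E with
  | zero => exact HolderBound.tsum hp (fun k => (h k).holderBound) ha ha0
  | succ N ih =>
    refine parabolicClass_iff.2 ⟨HolderBound.tsum hp (fun k => (h k).holderBound) ha ha0, ?_,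
      by omega⟩
    intro M hM
    obtain rfl : M = N := by omega
    choose v' hd hv' using fun k => (h k).exists_fderiv
    have hp1 : 0 ≤ p + 1 := by linarith
    refine ⟨fun t x => ∑' k, v' k t x, fun t ht x => ?_, ih hp1 hv'⟩
    refine hasFDerivAt_tsum ha (fun k y => hd k t ht y) (fun k y =>
      ((hv' k).holderBound.bound t ht y).trans
        (mul_le_of_le_one_right (ha0 k) (wt_rpow_le_one hp1 y))) (x₀ := 0) ?_ x
    exact ha.of_norm_bounded fun k => ((h k).holderBound.bound t ht 0).trans
      (mul_le_of_le_one_right (ha0 k) (wt_rpow_le_one hp 0))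

theorem HolderBound.smul_time (hT : 0 ≤ T) {θ : ℝ → ℝ} {B : ℝ} (hB : 0 ≤ B) (hθ : Continuous θ)
    (hb : ∀ t ∈ Set.Icc 0 T, |θ t| ≤ B) (hl : 0 < lam → ∀ t₁ ∈ Set.Icc 0 T, ∀ t₂ ∈ Set.Icc 0 T,
      |θ t₁ - θ t₂| ≤ B * |t₁ - t₂| ^ (lam / 2)) {v : ℝ → Spc n → E}
    (h : HolderBound T lam p A v) : HolderBound T lam p (2 * B * A) (fun t x => θ t • v t x) := by
  have hA := h.nonneg hT
  have hBA := mul_nonneg hB hA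
  refine ⟨(hθ.comp continuous_fst).continuousOn.smul h.cont, fun t ht x => ?_,
    fun hl' t ht x y hxy => ?_, fun hl' t₁ ht₁ t₂ ht₂ x => ?_⟩
  · have hw := (wt_rpow_pos x (-p)).le
    rw [norm_smul, Real.norm_eq_abs]
    calc _ ≤ B * (A * wt x ^ (-p)) :=
          mul_le_mul (hb t ht) (h.bound t ht x) (norm_nonneg _) hB
      _ ≤ 2 * (B * (A * wt x ^ (-p))) := by linarith [mul_nonneg hB (mul_nonneg hA hw)]
      _ = _ := by ring
  · have h1 := h.space hl' t ht x y hxy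
    rw [← smul_sub, norm_smul, Real.norm_eq_abs]
    have h0 := (norm_nonneg _).trans h1
    refine (mul_le_mul (hb t ht) h1 (norm_nonneg _) hB).trans ?_
    have h2 := mul_nonneg hB h0
    refine (le_add_of_nonneg_left h2).trans (le_of_eq (by ring))
  · have h1 := h.time hl' t₁ ht₁ t₂ ht₂ x
    have e : θ t₁ • v t₁ x - θ t₂ • v t₂ x =
        θ t₁ • (v t₁ x - v t₂ x) + (θ t₁ - θ t₂) • v t₂ x := by
      simp only [smul_sub, sub_smul]; abel
    rw [e]
    refine (norm_add_le _ _).trans ?_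
    rw [norm_smul, norm_smul, Real.norm_eq_abs, Real.norm_eq_abs]
    have h2 := mul_le_mul (hb t₁ ht₁) h1 (norm_nonneg _) hB
    have h3 := mul_le_mul (hl hl' t₁ ht₁ t₂ ht₂) (h.bound t₂ ht₂ x) (norm_nonneg _)
      (by positivity)
    exact (add_le_add h2 h3).trans (le_of_eq (by ring))

theorem ParabolicClass.smul_time (hT : 0 ≤ T) {θ : ℝ → ℝ} {B : ℝ} (hB : 0 ≤ B)
    (hθ : Continuous θ) (hb : ∀ t ∈ Set.Icc 0 T, |θ t| ≤ B)
    (hl : 0 < lam → ∀ t₁ ∈ Set.Icc 0 T, ∀ t₂ ∈ Set.Icc 0 T,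
      |θ t₁ - θ t₂| ≤ B * |t₁ - t₂| ^ (lam / 2)) {v : ℝ → Spc n → E}
    (h : ParabolicClass T lam N 0 p A v) :
    ParabolicClass T lam N 0 p (2 * B * A) (fun t x => θ t • v t x) := by
  induction N generalizing p E with
  | zero => exact h.holderBound.smul_time hT hB hθ hb hl
  | succ N ih =>
    refine parabolicClass_iff.2 ⟨h.holderBound.smul_time hT hB hθ hb hl, ?_, by omega⟩
    intro M hM
    obtain rfl : M = N := by omega
    obtain ⟨v', hd, hv'⟩ := h.exists_fderiv
    exact ⟨_, fun t ht x => (hd t ht x).const_smul (θ t), ih hv'⟩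

theorem exists_exp_time_bound (hT : 0 ≤ T) (hl0 : 0 ≤ lam) (hl1 : lam ≤ 1) (ω : ℝ) :
    ∃ B : ℝ, 0 ≤ B ∧ (∀ t ∈ Set.Icc 0 T, |Real.exp (ω * t)| ≤ B) ∧
      ∀ t₁ ∈ Set.Icc 0 T, ∀ t₂ ∈ Set.Icc 0 T,
        |Real.exp (ω * t₁) - Real.exp (ω * t₂)| ≤ B * |t₁ - t₂| ^ (lam / 2) := by
  set K := Real.exp (|ω| * T) with hK
  have hK1 : 1 ≤ K := Real.one_le_exp (by positivity)
  have hexp : ∀ t ∈ Set.Icc 0 T, Real.exp (ω * t) ≤ K := fun t ht =>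
    Real.exp_le_exp.2 (mul_le_mul (le_abs_self ω) ht.2 ht.1 (abs_nonneg ω))
  have hlip : ∀ t₁ ∈ Set.Icc 0 T, ∀ t₂ ∈ Set.Icc 0 T,
      |Real.exp (ω * t₁) - Real.exp (ω * t₂)| ≤ |ω| * K * |t₁ - t₂| := fun t₁ ht₁ t₂ ht₂ => by
    have := (convex_Icc 0 T).norm_image_sub_le_of_norm_hasDerivWithin_le
      (f := fun t => Real.exp (ω * t)) (f' := fun t => Real.exp (ω * t) * ω) (C := |ω| * K)
      (fun t _ => by simpa using (((hasDerivAt_id t).const_mul ω).exp).hasDerivWithinAt)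
      (fun t ht => by
        rw [norm_mul, Real.norm_eq_abs, Real.norm_eq_abs, abs_of_pos (Real.exp_pos _), mul_comm]
        exact mul_le_mul_of_nonneg_left (hexp t ht) (abs_nonneg ω)) ht₂ ht₁
    simpa only [Real.norm_eq_abs] using this
  refine ⟨K + |ω| * K * (1 + T), by positivity, fun t ht => ?_, fun t₁ ht₁ t₂ ht₂ => ?_⟩
  · rw [abs_of_pos (Real.exp_pos _)]
    have : 0 ≤ |ω| * K * (1 + T) := by positivity
    linarith [hexp t ht]
  · refine (hlip t₁ ht₁ t₂ ht₂).trans ?_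
    set d := |t₁ - t₂| with hd
    have hd0 : 0 ≤ d := abs_nonneg _
    have hdT : d ≤ T := abs_sub_le_iff.2 ⟨by linarith [ht₁.2, ht₂.1], by linarith [ht₁.1, ht₂.2]⟩
    have h1 : d ≤ (1 + T) * d ^ (lam / 2) := by
      rcases le_total d 1 with h | h
      · have h2 : d ≤ d ^ (lam / 2) := by
          rcases hd0.eq_or_lt with h0 | h0
          · rw [← h0]; positivity
          · calc d = d ^ (1 : ℝ) := by simp
              _ ≤ _ := Real.rpow_le_rpow_of_exponent_ge h0 h (by linarith)
        nlinarith [Real.rpow_nonneg hd0 (lam / 2)]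
      · have h2 : 1 ≤ d ^ (lam / 2) := Real.one_le_rpow h (by linarith)
        nlinarith
    have hr := Real.rpow_nonneg hd0 (lam / 2)
    calc |ω| * K * d ≤ |ω| * K * ((1 + T) * d ^ (lam / 2)) := by gcongr
      _ ≤ (K + |ω| * K * (1 + T)) * d ^ (lam / 2) := by
          have : 0 ≤ K * d ^ (lam / 2) := by positivity
          linarith

/-- Conjugating the heat potential with an exponential in time adds damping. -/
theorem heatPot_exp_smul (μ : ℝ) (f : ℝ → Spc n → E) {t : ℝ} (ht : t ∈ Set.Icc 0 T)
    (x : Spc n) :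
    heatPot μ 0 T (fun s y => Real.exp (ω * s) • f s y) t x =
      Real.exp (ω * t) • heatPot μ ω T f t x := by
  rw [heatPot, heatPot, pot, pot, ← intervalIntegral.integral_smul]
  refine intervalIntegral.integral_congr fun ρ hρ => ?_
  rw [Set.uIcc_of_le (Real.sqrt_nonneg t)] at hρ
  have hm : t - ρ ^ 2 ∈ Set.Icc 0 T := by
    have : ρ ^ 2 ≤ t := (Real.le_sqrt hρ.1 ht.1).1 hρ.2
    exact ⟨by linarith, by linarith [ht.2, sq_nonneg ρ]⟩
  have h1 : heatAvg (gaussOp μ E) (fun y => Real.exp (ω * (t - ρ ^ 2)) • f (t - ρ ^ 2) y) ρ x =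
      Real.exp (ω * (t - ρ ^ 2)) • heatAvg (gaussOp μ E) (f (t - ρ ^ 2)) ρ x := by
    rw [heatAvg, heatAvg, ← integral_smul]
    simp only [map_smul]
  simp only [clampTime_of_mem hm]
  rw [h1, smul_smul, smul_smul, heatDensity, heatDensity]
  congr 1
  rw [show ω * (t - ρ ^ 2) = ω * t + -ω * ρ ^ 2 by ring, Real.exp_add, neg_zero, zero_mul,
    Real.exp_zero]
  ring

theorem heatPot_add (hμ : 0 < μ) (hT : 0 ≤ T) (hp : 0 ≤ p) {f g : ℝ → Spc n → E} {A' : ℝ}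
    (hf : HolderBound T lam p A f) (hg : HolderBound T lam p A' g) (t : ℝ) (x : Spc n) :
    heatPot μ ω T (fun s y => f s y + g s y) t x = heatPot μ ω T f t x + heatPot μ ω T g t x := by
  have hκ := rapidDecay_gaussOp (n := n) (E := E) hμ
  have hφ := continuous_heatDensity ω
  rw [heatPot, heatPot, heatPot, pot, pot, pot, ← intervalIntegral.integral_add
    ((continuous_pot_slice hκ hT hp hφ hf t x).intervalIntegrable _ _)
    ((continuous_pot_slice hκ hT hp hφ hg t x).intervalIntegrable _ _)]
  refine intervalIntegral.integral_congr fun ρ _ => ?_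
  have h1 : heatAvg (gaussOp μ E) (fun y => f (clampTime T (t - ρ ^ 2)) y +
      g (clampTime T (t - ρ ^ 2)) y) ρ x = heatAvg (gaussOp μ E) (f (clampTime T (t - ρ ^ 2))) ρ x +
      heatAvg (gaussOp μ E) (g (clampTime T (t - ρ ^ 2))) ρ x := by
    rw [heatAvg, heatAvg, heatAvg, ← integral_add
      (integrable_heatAvg hκ (hf.continuous_slice_clamp hT _)
        (hf.norm_le hT hp (clampTime_mem hT _)) ρ x)
      (integrable_heatAvg hκ (hg.continuous_slice_clamp hT _)
        (hg.norm_le hT hp (clampTime_mem hT _)) ρ x)]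
    simp only [map_add]
  simp only [h1, smul_add]

theorem heatPot_congr (hT : 0 ≤ T) {f g : ℝ → Spc n → E}
    (h : ∀ t ∈ Set.Icc 0 T, ∀ x, f t x = g t x) : heatPot μ ω T f = heatPot μ ω T g := by
  funext t x
  refine intervalIntegral.integral_congr fun ρ _ => ?_
  simp only [show f (clampTime T (t - ρ ^ 2)) = g (clampTime T (t - ρ ^ 2)) from
    funext (h _ (clampTime_mem hT _))]

/-- Solvability of `u + 𝒱 u = f` by Neumann series for a contraction `𝒱`. -/
theorem exists_neumann_solution [CompleteSpace E] (hT : 0 ≤ T) (hp : 0 ≤ p)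
    {𝒱 : (ℝ → Spc n → E) → ℝ → Spc n → E}
    (hV : ∀ u A, ParabolicClass T lam N 0 p A u → ParabolicClass T lam N 0 p (1 / 2 * A) (𝒱 u))
    (hadd : ∀ u v A A', ParabolicClass T lam N 0 p A u → ParabolicClass T lam N 0 p A' v →
      ∀ t ∈ Set.Icc 0 T, ∀ x, 𝒱 (fun s y => u s y + v s y) t x = 𝒱 u t x + 𝒱 v t x)
    (hcongr : ∀ u v, (∀ t ∈ Set.Icc 0 T, ∀ x, u t x = v t x) → 𝒱 u = 𝒱 v)
    {f : ℝ → Spc n → E} (hf : ParabolicClass T lam N 0 p A f) :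
    ∃ u, ParabolicClass T lam N 0 p (2 * A) u ∧
      ∀ t ∈ Set.Icc 0 T, ∀ x, u t x + 𝒱 u t x = f t x := by
  set v : ℕ → ℝ → Spc n → E := fun k => (fun u s y => - 𝒱 u s y)^[k] f with hv
  have hv0 : v 0 = f := rfl
  have hvs : ∀ k, v (k + 1) = fun s y => - 𝒱 (v k) s y := fun k => by
    rw [hv]; exact Function.iterate_succ_apply' _ _ _
  have hvc : ∀ k, ParabolicClass T lam N 0 p ((1 / 2) ^ k * A) (v k) := fun k => by
    induction k with
    | zero => simpa [hv0] using hf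
    | succ k ih =>
      rw [hvs, pow_succ', mul_assoc]
      exact (hV _ _ ih).neg
  have hsum : ∀ K : ℕ, Summable fun k : ℕ => (1 / 2 : ℝ) ^ (k + K) * A := fun K =>
    ((summable_nat_add_iff K).2 summable_geometric_two).mul_right A
  have htsum : ∀ K : ℕ, ∑' k : ℕ, (1 / 2 : ℝ) ^ (k + K) * A = (1 / 2) ^ K * (2 * A) := fun K => by
    rw [tsum_mul_right]
    simp_rw [pow_add]
    rw [tsum_mul_right, tsum_geometric_two]; ring
  set s : ℕ → ℝ → Spc n → E := fun K t x => ∑' k, v (k + K) t x with hs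
  have hsc : ∀ K, ParabolicClass T lam N 0 p ((1 / 2) ^ K * (2 * A)) (s K) := fun K => by
    rw [← htsum]
    exact ParabolicClass.tsum hT hp (fun k => hvc (k + K)) (hsum K)
  have hA := hf.nonneg hT
  have hstep : ∀ K, ∀ t ∈ Set.Icc 0 T, ∀ x, s K t x = v K t x + s (K + 1) t x :=
    fun K t ht x => by
      have : Summable fun k => v (k + K) t x := (hsum K).of_norm_bounded fun k =>
        ((hvc (k + K)).holderBound.bound t ht x).trans
          (mul_le_of_le_one_right (by positivity) (wt_rpow_le_one hp x))
      rw [hs]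
      simp only
      rw [this.tsum_eq_zero_add, zero_add]
      congr 2 with k
      rw [show k + 1 + K = k + (K + 1) by ring]
  have hdefect : ∀ K, ∀ t ∈ Set.Icc 0 T, ∀ x,
      s K t x + 𝒱 (s K) t x - v K t x = s 0 t x + 𝒱 (s 0) t x - v 0 t x := fun K => by
    induction K with
    | zero => intros; rfl
    | succ K ih =>
      intro t ht x
      rw [← ih t ht x, hcongr _ _ (hstep K), hadd _ _ _ _ (hvc K) (hsc (K + 1)) t ht x,
        hstep K t ht x, hvs, sub_neg_eq_add]
      abel
  refine ⟨s 0, by simpa using hsc 0, fun t ht x => ?_⟩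
  have hlim : Tendsto (fun K : ℕ => (1 / 2 : ℝ) ^ K * (4 * A)) atTop (nhds 0) := by
    simpa using (tendsto_pow_atTop_nhds_zero_of_lt_one (r := (1 / 2 : ℝ)) (by norm_num)
      (by norm_num)).mul_const (4 * A)
  have hle : ‖s 0 t x + 𝒱 (s 0) t x - v 0 t x‖ ≤ 0 :=
    ge_of_tendsto' hlim fun K => by
      rw [← hdefect K t ht x]
      have hw := fun {B : ℝ} {g : ℝ → Spc n → E} (h : ParabolicClass T lam N 0 p B g) =>
        h.holderBound.norm_le hT hp ht x
      calc _ ≤ ‖s K t x‖ + ‖𝒱 (s K) t x‖ + ‖v K t x‖ := by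
            refine (norm_sub_le _ _).trans ?_
            gcongr; exact norm_add_le _ _
        _ ≤ (1 / 2) ^ K * (2 * A) + 1 / 2 * ((1 / 2) ^ K * (2 * A)) + (1 / 2) ^ K * A :=
            add_le_add (add_le_add (hw (hsc K)) (hw (hV _ _ (hsc K)))) (hw (hvc K))
        _ = _ := by ring
  rw [← hv0]
  exact sub_eq_zero.1 (norm_le_zero_iff.1 hle)

theorem eq_zero_of_add_contraction_eq_zero (hT : 0 ≤ T) (hp : 0 ≤ p)
    {𝒱 : (ℝ → Spc n → E) → ℝ → Spc n → E}
    (hV : ∀ u A, ParabolicClass T lam N 0 p A u → ParabolicClass T lam N 0 p (1 / 2 * A) (𝒱 u))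
    {u : ℝ → Spc n → E} (hu : ParabolicClass T lam N 0 p A u)
    (h0 : ∀ t ∈ Set.Icc 0 T, ∀ x, u t x + 𝒱 u t x = 0) {t : ℝ} (ht : t ∈ Set.Icc 0 T)
    (x : Spc n) : u t x = 0 := by
  have hk : ∀ k : ℕ, ParabolicClass T lam N 0 p ((1 / 2) ^ k * A) u := fun k => by
    induction k with
    | zero => simpa using hu
    | succ k ih =>
      rw [pow_succ', mul_assoc]
      refine (hV _ _ ih).neg.congr fun t ht x => ?_
      exact eq_neg_of_add_eq_zero_left (h0 t ht x)
  have hlim : Tendsto (fun k : ℕ => (1 / 2 : ℝ) ^ k * A) atTop (nhds 0) := by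
    simpa using (tendsto_pow_atTop_nhds_zero_of_lt_one (r := (1 / 2 : ℝ)) (by norm_num)
      (by norm_num)).mul_const A
  exact norm_le_zero_iff.1 (ge_of_tendsto' hlim fun k =>
    (hk k).holderBound.norm_le hT hp ht x)

end Volterra

section VolterraSolve

variable {E : Type} [NormedAddCommGroup E] [NormedSpace ℝ E]
  {T lam δ A B μ ω : ℝ} {M J : ℕ}
  (b₁ : E →L[ℝ] (Spc n →L[ℝ] E) →L[ℝ] E) (b₂ : (Spc n →L[ℝ] E) →L[ℝ] E →L[ℝ] E)
  {w u v : ℝ → Spc n → E}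

theorem bilinOp_congr (h : ∀ t ∈ Set.Icc 0 T, ∀ x, u t x = v t x) {t : ℝ}
    (ht : t ∈ Set.Icc 0 T) (x : Spc n) : bilinOp b₁ b₂ w u t x = bilinOp b₁ b₂ w v t x := by
  have e : u t = v t := funext (h t ht)
  rw [bilinOp, bilinOp, e]

theorem bilinOp_add (hu : ParabolicClass T lam (M + 1) J δ A u)
    (hv : ParabolicClass T lam (M + 1) J δ B v) {t : ℝ} (ht : t ∈ Set.Icc 0 T) (x : Spc n) :
    bilinOp b₁ b₂ w (fun s y => u s y + v s y) t x =
      bilinOp b₁ b₂ w u t x + bilinOp b₁ b₂ w v t x := by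
  obtain ⟨u', hdu, -⟩ := hu.exists_fderiv
  obtain ⟨v', hdv, -⟩ := hv.exists_fderiv
  have e : fderiv ℝ (fun y => u t y + v t y) x = fderiv ℝ (u t) x + fderiv ℝ (v t) x :=
    ((hdu t ht x).add (hdv t ht x)).fderiv.trans (by rw [(hdu t ht x).fderiv, (hdv t ht x).fderiv])
  simp only [bilinOp, e, map_add]
  abel

theorem bilinOp_smul (θ : ℝ → ℝ) (hu : ParabolicClass T lam (M + 1) J δ A u) {t : ℝ}
    (ht : t ∈ Set.Icc 0 T) (x : Spc n) :
    bilinOp b₁ b₂ w (fun s y => θ s • u s y) t x = θ t • bilinOp b₁ b₂ w u t x := by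
  obtain ⟨u', hdu, -⟩ := hu.exists_fderiv
  have e : fderiv ℝ (fun y => θ t • u t y) x = θ t • fderiv ℝ (u t) x :=
    ((hdu t ht x).const_smul (θ t)).fderiv.trans (by rw [(hdu t ht x).fderiv])
  simp only [bilinOp, e, map_smul, smul_add]

theorem exists_heatPot_bilinOp_bound [CompleteSpace E] (hμ : 0 < μ) (hT : 0 ≤ T) (hl0 : 0 ≤ lam)
    (hl1 : lam ≤ 1) (hδ : 0 ≤ δ) (M J : ℕ) :
    ∃ C : ℝ, 0 ≤ C ∧ ∀ A B : ℝ, ∀ w u : ℝ → Spc n → E, ParabolicClass T lam (M + 1) J δ A w →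
      ParabolicClass T lam (M + 1) J δ B u → ParabolicClass T lam (M + 1) (J + 1) δ (C * (A * B))
        (heatPot μ 0 T (bilinOp b₁ b₂ w u)) := by
  obtain ⟨C, hC, h⟩ := exists_heatPot_bound (n := n) hμ hT hl0 hl1 hδ M J E
  refine ⟨C * bilinConst b₁ b₂ M, mul_nonneg hC (bilinConst_nonneg b₁ b₂ M),
    fun A B w u hw hu => ?_⟩
  rw [mul_assoc]
  exact h _ _ ((hw.bilinOp hT hδ hδ b₁ b₂ hu).mono hT le_rfl le_rfl (by linarith) le_rfl)

theorem exists_contraction (hμ : 0 < μ) (hT : 0 ≤ T) (hl0 : 0 ≤ lam) (hl1 : lam < 1)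
    (hδ : 0 ≤ δ) (hw : ParabolicClass T lam (M + 1) 0 δ A w) :
    ∃ ω : ℝ, ∀ (u : ℝ → Spc n → E) (B : ℝ), ParabolicClass T lam (M + 1) 0 δ B u →
      ParabolicClass T lam (M + 1) 0 δ (1 / 2 * B) (heatPot μ ω T (bilinOp b₁ b₂ w u)) := by
  obtain ⟨C, hC, h⟩ := exists_heatPot_space_bound (n := n) hμ hT hl0 hl1.le hδ M E
  set K := C * (bilinConst b₁ b₂ M * A) with hK
  have hK0 : 0 ≤ K := mul_nonneg hC (mul_nonneg (bilinConst_nonneg b₁ b₂ M) (hw.nonneg hT))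
  obtain ⟨ω, -, hω⟩ := exists_damping T (lam := lam) (B := 2 * √T + 2)
    (ε := 1 / (2 * (K + 1))) (by positivity) hl0 hl1 (by positivity)
  refine ⟨ω, fun u B hu => ?_⟩
  have hm₁ := hω _ (continuous_heatDensity ω) fun ρ hρ =>
    abs_heatDensity_le (B := 2 * √T + 2) (by linarith) hρ
  have hm₂ := hω _ (continuous_gradDensity ω) fun ρ _ =>
    abs_gradDensity_le (B := 2 * √T + 2) (by linarith [Real.sqrt_nonneg T])
  refine (h ω _ _ _ hm₁ hm₂ ((hw.bilinOp hT hδ hδ b₁ b₂ hu).mono hT le_rfl le_rfl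
    (by linarith) le_rfl)).mono hT le_rfl le_rfl le_rfl ?_
  have hB := hu.nonneg hT
  calc _ = K / (K + 1) * (1 / 2 * B) := by rw [hK]; field_simp
    _ ≤ 1 * (1 / 2 * B) := by
        gcongr
        exact (div_le_one (by linarith)).2 (by linarith)
    _ = _ := one_mul _

theorem exp_neg_smul_exp_smul (ω t : ℝ) (a : E) :
    Real.exp (-ω * t) • Real.exp (ω * t) • a = a := by
  rw [smul_smul, ← Real.exp_add, neg_mul, neg_add_cancel, Real.exp_zero, one_smul]

theorem heatPot_bilinOp_exp_smul (hT : 0 ≤ T) (hu : ParabolicClass T lam (M + 1) J δ A u) {t : ℝ}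
    (ht : t ∈ Set.Icc 0 T) (x : Spc n) :
    heatPot μ 0 T (bilinOp b₁ b₂ w (fun s y => Real.exp (ω * s) • u s y)) t x =
      Real.exp (ω * t) • heatPot μ ω T (bilinOp b₁ b₂ w u) t x := by
  rw [← heatPot_exp_smul μ _ ht x, heatPot_congr hT fun t ht x =>
    bilinOp_smul b₁ b₂ (fun s => Real.exp (ω * s)) hu ht x]

/-- Solvability of the Volterra equation `u + Ψ b(w, u) = f` in spatial regularity classes. -/
theorem exists_volterra_solution [CompleteSpace E] (hμ : 0 < μ) (hT : 0 ≤ T) (hl0 : 0 ≤ lam)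
    (hl1 : lam < 1) (hδ : 0 ≤ δ) (hw : ParabolicClass T lam (M + 1) 0 δ A w) :
    ∃ C : ℝ, 0 ≤ C ∧ ∀ (f : ℝ → Spc n → E) (B : ℝ), ParabolicClass T lam (M + 1) 0 δ B f →
      ∃ u, ParabolicClass T lam (M + 1) 0 δ (C * B) u ∧ ∀ t ∈ Set.Icc 0 T, ∀ x,
        u t x + heatPot μ 0 T (bilinOp b₁ b₂ w u) t x = f t x := by
  obtain ⟨ω, hω⟩ := exists_contraction (μ := μ) b₁ b₂ hμ hT hl0 hl1 hδ hw
  obtain ⟨K₁, hK₁, hb₁, hL₁⟩ := exists_exp_time_bound hT hl0 hl1.le ω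
  obtain ⟨K₂, hK₂, hb₂, hL₂⟩ := exists_exp_time_bound hT hl0 hl1.le (-ω)
  refine ⟨2 * K₁ * (2 * (2 * K₂)), by positivity, fun f B hf => ?_⟩
  have hf' := hf.smul_time hT hK₂ (by fun_prop) hb₂ fun _ => hL₂
  obtain ⟨v, hv, hveq⟩ := exists_neumann_solution hT hδ hω
    (fun u v B₁ B₂ hu hv t ht x => by
      rw [heatPot_congr hT fun t ht x => bilinOp_add b₁ b₂ hu hv ht x]
      exact heatPot_add hμ hT (by linarith : 0 ≤ δ + δ + 1)
        (hw.bilinOp hT hδ hδ b₁ b₂ hu).holderBound (hw.bilinOp hT hδ hδ b₁ b₂ hv).holderBound t x)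
    (fun u v huv => heatPot_congr hT fun t ht x => bilinOp_congr b₁ b₂ huv ht x) hf'
  refine ⟨fun t x => Real.exp (ω * t) • v t x,
    (hv.smul_time hT hK₁ (by fun_prop) hb₁ fun _ => hL₁).mono hT le_rfl le_rfl le_rfl
      (le_of_eq (by ring)), fun t ht x => ?_⟩
  rw [heatPot_bilinOp_exp_smul b₁ b₂ hT hv ht x, ← smul_add, hveq t ht x]
  simpa using exp_neg_smul_exp_smul (-ω) t (f t x)

/-- Uniqueness for the Volterra equation `u + Ψ b(w, u) = f`. -/
theorem volterra_unique (hμ : 0 < μ) (hT : 0 ≤ T) (hl0 : 0 ≤ lam)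
    (hl1 : lam < 1) (hδ : 0 ≤ δ) {A₁ A₂ : ℝ} (hw : ParabolicClass T lam (M + 1) 0 δ A w)
    (hu : ParabolicClass T lam (M + 1) 0 δ A₁ u) (hv : ParabolicClass T lam (M + 1) 0 δ A₂ v)
    (h : ∀ t ∈ Set.Icc 0 T, ∀ x, u t x + heatPot μ 0 T (bilinOp b₁ b₂ w u) t x =
      v t x + heatPot μ 0 T (bilinOp b₁ b₂ w v) t x) :
    ∀ t ∈ Set.Icc 0 T, ∀ x, u t x = v t x := by
  obtain ⟨ω, hω⟩ := exists_contraction (μ := μ) b₁ b₂ hμ hT hl0 hl1 hδ hw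
  obtain ⟨K, hK, hb, hL⟩ := exists_exp_time_bound hT hl0 hl1.le (-ω)
  have hd := (hu.add hv.neg)
  have hd' := hd.smul_time hT hK (by fun_prop) hb fun _ => hL
  set d : ℝ → Spc n → E := fun t x => u t x + -v t x with hdef
  set d' : ℝ → Spc n → E := fun t x => Real.exp (-ω * t) • d t x with hdef'
  have hde : ∀ t ∈ Set.Icc 0 T, ∀ x, d t x = Real.exp (ω * t) • d' t x := fun t _ x => by
    have := exp_neg_smul_exp_smul (-ω) t (d t x)
    rw [neg_neg] at this
    exact this.symm
  have hpot : ∀ t ∈ Set.Icc 0 T, ∀ x, d t x + heatPot μ 0 T (bilinOp b₁ b₂ w d) t x = 0 :=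
    fun t ht x => by
      have e1 : heatPot μ 0 T (bilinOp b₁ b₂ w u) =
          heatPot μ 0 T (fun s y => bilinOp b₁ b₂ w d s y + bilinOp b₁ b₂ w v s y) :=
        heatPot_congr hT fun t ht x => by
          rw [← bilinOp_add b₁ b₂ hd hv ht x]
          exact bilinOp_congr b₁ b₂ (fun t ht x => by simp [hdef]) ht x
      have h1 := h t ht x
      rw [e1, heatPot_add hμ hT (by linarith : 0 ≤ δ + δ + 1)
        (hw.bilinOp hT hδ hδ b₁ b₂ hd).holderBound
        (hw.bilinOp hT hδ hδ b₁ b₂ hv).holderBound t x] at h1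
      rw [hdef, add_right_comm, ← sub_eq_add_neg, sub_eq_zero]
      rw [← add_assoc] at h1
      exact add_right_cancel h1
  have h0 : ∀ t ∈ Set.Icc 0 T, ∀ x, d' t x + heatPot μ ω T (bilinOp b₁ b₂ w d') t x = 0 :=
    fun t ht x => by
      have h1 := hpot t ht x
      rw [hde t ht x, heatPot_congr hT fun t ht x => bilinOp_congr b₁ b₂ hde ht x,
        heatPot_bilinOp_exp_smul b₁ b₂ hT hd' ht x, ← smul_add] at h1
      exact (smul_eq_zero.1 h1).resolve_left (Real.exp_pos _).ne'
  intro t ht x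
  have := eq_zero_of_add_contraction_eq_zero hT hδ hω hd' h0 ht x
  have h1 := hde t ht x
  rw [this, smul_zero] at h1
  exact add_neg_eq_zero.1 h1

/-- Solutions of the Volterra equation inherit the time regularity of the data. -/
theorem exists_volterra_regularity [CompleteSpace E] (hμ : 0 < μ) (hT : 0 ≤ T) (hl0 : 0 ≤ lam)
    (hl1 : lam ≤ 1) (hδ : 0 ≤ δ) (hw : ParabolicClass T lam (M + 1) J δ A w) :
    ∃ C : ℝ, 0 ≤ C ∧ ∀ (f u : ℝ → Spc n → E) (B : ℝ), ParabolicClass T lam (M + 1) J δ B f →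
      ParabolicClass T lam (M + 1) 0 δ B u → (∀ t ∈ Set.Icc 0 T, ∀ x,
        u t x + heatPot μ 0 T (bilinOp b₁ b₂ w u) t x = f t x) →
      ParabolicClass T lam (M + 1) J δ (C * B) u := by
  induction J with
  | zero => exact ⟨1, zero_le_one, fun f u B _ hu _ => by rwa [one_mul]⟩
  | succ J ih =>
    obtain ⟨C, hC, h⟩ := ih (hw.mono hT le_rfl (Nat.le_succ J) le_rfl le_rfl)
    obtain ⟨C', hC', h'⟩ := exists_heatPot_bilinOp_bound b₁ b₂ hμ hT hl0 hl1 hδ M J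
    have hA := hw.nonneg hT
    refine ⟨1 + C' * (A * C), by positivity, fun f u B hf hu he => ?_⟩
    have hu' := h f u B (hf.mono hT le_rfl (Nat.le_succ J) le_rfl le_rfl) hu he
    have hp := h' _ _ _ _ (hw.mono hT le_rfl (Nat.le_succ J) le_rfl le_rfl) hu'
    refine ((hf.add hp.neg).mono hT le_rfl le_rfl le_rfl (le_of_eq (by ring))).congr
      fun t ht x => ?_
    rw [← sub_eq_add_neg, eq_sub_iff_add_eq, he t ht x]

/-- Solvability of the Volterra equation in the full parabolic classes. -/
theorem exists_volterra_solution_regular [CompleteSpace E] (hμ : 0 < μ) (hT : 0 ≤ T)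
    (hl0 : 0 ≤ lam) (hl1 : lam < 1) (hδ : 0 ≤ δ) (hw : ParabolicClass T lam (M + 1) J δ A w) :
    ∃ C : ℝ, 0 ≤ C ∧ ∀ (f : ℝ → Spc n → E) (B : ℝ), ParabolicClass T lam (M + 1) J δ B f →
      ∃ u, ParabolicClass T lam (M + 1) J δ (C * B) u ∧ ∀ t ∈ Set.Icc 0 T, ∀ x,
        u t x + heatPot μ 0 T (bilinOp b₁ b₂ w u) t x = f t x := by
  obtain ⟨C, hC, h⟩ := exists_volterra_solution (μ := μ) b₁ b₂ hμ hT hl0 hl1 hδ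
    (hw.mono hT le_rfl (Nat.zero_le J) le_rfl le_rfl)
  obtain ⟨C', hC', h'⟩ := exists_volterra_regularity (μ := μ) b₁ b₂ hμ hT hl0 hl1.le hδ hw
  refine ⟨C' * (C + 1), by positivity, fun f B hf => ?_⟩
  have hB := hf.nonneg hT
  obtain ⟨u, hu, he⟩ := h f B (hf.mono hT le_rfl (Nat.zero_le J) le_rfl le_rfl)
  refine ⟨u, ?_, he⟩
  rw [mul_assoc]
  refine h' f u _ (hf.mono hT le_rfl le_rfl le_rfl ?_) (hu.mono hT le_rfl le_rfl le_rfl ?_) he <;>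
    nlinarith

end VolterraSolve

section Forms

variable {q : ℕ} {T lam p A μ ω : ℝ} {N J : ℕ}

/-- The `I`-th coefficient of the derivative in the `i`-th coordinate direction. -/
def coordDeriv (i : Fin n) (I : Idx n q) : (Spc n →L[ℝ] Fib n q) →L[ℝ] ℝ :=
  (ContinuousLinearMap.proj I).comp
    (ContinuousLinearMap.apply ℝ (Fib n q) (EuclideanSpace.single i (1 : ℝ)))

/-- The exterior derivative as a linear map on Jacobians. -/
def extDerivSymbol (n q : ℕ) : (Spc n →L[ℝ] Fib n q) →L[ℝ] Fib n (q + 1) :=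
  ContinuousLinearMap.pi fun J => ∑ i : Fin n,
    if h : i ∈ J.1 then
      (-1 : ℝ) ^ (J.1.filter fun j => j < i).card •
        coordDeriv i ⟨J.1.erase i, by simp [Finset.card_erase_of_mem h, J.2]⟩
    else 0

/-- The exterior derivative on forms of one degree lower as a linear map on Jacobians. -/
def extDerivLowSymbol (n q : ℕ) : (Spc n →L[ℝ] Fib n (q - 1)) →L[ℝ] Fib n q :=
  ContinuousLinearMap.pi fun J => ∑ i : Fin n,
    if h : i ∈ J.1 ∧ (J.1.erase i).card = q - 1 then
      (-1 : ℝ) ^ (J.1.filter fun j => j < i).card • coordDeriv i ⟨J.1.erase i, h.2⟩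
    else 0

/-- The codifferential as a linear map on Jacobians. -/
def coDerivSymbol (n q : ℕ) : (Spc n →L[ℝ] Fib n q) →L[ℝ] Fib n (q - 1) :=
  ContinuousLinearMap.pi fun K => -∑ i : Fin n,
    if h : i ∉ K.1 ∧ (insert i K.1).card = q then
      (-1 : ℝ) ^ (K.1.filter fun j => j < i).card • coordDeriv i ⟨insert i K.1, h.2⟩
    else 0

theorem pd_eq_coordDeriv {u : FormT n q} {t : ℝ} {x : Spc n}
    (hu : DifferentiableAt ℝ (fib u t) x) (i : Fin n) (I : Idx n q) :
    pd i (u I t) x = coordDeriv i I (fderiv ℝ (fib u t) x) := by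
  have h := hasFDerivAt_pi'.1 hu.hasFDerivAt I
  have e : (fun y => fib u t y I) = u I t := rfl
  rw [e] at h
  rw [pd, h.fderiv]
  rfl

theorem ddFib_eq {u : FormT n q} {t : ℝ} {x : Spc n} (hu : DifferentiableAt ℝ (fib u t) x) :
    ddFib u t x = ((extDerivSymbol n q).prod (coDerivSymbol n q)) (fderiv ℝ (fib u t) x) := by
  refine Prod.ext (funext fun J => ?_) (funext fun K => ?_)
  · simp only [ddFib, dT, dS, ContinuousLinearMap.prod_apply, extDerivSymbol,
      ContinuousLinearMap.coe_pi', sum_apply]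
    refine Finset.sum_congr rfl fun i _ => ?_
    split_ifs with h
    · rw [smul_apply, smul_eq_mul, ← pd_eq_coordDeriv hu]
    · rfl
  · simp only [ddFib, coDT, coDS, ContinuousLinearMap.prod_apply, coDerivSymbol,
      ContinuousLinearMap.coe_pi', neg_apply, sum_apply]
    refine congrArg Neg.neg (Finset.sum_congr rfl fun i _ => ?_)
    split_ifs with h
    · rw [smul_apply, smul_eq_mul, ← pd_eq_coordDeriv hu]
    · rfl

theorem fib_dLowT {u : FormT n (q - 1)} {t : ℝ} {x : Spc n}
    (hu : DifferentiableAt ℝ (fib u t) x) :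
    fib (dLowT u : FormT n q) t x = extDerivLowSymbol n q (fderiv ℝ (fib u t) x) := by
  funext J
  simp only [fib, dLowT, dLowS, extDerivLowSymbol,
    ContinuousLinearMap.coe_pi', sum_apply]
  refine Finset.sum_congr rfl fun i _ => ?_
  split_ifs with h
  · rw [smul_apply, smul_eq_mul, ← pd_eq_coordDeriv hu]
  · rfl

variable (M₁ : M1Type n q) (M₂ : M2Type n q)

/-- `M₁` applied to the symbol of `d ⊕ d^*`. -/
def gradSymbol : (Spc n →L[ℝ] Fib n q) →L[ℝ] Fib n q →L[ℝ] Fib n q :=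
  (LinearMap.toContinuousBilinearMap M₁).comp
    ((extDerivSymbol n q).prod (coDerivSymbol n q))

/-- The symmetrization of `M₂`. -/
def symM2 : Fib n q →L[ℝ] Fib n q →L[ℝ] Fib n (q - 1) :=
  LinearMap.toContinuousBilinearMap M₂ + (LinearMap.toContinuousBilinearMap M₂).flip

/-- The part of `B_q` containing derivatives of the second argument. -/
def bopRight : Fib n q →L[ℝ] (Spc n →L[ℝ] Fib n q) →L[ℝ] Fib n q :=
  (gradSymbol M₁).flip + (ContinuousLinearMap.compL ℝ _ _ _ (extDerivLowSymbol n q)).comp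
    (ContinuousLinearMap.precompR (Spc n) (symM2 M₂))

/-- The part of `B_q` containing derivatives of the first argument. -/
def bopLeft : (Spc n →L[ℝ] Fib n q) →L[ℝ] Fib n q →L[ℝ] Fib n q :=
  gradSymbol M₁ + (ContinuousLinearMap.compL ℝ _ _ _ (extDerivLowSymbol n q)).comp
    (ContinuousLinearMap.precompL (Spc n) (symM2 M₂))

theorem fib_Bop {w u : FormT n q} {t : ℝ} {x : Spc n} (hw : DifferentiableAt ℝ (fib w t) x)
    (hu : DifferentiableAt ℝ (fib u t) x) :
    fib (Bop M₁ M₂ w u) t x = bilinOp (bopRight M₁ M₂) (bopLeft M₁ M₂) (fib w) (fib u) t x := by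
  set P : FormT n (q - 1) := fun K t' x' =>
    M₂ (fib u t' x') (fib w t' x') K + M₂ (fib w t' x') (fib u t' x') K with hP
  have hPe : fib P t = fun y => symM2 M₂ (fib w t y) (fib u t y) := by
    funext y K
    exact add_comm _ _
  have hd := (symM2 M₂).hasFDerivAt_of_bilinear hw.hasFDerivAt hu.hasFDerivAt
  rw [← hPe] at hd
  have h1 : fib (Bop M₁ M₂ w u) t x =
      M₁ (ddFib u t x) (fib w t x) + M₁ (ddFib w t x) (fib u t x) +
        fib (dLowT P : FormT n q) t x := rfl
  rw [h1, fib_dLowT hd.differentiableAt, hd.fderiv, ddFib_eq hu, ddFib_eq hw, map_add]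
  simp only [bilinOp, bopRight, bopLeft, add_apply]
  exact add_add_add_comm _ _ _ _

theorem heatPot_clm {E F : Type} [NormedAddCommGroup E] [NormedSpace ℝ E]
    [NormedAddCommGroup F] [NormedSpace ℝ F] [CompleteSpace E] [CompleteSpace F]
    (L : E →L[ℝ] F) (hμ : 0 < μ) (hT : 0 ≤ T) (hp : 0 ≤ p) {f : ℝ → Spc n → E}
    (hf : HolderBound T lam p A f) (t : ℝ) (x : Spc n) :
    heatPot μ ω T (fun s y => L (f s y)) t x = L (heatPot μ ω T f t x) := by
  have hκ := rapidDecay_gaussOp (n := n) (E := E) hμ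
  rw [heatPot, heatPot, pot, pot, ← L.intervalIntegral_comp_comm
    ((continuous_pot_slice hκ hT hp (continuous_heatDensity ω) hf t x).intervalIntegrable _ _)]
  refine intervalIntegral.integral_congr fun ρ _ => ?_
  simp only [map_smul]
  rw [heatAvg, heatAvg, ← L.integral_comp_comm
    (integrable_heatAvg hκ (hf.continuous_slice_clamp hT _)
      (hf.norm_le hT hp (clampTime_mem hT _)) ρ x)]
  simp only [gaussOp, smul_apply, ContinuousLinearMap.id_apply, map_smul]

theorem fib_volPotF (hμ : 0 < μ) (hT : 0 ≤ T) (hp : 0 ≤ p) {f : FormT n q}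
    (hf : HolderBound T lam p A (fib f)) {t : ℝ} (ht : t ∈ Set.Icc 0 T) (x : Spc n) :
    fib (volPotF μ f) t x = heatPot μ 0 T (fib f) t x := by
  funext I
  have hL := hf.clm (ContinuousLinearMap.proj (R := ℝ) (φ := fun _ : Idx n q => ℝ) I) le_rfl
  have h1 : volPot μ (f I) t x = heatPot μ 0 T (f I) t x := volPot_eq_heatPot hμ hT hp hL ht x
  exact h1.trans (heatPot_clm
    (ContinuousLinearMap.proj (R := ℝ) (φ := fun _ : Idx n q => ℝ) I) hμ hT hp hf t x)

theorem ParabolicClass.differentiableAt {E : Type} [NormedAddCommGroup E] [NormedSpace ℝ E]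
    {v : ℝ → Spc n → E} (h : ParabolicClass T lam (N + 1) J p A v) {t : ℝ}
    (ht : t ∈ Set.Icc 0 T) (x : Spc n) : DifferentiableAt ℝ (v t) x := by
  obtain ⟨v', hv, -⟩ := h.exists_fderiv
  exact (hv t ht x).differentiableAt

theorem fib_volPotF_Bop {B : ℝ} (hμ : 0 < μ) (hT : 0 ≤ T) (hp : 0 ≤ p) {w u : FormT n q}
    (hw : ParabolicClass T lam (N + 1) J p A (fib w))
    (hu : ParabolicClass T lam (N + 1) J p B (fib u)) {t : ℝ} (ht : t ∈ Set.Icc 0 T) (x : Spc n) :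
    fib (volPotF μ (Bop M₁ M₂ w u)) t x =
      heatPot μ 0 T (bilinOp (bopRight M₁ M₂) (bopLeft M₁ M₂) (fib w) (fib u)) t x := by
  have he : ∀ t ∈ Set.Icc 0 T, ∀ x, fib (Bop M₁ M₂ w u) t x =
      bilinOp (bopRight M₁ M₂) (bopLeft M₁ M₂) (fib w) (fib u) t x := fun t ht x =>
    fib_Bop M₁ M₂ (hw.differentiableAt ht x) (hu.differentiableAt ht x)
  have hb := ((hw.bilinOp hT hp hp (bopRight M₁ M₂) (bopLeft M₁ M₂) hu).congr he).holderBound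
  rw [fib_volPotF hμ hT (by linarith : 0 ≤ p + p + 1) hb ht x, heatPot_congr hT he]

theorem ParabolicClass.zero {E : Type} [NormedAddCommGroup E] [NormedSpace ℝ E] :
    ParabolicClass T lam N J p 0 (fun (_ : ℝ) (_ : Spc n) => (0 : E)) := by
  induction N using Nat.strong_induction_on generalizing J p E with
  | _ N ih =>
    refine parabolicClass_iff.2 ⟨⟨continuousOn_const, by simp, by simp, by simp⟩, ?_, ?_⟩
    · rintro M rfl
      exact ⟨fun _ _ => 0, fun t _ x => hasFDerivAt_const _ _, ih M (by omega)⟩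
    · rintro M K rfl rfl
      exact ⟨fun _ _ => 0, fun t _ x => hasDerivWithinAt_const _ _ _, ih M (by omega)⟩

theorem ParabolicClass.sum {E : Type} [NormedAddCommGroup E] [NormedSpace ℝ E] {ι : Type}
    (S : Finset ι) {v : ι → ℝ → Spc n → E} (h : ∀ i ∈ S, ParabolicClass T lam N J p A (v i)) :
    ParabolicClass T lam N J p (S.card * A) (fun t x => ∑ i ∈ S, v i t x) := by
  induction S using Finset.induction_on with
  | empty => simpa using ParabolicClass.zero (n := n) (E := E)
  | insert a S ha ih =>
    have h1 := (h a (Finset.mem_insert_self a S)).add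
      (ih fun i hi => h i (Finset.mem_insert_of_mem hi))
    have e : A + S.card * A = ((insert a S).card : ℝ) * A := by
      rw [Finset.card_insert_of_notMem ha]; push_cast; ring
    rw [e] at h1
    exact h1.congr fun t _ x => Finset.sum_insert ha

theorem ParabolicClass.of_components {u : FormT n q} (h : ∀ I, ParabolicClass T lam N J p A (u I)) :
    ParabolicClass T lam N J p (Fintype.card (Idx n q) * A) (fib u) := by
  have h1 : ∀ I ∈ (Finset.univ : Finset (Idx n q)), ParabolicClass T lam N J p A
      (fun t x => ContinuousLinearMap.single ℝ (fun _ : Idx n q => ℝ) I (u I t x)) :=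
    fun I _ => by
      have h2 := (h I).clm (ContinuousLinearMap.single ℝ (fun _ : Idx n q => ℝ) I) (b := 1)
        (ContinuousLinearMap.opNorm_le_bound _ zero_le_one fun r => by
          rw [one_mul]
          refine (pi_norm_le_iff_of_nonneg (norm_nonneg r)).2 fun K => ?_
          by_cases hK : K = I
          · subst hK; simp
          · simp [hK])
      rwa [one_mul] at h2
  refine (ParabolicClass.sum _ h1).congr fun t _ x => funext fun K => ?_
  simp [fib, Finset.sum_apply, Pi.single_apply]

theorem ParabolicClass.component {u : FormT n q} (h : ParabolicClass T lam N J p A (fib u))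
    (I : Idx n q) : ParabolicClass T lam N J p A (u I) := by
  have h1 := h.clm (ContinuousLinearMap.proj (R := ℝ) (φ := fun _ : Idx n q => ℝ) I) (b := 1)
    (ContinuousLinearMap.opNorm_le_bound _ zero_le_one fun r => by
      rw [one_mul]; exact norm_le_pi_norm r I)
  rw [one_mul] at h1
  exact h1

end Forms

section FSpaces

variable {q k s : ℕ} {T lam lam' δ A : ℝ}

theorem AnisoReg.of_succ {v : ℝ → Spc n → ℝ} (h : AnisoReg T (k + 1) s v) : AnisoReg T k s v := by
  refine ⟨h.1, fun j hj t ht => (h.2.1 j hj t ht).of_le ?_, fun j m hj hm =>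
    h.2.2 j m hj (by omega)⟩
  gcongr
  exact le_self_add

/-- Constant comparing the `𝓕`-norm with the parabolic classes. -/
def fConst (n q k s : ℕ) (lam lam' δ : ℝ) : ℝ :=
  Fintype.card (Idx n q) * (anisoConst (k + 1) s lam δ + anisoConst k s lam' δ)

theorem fConst_nonneg : 0 ≤ fConst n q k s lam lam' δ := by
  have h1 := anisoConst_pos (k := k + 1) (s := s) (lam := lam) (p := δ)
  have h2 := anisoConst_pos (k := k) (s := s) (lam := lam') (p := δ)
  unfold fConst
  positivity

/-- Membership of the fibre map in both parabolic classes defining the space `𝓕`. -/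
def FClass (T : ℝ) (k s : ℕ) (lam lam' δ A : ℝ) {E : Type} [NormedAddCommGroup E]
    [NormedSpace ℝ E] (v : ℝ → Spc n → E) : Prop :=
  ParabolicClass T lam (2 * s + (k + 1)) s δ A v ∧ ParabolicClass T lam' (2 * s + k) s δ A v

theorem FMemF.fClass (hT : 0 < T) (h1 : 0 < lam) (h2 : lam < 1) (h1' : 0 < lam') (h2' : lam' < 1)
    (hδ : 0 ≤ δ) {u : FormT n q} (hu : FMemF T k s lam lam' δ u) :
    FClass T k s lam lam' δ (fConst n q k s lam lam' δ * (eFF T k s lam lam' δ u).toReal)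
      (fib u) := by
  set A := (eFF T k s lam lam' δ u).toReal with hA
  have hA0 : 0 ≤ A := ENNReal.toReal_nonneg
  have hle : ∀ I, eFn T k s lam lam' δ (u I) ≤ ENNReal.ofReal A := fun I => by
    rw [hA, ENNReal.ofReal_toReal hu.2]
    exact Finset.single_le_sum (f := fun I => eFn T k s lam lam' δ (u I))
      (fun _ _ => zero_le) (Finset.mem_univ I)
  have c1 := anisoConst_pos (k := k + 1) (s := s) (lam := lam) (p := δ)
  have c2 := anisoConst_pos (k := k) (s := s) (lam := lam') (p := δ)
  constructor
  · refine (ParabolicClass.of_components fun I => ParabolicClass.of_eAnisoKS hT h1 h2 hδ hA0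
      (hu.1 I) (le_self_add.trans (hle I))).mono hT.le le_rfl le_rfl le_rfl ?_
    rw [fConst, mul_assoc]
    gcongr
    linarith
  · refine (ParabolicClass.of_components fun I => ParabolicClass.of_eAnisoKS hT h1' h2' hδ hA0
      (hu.1 I).of_succ (le_add_self.trans (hle I))).mono hT.le le_rfl le_rfl le_rfl ?_
    rw [fConst, mul_assoc]
    gcongr
    linarith

theorem FClass.fMemF (hT : 0 < T) (h1 : 0 < lam) (h1' : 0 < lam') (hδ : 0 ≤ δ) {u : FormT n q}
    (hu : FClass T k s lam lam' δ A (fib u)) :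
    FMemF T k s lam lam' δ u ∧
      eFF T k s lam lam' δ u ≤ ENNReal.ofReal (fConst n q k s lam lam' δ * A) := by
  have hA := hu.1.nonneg hT.le
  have c1 := anisoConst_pos (k := k + 1) (s := s) (lam := lam) (p := δ)
  have c2 := anisoConst_pos (k := k) (s := s) (lam := lam') (p := δ)
  have hle : eFF T k s lam lam' δ u ≤ ENNReal.ofReal (fConst n q k s lam lam' δ * A) := by
    have hI : ∀ I ∈ (Finset.univ : Finset (Idx n q)), eFn T k s lam lam' δ (u I) ≤
        ENNReal.ofReal ((anisoConst (k + 1) s lam δ + anisoConst k s lam' δ) * A) := fun I _ => by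
      rw [add_mul, ENNReal.ofReal_add (by positivity) (by positivity)]
      exact add_le_add ((hu.1.component I).eAnisoKS_le hT h1 hδ)
        ((hu.2.component I).eAnisoKS_le hT h1' hδ)
    refine (Finset.sum_le_card_nsmul _ _ _ hI).trans (le_of_eq ?_)
    rw [fConst, mul_assoc, ENNReal.ofReal_mul (Nat.cast_nonneg _), ENNReal.ofReal_natCast,
      nsmul_eq_mul, Finset.card_univ]
  exact ⟨⟨fun I => (hu.1.component I).anisoReg hT, ne_top_of_le_ne_top ENNReal.ofReal_ne_top hle⟩,
    hle⟩

end FSpaces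

section Invertibility

variable {q k s : ℕ} {T lam lam' δ A B K μ : ℝ}

theorem ParabolicClass.exists_succ {E : Type} [NormedAddCommGroup E] [NormedSpace ℝ E] {N J : ℕ}
    {v : ℝ → Spc n → E} (h : ParabolicClass T lam (N + 1) J δ A v) (hT : 0 ≤ T) :
    ParabolicClass T 0 (0 + 1) 0 δ A v :=
  (h.mono hT (by omega) (Nat.zero_le J) le_rfl le_rfl).sup_only

theorem exists_fClass_heatPot_bound {E : Type} [NormedAddCommGroup E] [NormedSpace ℝ E]
    [CompleteSpace E] (b₁ : E →L[ℝ] (Spc n →L[ℝ] E) →L[ℝ] E)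
    (b₂ : (Spc n →L[ℝ] E) →L[ℝ] E →L[ℝ] E) (hμ : 0 < μ) (hT : 0 ≤ T) (hk : 1 ≤ k)
    (h1 : 0 ≤ lam) (h2 : lam ≤ 1) (h1' : 0 ≤ lam') (h2' : lam' ≤ 1) (hδ : 0 ≤ δ)
    {w : ℝ → Spc n → E} (hw : FClass T k s lam lam' δ A w) :
    ∃ C : ℝ, 0 ≤ C ∧ ∀ (u : ℝ → Spc n → E) (B : ℝ), FClass T k s lam lam' δ B u →
      FClass T k s lam lam' δ (C * B)
        (fun t x => u t x + heatPot μ 0 T (bilinOp b₁ b₂ w u) t x) := by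
  obtain ⟨k, rfl⟩ : ∃ m, k = m + 1 := ⟨k - 1, by omega⟩
  obtain ⟨C₁, hC₁, hb₁⟩ := exists_heatPot_bilinOp_bound b₁ b₂ hμ hT h1 h2 hδ (2 * s + (k + 1)) s
  obtain ⟨C₂, hC₂, hb₂⟩ := exists_heatPot_bilinOp_bound b₁ b₂ hμ hT h1' h2' hδ (2 * s + k) s
  have hA := hw.1.nonneg hT
  refine ⟨1 + (C₁ + C₂) * A, by positivity, fun u B hu => ?_⟩
  have hB := hu.1.nonneg hT
  have hAB := mul_nonneg hA hB
  constructor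
  · refine (hu.1.add ((hb₁ _ _ _ _ hw.1 hu.1).mono hT le_rfl (Nat.le_succ s) le_rfl
      le_rfl)).mono hT le_rfl le_rfl le_rfl ?_
    linarith [mul_nonneg hC₂ hAB]
  · refine (hu.2.add ((hb₂ _ _ _ _ hw.2 hu.2).mono hT le_rfl (Nat.le_succ s) le_rfl
      le_rfl)).mono hT le_rfl le_rfl le_rfl ?_
    linarith [mul_nonneg hC₁ hAB]

theorem exists_fClass_volterra_solution {E : Type} [NormedAddCommGroup E] [NormedSpace ℝ E]
    [CompleteSpace E] (b₁ : E →L[ℝ] (Spc n →L[ℝ] E) →L[ℝ] E)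
    (b₂ : (Spc n →L[ℝ] E) →L[ℝ] E →L[ℝ] E) (hμ : 0 < μ) (hT : 0 ≤ T) (hk : 1 ≤ k)
    (h1 : 0 ≤ lam) (h2 : lam < 1) (h1' : 0 ≤ lam') (h2' : lam' < 1) (hδ : 0 ≤ δ)
    {w : ℝ → Spc n → E} (hw : FClass T k s lam lam' δ A w) :
    ∃ C : ℝ, 0 ≤ C ∧ ∀ (f : ℝ → Spc n → E) (B : ℝ), FClass T k s lam lam' δ B f →
      ∃ u, FClass T k s lam lam' δ (C * B) u ∧ ∀ t ∈ Set.Icc 0 T, ∀ x,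
        u t x + heatPot μ 0 T (bilinOp b₁ b₂ w u) t x = f t x := by
  obtain ⟨k, rfl⟩ : ∃ m, k = m + 1 := ⟨k - 1, by omega⟩
  obtain ⟨C₁, hC₁, hs₁⟩ := exists_volterra_solution_regular (μ := μ) b₁ b₂ hμ hT h1 h2 hδ
    (M := 2 * s + (k + 1)) hw.1
  obtain ⟨C₂, hC₂, hs₂⟩ := exists_volterra_solution_regular (μ := μ) b₁ b₂ hμ hT h1' h2' hδ
    (M := 2 * s + k) hw.2
  refine ⟨C₁ + C₂, by positivity, fun f B hf => ?_⟩
  obtain ⟨u, hu, hue⟩ := hs₁ f B hf.1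
  obtain ⟨v, hv, hve⟩ := hs₂ f B hf.2
  have hB := hf.1.nonneg hT
  have huv := volterra_unique b₁ b₂ hμ hT le_rfl zero_lt_one hδ (hw.2.exists_succ hT)
    (hu.exists_succ hT) (hv.exists_succ hT) fun t ht x => (hue t ht x).trans (hve t ht x).symm
  refine ⟨u, ⟨hu.mono hT le_rfl le_rfl le_rfl ?_,
    (hv.congr huv).mono hT le_rfl le_rfl le_rfl ?_⟩, hue⟩
  · linarith [mul_nonneg hC₂ hB]
  · linarith [mul_nonneg hC₁ hB]

theorem eFF_le_of_fClass (hT : 0 < T) (h1 : 0 < lam) (h1' : 0 < lam') (hδ : 0 ≤ δ)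
    {u v : FormT n q} (hK : 0 ≤ K) (hu : FMemF T k s lam lam' δ u)
    (hv : FClass T k s lam lam' δ
      (K * (fConst n q k s lam lam' δ * (eFF T k s lam lam' δ u).toReal)) (fib v)) {C : ℝ}
    (hC : fConst n q k s lam lam' δ * K * fConst n q k s lam lam' δ ≤ C) :
    FMemF T k s lam lam' δ v ∧
      eFF T k s lam lam' δ v ≤ ENNReal.ofReal C * eFF T k s lam lam' δ u := by
  have hf := fConst_nonneg (n := n) (q := q) (k := k) (s := s) (lam := lam) (lam' := lam') (δ := δ)
  obtain ⟨hm, hle⟩ := hv.fMemF hT h1 h1' hδ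
  refine ⟨hm, hle.trans ?_⟩
  rw [show fConst n q k s lam lam' δ *
      (K * (fConst n q k s lam lam' δ * (eFF T k s lam lam' δ u).toReal)) =
      fConst n q k s lam lam' δ * K * fConst n q k s lam lam' δ *
        (eFF T k s lam lam' δ u).toReal by ring, ENNReal.ofReal_mul (by positivity),
    ENNReal.ofReal_toReal hu.2]
  gcongr

end Invertibility

end HeatPotential

/-- `I + Ψ_{μ,q}B_q(w,·)` is continuously invertible on
`𝓕^{k,𝐬(s,λ,λ',δ)}_{T,Λ^q}`. -/
theorem stmt8 (n q s k : ℕ) (hn : 2 ≤ n) (hq : q ≤ n) (hs : 1 ≤ s) (hk : 1 ≤ k)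
    (lam lam' δ μ T : ℝ) (h1 : 0 < lam) (h2 : lam < lam') (h3 : lam' < 1)
    (hδ : (n : ℝ) / 2 < δ) (hμ : 0 < μ) (hT : 0 < T)
    (M₁ : M1Type n q) (M₂ : M2Type n q) (w : FormT n q)
    (hw : FMemF T k s lam lam' δ w) :
    ∃ C : ℝ, 0 < C ∧
      (∀ u : FormT n q, FMemF T k s lam lam' δ u →
        FMemF T k s lam lam' δ (u + volPotF μ (Bop M₁ M₂ w u)) ∧
        eFF T k s lam lam' δ (u + volPotF μ (Bop M₁ M₂ w u)) ≤
          ENNReal.ofReal C * eFF T k s lam lam' δ u) ∧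
      ∀ f : FormT n q, FMemF T k s lam lam' δ f →
        ∃ u : FormT n q, FMemF T k s lam lam' δ u ∧
          EqOnT T (u + volPotF μ (Bop M₁ M₂ w u)) f ∧
          eFF T k s lam lam' δ u ≤ ENNReal.ofReal C * eFF T k s lam lam' δ f ∧
          ∀ u' : FormT n q, FMemF T k s lam lam' δ u' →
            EqOnT T (u' + volPotF μ (Bop M₁ M₂ w u')) f → EqOnT T u' u := by
  have hδ0 : 0 ≤ δ := (div_nonneg (Nat.cast_nonneg n) zero_le_two).trans hδ.le
  have h1' : 0 < lam' := h1.trans h2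
  have h2' : lam < 1 := h2.trans h3
  have hF := fun {u : FormT n q} (hu : FMemF T k s lam lam' δ u) =>
    hu.fClass hT h1 h2' h1' h3 hδ0
  have hW := hF hw
  have hpot := fun {u : FormT n q} (hu : FMemF T k s lam lam' δ u) =>
    fun t ht x => fib_volPotF_Bop (T := T) M₁ M₂ hμ hT.le hδ0 hW.1 (hF hu).1 (t := t) ht x
  obtain ⟨K₁, hK₁, hdir⟩ := exists_fClass_heatPot_bound (μ := μ) (bopRight M₁ M₂) (bopLeft M₁ M₂)
    hμ hT.le hk h1.le h2'.le h1'.le h3.le hδ0 hW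
  obtain ⟨K₂, hK₂, hinv⟩ := exists_fClass_volterra_solution (μ := μ) (bopRight M₁ M₂)
    (bopLeft M₁ M₂) hμ hT.le hk h1.le h2' h1'.le h3 hδ0 hW
  set c := fConst n q k s lam lam' δ with hc
  have hc0 : 0 ≤ c := fConst_nonneg
  have hcK₁ : 0 ≤ c * K₁ * c := by positivity
  have hcK₂ : 0 ≤ c * K₂ * c := by positivity
  refine ⟨c * K₁ * c + c * K₂ * c + 1, by positivity, fun u hu => ?_, fun f hf => ?_⟩
  · refine eFF_le_of_fClass hT h1 h1' hδ0 hK₁ hu ?_ (by linarith)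
    have he : ∀ t ∈ Set.Icc 0 T, ∀ x, fib (u + volPotF μ (Bop M₁ M₂ w u)) t x =
        fib u t x + heatPot μ 0 T
          (bilinOp (bopRight M₁ M₂) (bopLeft M₁ M₂) (fib w) (fib u)) t x := fun t ht x => by
      rw [← hpot hu t ht x]
      rfl
    have h := hdir _ _ (hF hu)
    exact ⟨h.1.congr he, h.2.congr he⟩
  · obtain ⟨v, hv, hve⟩ := hinv _ _ (hF hf)
    set u : FormT n q := fun I t x => v t x I with hu
    obtain ⟨hum, hule⟩ := eFF_le_of_fClass (v := u) hT h1 h1' hδ0 hK₂ hf hv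
      (C := c * K₁ * c + c * K₂ * c + 1) (by linarith)
    refine ⟨u, hum, fun I t ht x => ?_, hule, fun u' hu' he => ?_⟩
    · have h4 := congrFun (hve t ht x) I
      have h5 := congrFun (hpot hum t ht x) I
      exact (congrArg (u I t x + ·) h5).trans h4
    · have huniq := volterra_unique (bopRight M₁ M₂) (bopLeft M₁ M₂) hμ hT.le le_rfl zero_lt_one
        hδ0 (hW.1.exists_succ hT.le) ((hF hu').1.exists_succ hT.le) (hv.1.exists_succ hT.le)
        fun t ht x => by
          rw [hve t ht x, ← hpot hu' t ht x]
          exact funext fun I => he I t ht x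
      exact fun I t ht x => congrFun (huniq t ht x) I

end NSdeRham

end
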